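/- arXiv:2601.04384 — 3 statements merged into one kernel-verified Lean document; each statement's English description precedes it below -/
import Mathlib

section
/- Let A = {a_1, ..., a_n} be a set of n distinct real numbers, and let S be the sum of the elements of a uniformly random k-element subset of A. Then there is an absolute constant C such that for every real number x, P(S = x) ≤ C / (n √(min(k, n−k))). -/
open scoped Classical
open Finset

open scoped Pointwise in
lemma cd_aux {p : ℕ} (hp : p.Prime) [NeZero p] (g : ZMod p → ℝ) (h0 : g 0 = 0)
    (hadd : ∀ x y, g (x + y) ≤ g x + g y) (r : ℝ) (hr : 0 ≤ r) (j : ℕ) (hj : 1 ≤ j) :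
    min p (j * (#{x | g x ≤ r} - 1) + 1) ≤ #{x | g x ≤ j * r} := by
  have hne : ∀ s : ℝ, 0 ≤ s → 1 ≤ #{x | g x ≤ s} := by
    intro s hs
    refine Finset.card_pos.mpr ⟨0, by simp [h0, hs]⟩
  induction j, hj using Nat.le_induction with
  | base =>
    have := hne r hr
    simp only [Nat.cast_one, one_mul]
    omega
  | succ j hj ih =>
    have h1 := hne r hr
    have h2 := hne (j * r) (by positivity)
    have := ZMod.cauchy_davenport hp (s := {x | g x ≤ j * r}) (t := {x | g x ≤ r})
      (Finset.card_pos.mp h2) (Finset.card_pos.mp h1)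
    have h3 : #(({x | g x ≤ j * r} : Finset (ZMod p)) + ({x | g x ≤ r} : Finset (ZMod p))) ≤ #{x | g x ≤ ((j + 1 : ℕ) : ℝ) * r} := by
      apply Finset.card_le_card
      intro z hz
      obtain ⟨x, hx, y, hy, rfl⟩ := Finset.mem_add.mp hz
      simp only [mem_filter, mem_univ, true_and] at hx hy ⊢
      push_cast
      linarith [hadd x y]
    have h4 : (j+1) * (#{x | g x ≤ r} - 1) = j * (#{x | g x ≤ r} - 1) + (#{x | g x ≤ r} - 1) := by ring
    rw [h4]
    omega

lemma cd_bound {p : ℕ} (hp : p.Prime) [NeZero p] (g : ZMod p → ℝ) (h0 : g 0 = 0)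
    (hadd : ∀ x y, g (x + y) ≤ g x + g y) (r r0 K : ℝ) (hr : 0 < r) (hr0 : r ≤ r0)
    (hK : (#{x | g x ≤ r0} : ℝ) ≤ K) (hKp : K < p) :
    (#{x | g x ≤ r} : ℝ) ≤ 1 + K * (2 * r / r0) := by
  set j := ⌊r0 / r⌋₊ with hjdef
  have h1 : 1 ≤ r0 / r := by rwa [le_div_iff₀ hr, one_mul]
  have hj : 1 ≤ j := by
    rw [hjdef, Nat.one_le_floor_iff]; exact h1
  have hjle : (j : ℝ) ≤ r0 / r := Nat.floor_le (by linarith)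
  have hjlt : r0 / r < j + 1 := Nat.lt_floor_add_one _
  have hj1 : (1 : ℝ) ≤ j := by exact_mod_cast hj
  have key := cd_aux hp g h0 hadd r hr.le j hj
  have hsub : #{x | g x ≤ j * r} ≤ #{x | g x ≤ r0} := by
    apply Finset.card_le_card
    intro z hz
    simp only [mem_filter, mem_univ, true_and] at hz ⊢
    rw [le_div_iff₀ hr] at hjle
    linarith
  have hlt : #{x | g x ≤ r0} < p := by exact_mod_cast hK.trans_lt hKp
  have hpos : 1 ≤ #{x | g x ≤ r} := Finset.card_pos.mpr ⟨0, by simp [h0, hr.le]⟩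
  have h5 : j * (#{x | g x ≤ r} - 1) + 1 ≤ #{x | g x ≤ r0} := by omega
  have h6 : (j : ℝ) * ((#{x | g x ≤ r} : ℝ) - 1) + 1 ≤ K := by
    refine le_trans ?_ hK
    rw [← Nat.cast_one (R := ℝ), ← Nat.cast_sub hpos]
    exact_mod_cast h5
  have hK0 : 0 ≤ K := le_trans (by positivity) hK
  have h7 : ((#{x | g x ≤ r} : ℝ) - 1) ≤ K / j := by
    rw [le_div_iff₀ (by linarith)]; nlinarith
  have hr0p : 0 < r0 := by linarith
  have h8 : K / j ≤ K * (2 * r / r0) := by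
    rw [div_eq_mul_inv]
    apply mul_le_mul_of_nonneg_left _ hK0
    rw [inv_le_comm₀ (by linarith) (by positivity), inv_div, ]
    rw [div_lt_iff₀ hr] at hjlt
    rw [div_le_iff₀ (by positivity)]
    nlinarith
  linarith

lemma geo_aux (M : ℕ) : ∑ m ∈ range M, (1/2 : ℝ)^m * (m + 1) ≤ 4 := by
  have : ∑ m ∈ range M, (1/2 : ℝ)^m * (m + 1) = 4 - (1/2)^M * (2 * M + 4) := by
    induction M with
    | zero => norm_num
    | succ n ih => rw [sum_range_succ, ih, pow_succ]; push_cast; ring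
  rw [this]
  have : 0 ≤ (1/2 : ℝ)^M * (2 * M + 4) := by positivity
  linarith

lemma geo_aux2 (M : ℕ) : ∑ m ∈ range M, (1/2 : ℝ)^m ≤ 2 := by
  have : ∑ m ∈ range M, (1/2 : ℝ)^m = 2 - (1/2)^M * 2 := by
    induction M with
    | zero => norm_num
    | succ n ih => rw [sum_range_succ, ih, pow_succ]; ring
  rw [this]
  have : 0 ≤ (1/2 : ℝ)^M * 2 := by positivity
  linarith

lemma sum_exp {α : Type*} (X : Finset α) (g : α → ℝ) (B κ : ℝ) (hB : 0 ≤ B)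
    (hκ : 0 < κ)
    (h : ∀ r > 0, (#{x ∈ X | g x ≤ r} : ℝ) ≤ 1 + B * r) :
    ∑ x ∈ X, Real.exp (-(κ * g x ^ 2)) ≤ 2 + 4 * B / √κ := by
  set M := X.sup (fun x => ⌊κ * g x ^ 2⌋₊) + 1 with hM
  have hmaps : ∀ x ∈ X, ⌊κ * g x ^ 2⌋₊ ∈ range M := by
    intro x hx
    rw [mem_range, hM, Nat.lt_succ_iff]
    exact Finset.le_sup (f := fun x => ⌊κ * g x ^ 2⌋₊) hx
  rw [← Finset.sum_fiberwise_of_maps_to hmaps]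
  have hs : 0 < √κ := Real.sqrt_pos.mpr hκ
  have hss : √κ ^ 2 = κ := Real.sq_sqrt hκ.le
  calc _ ≤ ∑ m ∈ range M, ((1/2 : ℝ)^m + (B / √κ) * ((1/2 : ℝ)^m * (m + 1))) := by
        apply Finset.sum_le_sum
        intro m _
        have h1 : ∑ x ∈ X with ⌊κ * g x ^ 2⌋₊ = m, Real.exp (-(κ * g x ^ 2))
            ≤ ∑ x ∈ X with ⌊κ * g x ^ 2⌋₊ = m, (1/2 : ℝ)^m := by
          apply Finset.sum_le_sum
          intro x hx
          rw [mem_filter] at hx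
          have h2 : (m : ℝ) ≤ κ * g x ^ 2 := by
            rw [← hx.2]; exact Nat.floor_le (by positivity)
          have h3 : Real.exp (-1) ≤ 1/2 := by
            rw [Real.exp_neg, one_div]
            apply inv_anti₀ (by norm_num)
            linarith [Real.add_one_le_exp (1:ℝ)]
          calc Real.exp (-(κ * g x ^ 2)) ≤ Real.exp (m * (-1)) := by
                apply Real.exp_le_exp.mpr; linarith
            _ = Real.exp (-1) ^ m := by rw [Real.exp_nat_mul]
            _ ≤ _ := by gcongr
        refine h1.trans ?_
        rw [sum_const, nsmul_eq_mul]
        have hpos : 0 < ((m:ℝ) + 1) / √κ := by positivity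
        have h4 : (#{x ∈ X | ⌊κ * g x ^ 2⌋₊ = m} : ℝ) ≤ 1 + B * (((m:ℝ) + 1) / √κ) := by
          refine le_trans ?_ (h _ hpos)
          norm_cast
          apply Finset.card_le_card
          intro x hx
          rw [mem_filter] at hx ⊢
          refine ⟨hx.1, ?_⟩
          have h5 : κ * g x ^ 2 < m + 1 := by
            rw [← hx.2]; exact Nat.lt_floor_add_one _
          push_cast
          rw [le_div_iff₀ hs]
          apply le_of_sq_le_sq _ (by positivity)
          rw [mul_pow, hss]
          have : (0:ℝ) ≤ m := by positivity
          nlinarith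
        calc _ ≤ (1 + B * (((m:ℝ) + 1) / √κ)) * (1/2)^m := by gcongr
          _ = _ := by ring
    _ = ∑ m ∈ range M, (1/2 : ℝ)^m + (B / √κ) * ∑ m ∈ range M, ((1/2 : ℝ)^m * (m + 1)) := by
        rw [sum_add_distrib, mul_sum]
    _ ≤ 2 + (B / √κ) * 4 := by
        have h1 := geo_aux M
        have h2 := geo_aux2 M
        gcongr
    _ = _ := by ring

lemma psi_norm {p : ℕ} [NeZero p] (x : ZMod p) : ‖(ZMod.stdAddChar x : ℂ)‖ = 1 := by
  exact AddChar.norm_apply _ _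

lemma unit_sub_one (z : ℂ) (hz : ‖z‖ = 1) : ‖z - 1‖ ^ 2 = 2 - 2 * z.re := by
  have h : z.re ^ 2 + z.im ^ 2 = 1 := by
    have := Complex.sq_norm z
    rw [hz, Complex.normSq_apply] at this
    nlinarith
  rw [Complex.sq_norm, Complex.normSq_apply]
  simp
  nlinarith

lemma sum_psi {p : ℕ} [NeZero p] (b : ZMod p) :
    ∑ x : ZMod p, (ZMod.stdAddChar (x * b) : ℂ) = if b = 0 then (p : ℂ) else 0 := by
  rw [AddChar.sum_mulShift b (ZMod.isPrimitive_stdAddChar p)]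
  simp [ZMod.card]

/-- normalized distance -/
noncomputable def gdist {p : ℕ} [NeZero p] {ι : Type*} [Fintype ι] (c : ι → ZMod p) (θ : ZMod p) : ℝ :=
  √(∑ i, ‖(ZMod.stdAddChar (θ * c i) : ℂ) - 1‖ ^ 2)

lemma gdist_zero {p : ℕ} [NeZero p] {ι : Type*} [Fintype ι] (c : ι → ZMod p) : gdist c 0 = 0 := by
  simp [gdist]

lemma gdist_add {p : ℕ} [NeZero p] {ι : Type*} [Fintype ι] (c : ι → ZMod p) (x y : ZMod p) :
    gdist c (x + y) ≤ gdist c x + gdist c y := by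
  have h := norm_add_le (WithLp.toLp 2 (fun i => (ZMod.stdAddChar (x * c i) : ℂ) - 1) : EuclideanSpace ℂ ι)
    (WithLp.toLp 2 (fun i => (ZMod.stdAddChar (x * c i) : ℂ) * ((ZMod.stdAddChar (y * c i) : ℂ) - 1)))
  rw [EuclideanSpace.norm_eq, EuclideanSpace.norm_eq, EuclideanSpace.norm_eq] at h
  simp only [PiLp.add_apply, norm_mul, psi_norm, one_mul] at h
  unfold gdist
  refine le_trans (le_of_eq ?_) h
  congr 1
  refine Finset.sum_congr rfl fun i _ => ?_
  rw [add_mul, AddChar.map_add_eq_mul]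
  congr 2
  ring

/-- unnormalized exponential sum -/
noncomputable def fsum {p n : ℕ} [NeZero p] (b : Fin n → ZMod p) (θ : ZMod p) : ℂ :=
  ∑ i, (ZMod.stdAddChar (θ * b i) : ℂ)

lemma fsum_norm_le {p n : ℕ} [NeZero p] (b : Fin n → ZMod p) (θ : ZMod p) : ‖fsum b θ‖ ≤ n := by
  unfold fsum
  refine (norm_sum_le _ _).trans ?_
  simp

lemma fsum_sq {p n : ℕ} [NeZero p] (b : Fin n → ZMod p) (θ : ZMod p) :
    ((‖fsum b θ‖ ^ 2 : ℝ) : ℂ) = ∑ ij : Fin n × Fin n, (ZMod.stdAddChar (θ * (b ij.1 - b ij.2)) : ℂ) := by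
  rw [← Complex.normSq_eq_norm_sq, ← Complex.mul_conj, fsum, map_sum, Finset.sum_mul_sum, Fintype.sum_prod_type]
  refine Finset.sum_congr rfl fun i _ => Finset.sum_congr rfl fun j _ => ?_
  rw [mul_sub, sub_eq_add_neg, AddChar.map_add_eq_mul, AddChar.map_neg_eq_conj]

lemma gdist_fsum {p n : ℕ} [NeZero p] (b : Fin n → ZMod p) (θ : ZMod p) :
    gdist (fun ij : Fin n × Fin n => b ij.1 - b ij.2) θ ^ 2 = 2 * ((n:ℝ) ^ 2 - ‖fsum b θ‖ ^ 2) := by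
  have h := congrArg Complex.re (fsum_sq b θ)
  rw [Complex.ofReal_re, Complex.re_sum] at h
  rw [gdist, Real.sq_sqrt (by positivity), h]
  simp_rw [unit_sub_one _ (psi_norm _)]
  rw [Finset.sum_sub_distrib, ← mul_sum]
  simp
  ring

lemma sum_fsum_sq {p n : ℕ} [NeZero p] (b : Fin n → ZMod p) (hb : Function.Injective b) :
    ∑ θ, ‖fsum b θ‖ ^ 2 = p * n := by
  have : ((∑ θ, ‖fsum b θ‖ ^ 2 : ℝ) : ℂ) = ((p * n : ℝ) : ℂ) := by
    push_cast
    have h := fun θ => fsum_sq b θ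
    push_cast at h
    simp_rw [h]
    rw [Finset.sum_comm]
    simp_rw [sum_psi, Fintype.sum_prod_type, sub_eq_zero, hb.eq_iff]
    simp
    ring
  exact_mod_cast this

/-- deficiency -/
noncomputable def Ddef {p n : ℕ} [NeZero p] (b : Fin n → ZMod p) (θ : ZMod p) : ℝ :=
  1 - (‖fsum b θ‖ / n) ^ 2

lemma Dset_card {p n : ℕ} [NeZero p] (hn : 0 < n) (b : Fin n → ZMod p)
    (hb : Function.Injective b) : (#{θ | Ddef b θ ≤ 1/2} : ℝ) ≤ 2 * p / n := by
  have hn' : (0:ℝ) < n := by exact_mod_cast hn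
  have h1 : ∑ θ ∈ univ.filter (fun θ => Ddef b θ ≤ 1/2), ((n:ℝ)^2 / 2) ≤ (p:ℝ) * (n:ℝ) := by
    rw [← sum_fsum_sq b hb]
    refine le_trans (Finset.sum_le_sum (g := fun θ => ‖fsum b θ‖ ^ 2) ?_)
      (Finset.sum_le_sum_of_subset_of_nonneg (Finset.filter_subset _ _) fun _ _ _ => by positivity)
    intro θ hθ
    simp only [mem_filter, mem_univ, true_and, Ddef, div_pow] at hθ
    have : 1/2 ≤ ‖fsum b θ‖ ^ 2 / (n:ℝ)^2 := by linarith
    rw [le_div_iff₀ (by positivity)] at this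
    linarith
  rw [sum_const, nsmul_eq_mul] at h1
  rw [le_div_iff₀ hn']
  have : (#{θ | Ddef b θ ≤ 1/2} : ℝ) * n * n ≤ 2 * p * n := by linarith
  exact le_of_mul_le_mul_right this hn'

lemma theta_sum {p n : ℕ} (hp : p.Prime) [NeZero p] (hn : 3 ≤ n) (b : Fin n → ZMod p)
    (hb : Function.Injective b) (κ : ℝ) (hκ : 0 < κ) :
    ∑ θ ∈ univ.filter (fun θ => Ddef b θ ≤ 1/2), Real.exp (-(κ * Ddef b θ))
      ≤ 2 + 24 * (p / n) / √κ := by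
  have hn' : (0:ℝ) < n := by positivity
  have hp' : (0:ℝ) < p := by exact_mod_cast hp.pos
  set g : ZMod p → ℝ := fun θ => gdist (fun ij : Fin n × Fin n => b ij.1 - b ij.2) θ / (√2 * n) with hg
  have hg2 : ∀ θ, g θ ^ 2 = Ddef b θ := by
    intro θ
    simp only [hg]
    rw [div_pow, gdist_fsum, mul_pow, Real.sq_sqrt (by norm_num), Ddef]
    field_simp
  have hgnn : ∀ θ, 0 ≤ g θ := by
    intro θ; simp only [hg]; unfold gdist; positivity
  have g0 : g 0 = 0 := by simp [hg, gdist_zero]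
  have gadd : ∀ x y, g (x + y) ≤ g x + g y := by
    intro x y
    simp only [hg]
    rw [← add_div]
    gcongr
    exact gdist_add _ x y
  have hset : ∀ θ, g θ ≤ √(1/2) ↔ Ddef b θ ≤ 1/2 := by
    intro θ
    rw [← hg2, Real.le_sqrt (hgnn θ) (by norm_num)]
  have hK : (#{θ | g θ ≤ √(1/2)} : ℝ) ≤ 2 * p / n := by
    simp_rw [hset]
    exact Dset_card (by omega) b hb
  have hKp : (2 * p / n : ℝ) < p := by
    rw [div_lt_iff₀ hn']
    have : (3:ℝ) ≤ n := by exact_mod_cast hn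
    nlinarith
  have hs : (2/3 : ℝ) ≤ √(1/2) := by
    apply Real.le_sqrt_of_sq_le; norm_num
  have := sum_exp (univ.filter (fun θ => Ddef b θ ≤ 1/2)) g (6 * (p / n)) κ (by positivity) hκ ?_
  · simp_rw [hg2] at this
    refine this.trans (le_of_eq ?_)
    ring
  · intro r hr
    by_cases hr0 : r ≤ √(1/2)
    · have h1 := cd_bound hp g g0 gadd r _ _ hr hr0 hK hKp
      have h2 : (#{x ∈ univ.filter (fun θ => Ddef b θ ≤ 1/2) | g x ≤ r} : ℝ) ≤ #{x | g x ≤ r} := by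
        norm_cast
        apply Finset.card_le_card
        intro x
        simp
      refine h2.trans (h1.trans ?_)
      have h3 : 2 * r / √(1/2) ≤ 3 * r := by
        rw [div_le_iff₀ (by linarith)]
        nlinarith
      calc 1 + 2 * p / n * (2 * r / √(1/2)) ≤ 1 + 2 * p / n * (3 * r) := by gcongr
        _ = _ := by ring
    · push Not at hr0
      have h2 : (#{x ∈ univ.filter (fun θ => Ddef b θ ≤ 1/2) | g x ≤ r} : ℝ) ≤ #{x | Ddef b x ≤ 1/2} := by
        norm_cast
        apply Finset.card_le_card
        intro x
        simp +contextual
      refine h2.trans ((Dset_card (by omega) b hb).trans ?_)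
      have : (p / n : ℝ) * (2/3) ≤ (p / n : ℝ) * r := by
        gcongr; linarith
      have h0 : (0:ℝ) ≤ p / n := by positivity
      have h9 : (2 * p / n : ℝ) = 2 * (p / n) := by ring
      rw [h9]
      linarith

lemma phi_card0 {p : ℕ} (hp : p.Prime) [NeZero p] (r : ℝ) (hr : 0 < r) :
    (#{φ : ZMod p | ‖(ZMod.stdAddChar φ : ℂ) - 1‖ ≤ r} : ℝ) ≤ 1 + 4/3 * p * r := by
  have hp' : (0:ℝ) < p := by exact_mod_cast hp.pos
  have hK : (#{φ : ZMod p | ‖(ZMod.stdAddChar φ : ℂ) - 1‖ ≤ 1} : ℝ) ≤ 2/3 * p := by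
    have h1 : ∑ φ ∈ univ.filter (fun φ : ZMod p => ‖(ZMod.stdAddChar φ : ℂ) - 1‖ ≤ 1), (3/2 : ℝ)
        ≤ ∑ φ : ZMod p, (1 + (ZMod.stdAddChar φ : ℂ).re) := by
      refine le_trans (Finset.sum_le_sum (g := fun φ : ZMod p => (1 + (ZMod.stdAddChar φ : ℂ).re)) ?_)
        (Finset.sum_le_sum_of_subset_of_nonneg (Finset.filter_subset _ _) fun φ _ _ => ?_)
      · intro φ hφ
        simp only [mem_filter, mem_univ, true_and] at hφ
        have := unit_sub_one _ (psi_norm φ)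
        nlinarith [norm_nonneg ((ZMod.stdAddChar φ : ℂ) - 1)]
      · have := Complex.abs_re_le_norm (ZMod.stdAddChar φ : ℂ)
        rw [psi_norm] at this
        linarith [(abs_le.mp this).1]
    have h2 : ∑ φ : ZMod p, (1 + (ZMod.stdAddChar φ : ℂ).re) = p := by
      rw [sum_add_distrib, ← Complex.re_sum]
      have hs := sum_psi (p := p) 1
      have : Fact (1 < p) := ⟨hp.one_lt⟩
      simp only [mul_one, one_ne_zero, if_false] at hs
      rw [hs]
      simp [ZMod.card]
    rw [h2, sum_const, nsmul_eq_mul] at h1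
    linarith
  by_cases h : r ≤ 1
  · have := cd_bound hp (fun φ : ZMod p => ‖(ZMod.stdAddChar φ : ℂ) - 1‖) (by simp) ?_ r 1 _ hr h hK (by linarith)
    · refine this.trans (le_of_eq ?_)
      ring
    · intro x y
      have : (ZMod.stdAddChar (x + y) : ℂ) - 1 = ((ZMod.stdAddChar x : ℂ) - 1) + (ZMod.stdAddChar x : ℂ) * ((ZMod.stdAddChar y : ℂ) - 1) := by
        rw [AddChar.map_add_eq_mul]; ring
      simp only [this]
      refine (norm_add_le _ _).trans ?_
      rw [norm_mul, psi_norm, one_mul]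
  · push Not at h
    have h1 : (#{φ : ZMod p | ‖(ZMod.stdAddChar φ : ℂ) - 1‖ ≤ r} : ℝ) ≤ p := by
      have := Finset.card_le_univ (univ.filter fun φ : ZMod p => ‖(ZMod.stdAddChar φ : ℂ) - 1‖ ≤ r)
      rw [ZMod.card] at this
      exact_mod_cast this
    nlinarith

lemma phi_sum {p : ℕ} (hp : p.Prime) [NeZero p] (u : ℂ) (hu : ‖u‖ = 1) (κ : ℝ) (hκ : 0 < κ) :
    ∑ φ : ZMod p, Real.exp (-(κ * ‖u * (ZMod.stdAddChar φ : ℂ) - 1‖ ^ 2)) ≤ 2 + 12 * p / √κ := by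
  have hp' : (0:ℝ) < p := by exact_mod_cast hp.pos
  have := sum_exp univ (fun φ : ZMod p => ‖u * (ZMod.stdAddChar φ : ℂ) - 1‖) (3 * p) κ (by positivity) hκ ?_
  · refine this.trans (le_of_eq ?_)
    ring
  · intro r hr
    rcases Finset.eq_empty_or_nonempty (univ.filter fun φ : ZMod p => ‖u * (ZMod.stdAddChar φ : ℂ) - 1‖ ≤ r) with h | ⟨φ0, h0⟩
    · rw [h]; simp; positivity
    · have h1 : #{φ : ZMod p | ‖u * (ZMod.stdAddChar φ : ℂ) - 1‖ ≤ r} ≤ #{φ : ZMod p | ‖(ZMod.stdAddChar φ : ℂ) - 1‖ ≤ 2 * r} := by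
        apply Finset.card_le_card_of_injOn (fun φ => φ - φ0)
        · intro φ hφ
          simp only [coe_filter, mem_univ, true_and, Set.mem_ofPred_eq, mem_filter] at hφ h0 ⊢
          have e : ‖(ZMod.stdAddChar (φ - φ0) : ℂ) - 1‖ = ‖(u * (ZMod.stdAddChar φ : ℂ) - 1) - (u * (ZMod.stdAddChar φ0 : ℂ) - 1)‖ := by
            have : (u * (ZMod.stdAddChar φ : ℂ) - 1) - (u * (ZMod.stdAddChar φ0 : ℂ) - 1)
              = u * (ZMod.stdAddChar φ0 : ℂ) * ((ZMod.stdAddChar (φ - φ0) : ℂ) - 1) := by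
              conv_lhs => rw [show φ = φ0 + (φ - φ0) by ring, AddChar.map_add_eq_mul]
              ring
            rw [this, norm_mul, norm_mul, hu, psi_norm]; simp
          rw [e]
          refine (norm_sub_le _ _).trans ?_
          linarith
        · intro x _ y _ h
          simpa using h
      have h2 := phi_card0 hp (2 * r) (by linarith)
      have h3 : (#{φ : ZMod p | ‖u * (ZMod.stdAddChar φ : ℂ) - 1‖ ≤ r} : ℝ) ≤ #{φ : ZMod p | ‖(ZMod.stdAddChar φ : ℂ) - 1‖ ≤ 2 * r} := by exact_mod_cast h1
      have : 0 < p * r := by positivity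
      nlinarith

lemma psi_sum {p : ℕ} [NeZero p] {ι : Type*} (s : Finset ι) (f : ι → ZMod p) :
    (ZMod.stdAddChar (∑ i ∈ s, f i) : ℂ) = ∏ i ∈ s, (ZMod.stdAddChar (f i) : ℂ) := by
  induction s using Finset.induction_on with
  | empty => simp
  | insert i s hi ih => rw [sum_insert hi, prod_insert hi, AddChar.map_add_eq_mul, ih]

lemma countB {p n k : ℕ} [NeZero p] (b : Fin n → ZMod p) (y : ZMod p) (q : ℝ) (hq0 : 0 ≤ q) (hq1 : q ≤ 1) :
    (p:ℝ) ^ 2 * ((#{s ∈ powersetCard k (univ : Finset (Fin n)) | ∑ i ∈ s, b i = y} : ℝ) * (q ^ k * (1 - q) ^ (n - k)))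
      ≤ ∑ θ : ZMod p, ∑ φ : ZMod p, ∏ i, ‖(1 - q : ℂ) + q * (ZMod.stdAddChar (θ * b i + φ) : ℂ)‖ := by
  set W : Finset (Fin n) → ℝ := fun s => q ^ #s * (1 - q) ^ (n - #s) with hW
  have hWnn : ∀ s, 0 ≤ W s := fun s => by
    have : 0 ≤ 1 - q := by linarith
    simp only [hW]; positivity
  have key : ∑ θ : ZMod p, ∑ φ : ZMod p, (∏ i, ((1 - q : ℂ) + q * (ZMod.stdAddChar (θ * b i + φ) : ℂ)))
      * (ZMod.stdAddChar (-(θ * y + φ * (k : ZMod p))) : ℂ) =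
      ((∑ s : Finset (Fin n), W s * ((if ∑ i ∈ s, b i - y = 0 then (p:ℝ) else 0) *
        (if ((#s : ZMod p) - (k : ZMod p)) = 0 then (p:ℝ) else 0)) : ℝ) : ℂ) := by
    have h1 : ∀ θ φ : ZMod p, (∏ i, ((1 - q : ℂ) + q * (ZMod.stdAddChar (θ * b i + φ) : ℂ)))
      * (ZMod.stdAddChar (-(θ * y + φ * (k : ZMod p))) : ℂ) =
        ∑ s : Finset (Fin n), (W s : ℂ) * ((ZMod.stdAddChar (θ * (∑ i ∈ s, b i - y)) : ℂ) *
          (ZMod.stdAddChar (φ * ((#s : ZMod p) - (k : ZMod p))) : ℂ)) := by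
      intro θ φ
      simp_rw [add_comm (1 - q : ℂ)]
      rw [Finset.prod_add, powerset_univ, Finset.sum_mul]
      refine Finset.sum_congr rfl fun s _ => ?_
      rw [Finset.prod_mul_distrib, prod_const, prod_const, ← psi_sum]
      rw [← Finset.compl_eq_univ_sdiff, card_compl, Fintype.card_fin]
      simp only [hW]
      rw [← AddChar.map_add_eq_mul]
      push_cast
      rw [sum_add_distrib, ← mul_sum, sum_const, nsmul_eq_mul]
      have : θ * (∑ i ∈ s, b i - y) + φ * ((#s : ZMod p) - (k : ZMod p)) = (θ * ∑ i ∈ s, b i + #s * φ) + (-(θ * y + φ * (k : ZMod p))) := by ring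
      rw [this, AddChar.map_add_eq_mul _ (θ * ∑ i ∈ s, b i + #s * φ) (-(θ * y + φ * (k : ZMod p)))]
      ring
    simp_rw [h1]
    simp_rw [Finset.sum_comm (s := (univ : Finset (ZMod p))) (t := (univ : Finset (Finset (Fin n)))), ← mul_sum, ← sum_mul, sum_psi]
    push_cast
    refine Finset.sum_congr rfl fun s _ => ?_
    split_ifs <;> simp
  have lower : (p:ℝ) ^ 2 * ((#{s ∈ powersetCard k (univ : Finset (Fin n)) | ∑ i ∈ s, b i = y} : ℝ) * (q ^ k * (1 - q) ^ (n - k))) ≤ 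
      (∑ s : Finset (Fin n), W s * ((if ∑ i ∈ s, b i - y = 0 then (p:ℝ) else 0) *
        (if ((#s : ZMod p) - (k : ZMod p)) = 0 then (p:ℝ) else 0)) : ℝ) := by
    refine le_trans ?_ (Finset.sum_le_sum_of_subset_of_nonneg (Finset.subset_univ 
      ((powersetCard k (univ : Finset (Fin n))).filter (fun s => ∑ i ∈ s, b i = y))) ?_)
    · rw [Finset.sum_congr rfl (g := fun _ => (p:ℝ)^2 * (q ^ k * (1 - q) ^ (n - k)))]
      · rw [sum_const, nsmul_eq_mul]
        apply le_of_eq; ring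
      · intro s hs
        rw [mem_filter, mem_powersetCard] at hs
        simp only [hW, hs.2, hs.1.2, sub_self, if_true]
        ring
    · intro s _ _
      have := hWnn s
      positivity
  refine lower.trans ?_
  have h2 := congrArg norm key
  rw [Complex.norm_real, Real.norm_eq_abs] at h2
  refine (le_abs_self _).trans ?_
  rw [← h2]
  refine (norm_sum_le _ _).trans (Finset.sum_le_sum fun θ _ => ?_)
  refine (norm_sum_le _ _).trans (Finset.sum_le_sum fun φ _ => ?_)
  rw [norm_mul, psi_norm, mul_one, norm_prod]

lemma factor_bound (q : ℝ) (z : ℂ) (hz : ‖z‖ = 1) :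
    ‖(1 - q : ℂ) + q * z‖ ≤ Real.exp (-(q * (1 - q) * (1 - z.re))) := by
  have h : z.re ^ 2 + z.im ^ 2 = 1 := by
    have := Complex.sq_norm z
    rw [hz, Complex.normSq_apply] at this
    nlinarith
  have h1 : ‖(1 - q : ℂ) + q * z‖ ^ 2 = 1 + -(2 * (q * (1 - q) * (1 - z.re))) := by
    rw [Complex.sq_norm, Complex.normSq_apply]
    simp
    linear_combination q^2 * h
  apply le_of_sq_le_sq _ (by positivity)
  rw [h1, ← Real.exp_nat_mul]
  have := Real.add_one_le_exp (-(2 * (q * (1 - q) * (1 - z.re))))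
  push_cast
  rw [mul_neg]
  linarith

lemma prod_bound {p n k : ℕ} [NeZero p] (hk : 1 ≤ k) (hkn : 2 * k ≤ n) (b : Fin n → ZMod p) (θ : ZMod p) :
    ∃ u : ℂ, ‖u‖ = 1 ∧ ∀ φ : ZMod p,
     ∏ i, ‖(1 - ((k / n : ℝ)) : ℂ) + (k / n : ℝ) * (ZMod.stdAddChar (θ * b i + φ) : ℂ)‖ ≤
      Real.exp (-(k / 4 * Ddef b θ)) *
        Real.exp (-((k * (‖fsum b θ‖ / n) / 4) * ‖u * (ZMod.stdAddChar φ : ℂ) - 1‖ ^ 2)) := by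
  have hk' : (0:ℝ) < k := by exact_mod_cast hk
  have hn' : (0:ℝ) < n := by exact_mod_cast (by omega : 0 < n)
  have hkn' : 2 * (k:ℝ) ≤ n := by exact_mod_cast hkn
  set q : ℝ := k / n with hq
  have hq0 : 0 ≤ q := by positivity
  have hq1 : q ≤ 1/2 := by rw [hq, div_le_iff₀ hn']; linarith
  refine ⟨Complex.exp (Complex.arg (fsum b θ) * Complex.I), Complex.norm_exp_ofReal_mul_I _, fun φ => ?_⟩
  set u := Complex.exp (Complex.arg (fsum b θ) * Complex.I) with hu
  have hun : ‖u‖ = 1 := Complex.norm_exp_ofReal_mul_I _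
  have hfu : fsum b θ = ‖fsum b θ‖ * u := (Complex.norm_mul_exp_arg_mul_I _).symm
  set ρ := ‖fsum b θ‖ / n with hρ
  have hρ0 : 0 ≤ ρ := by positivity
  have hρ1 : ρ ≤ 1 := by rw [hρ, div_le_one hn']; exact fsum_norm_le b θ
  have hD : Ddef b θ = 1 - ρ ^ 2 := rfl
  have h1 : ∏ i, ‖(1 - q : ℂ) + q * (ZMod.stdAddChar (θ * b i + φ) : ℂ)‖ ≤
      ∏ i, Real.exp (-(q * (1 - q) * (1 - (ZMod.stdAddChar (θ * b i + φ) : ℂ).re))) :=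
    Finset.prod_le_prod (fun _ _ => norm_nonneg _) fun i _ => factor_bound q _ (psi_norm _)
  refine h1.trans ?_
  rw [← Real.exp_sum, ← Real.exp_add]
  apply Real.exp_le_exp.mpr
  have h2 : ∑ i, (1 - (ZMod.stdAddChar (θ * b i + φ) : ℂ).re) = n * (1 - ρ) + n * ρ * ‖u * (ZMod.stdAddChar φ : ℂ) - 1‖ ^ 2 / 2 := by
    rw [unit_sub_one _ (by rw [norm_mul, hun, psi_norm, one_mul]), sum_sub_distrib, ← Complex.re_sum]
    simp_rw [AddChar.map_add_eq_mul]
    rw [← sum_mul]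
    change _ - (fsum b θ * _).re = _
    rw [hfu]
    have : ‖fsum b θ‖ = n * ρ := by rw [hρ]; field_simp
    rw [this, mul_assoc, Complex.re_ofReal_mul]
    simp
    ring
  rw [sum_neg_distrib, ← mul_sum, h2, hD]
  set X := ‖u * (ZMod.stdAddChar φ : ℂ) - 1‖ ^ 2 with hX
  have hX0 : 0 ≤ X := by positivity
  have h3 : (k:ℝ) / 2 * ((1 - ρ) + ρ * X / 2) ≤ q * (1 - q) * (n * (1 - ρ) + n * ρ * X / 2) := by
    have e1 : q * (1 - q) * (n * (1 - ρ) + n * ρ * X / 2) = k * (1 - q) * ((1 - ρ) + ρ * X / 2) := by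
      rw [hq]; field_simp
    rw [e1]
    have : 0 ≤ 1 - ρ := by linarith
    have : (k:ℝ)/2 ≤ k * (1 - q) := by nlinarith
    gcongr
  have h4 : (k:ℝ) / 4 * (1 - ρ ^ 2) ≤ k / 2 * (1 - ρ) := by
    have : (1 - ρ^2) ≤ 2 * (1 - ρ) := by nlinarith
    nlinarith
  linarith

lemma exp_cube (x : ℝ) (hx : 0 < x) : Real.exp (-(x / 8)) ≤ 3072 / x ^ 3 := by
  have h := Real.pow_div_factorial_le_exp (x / 8) (by positivity) 3
  rw [Real.exp_neg, inv_le_comm₀ (by positivity) (by positivity)]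
  refine le_trans (le_of_eq ?_) h
  norm_num [Nat.factorial]
  field_simp
  norm_num

lemma caseB {p n k : ℕ} (hp : p.Prime) [NeZero p] (hk : 2 ≤ k) (hkn : 2 * k ≤ n) (hnk : n ≤ 2 * k ^ 2)
    (hpn : n ^ 2 ≤ p) (b : Fin n → ZMod p) (hb : Function.Injective b) (y : ZMod p) :
    (#{s ∈ powersetCard k (univ : Finset (Fin n)) | ∑ i ∈ s, b i = y} : ℝ) * 
      (((k:ℝ) / n) ^ k * (1 - (k:ℝ) / n) ^ (n - k)) ≤ 8044 / (n * k) := by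
  have hk' : (0:ℝ) < k := by exact_mod_cast (by omega : 0 < k)
  have hn' : (0:ℝ) < n := by exact_mod_cast (by omega : 0 < n)
  have hp' : (0:ℝ) < p := by exact_mod_cast hp.pos
  have hkn' : 2 * (k:ℝ) ≤ n := by exact_mod_cast hkn
  have hnk' : (n:ℝ) ≤ 2 * k ^ 2 := by exact_mod_cast hnk
  have hpn' : (n:ℝ) ^ 2 ≤ p := by exact_mod_cast hpn
  have hn1 : (1:ℝ) ≤ n := by exact_mod_cast (by omega : 1 ≤ n)
  have hk1 : (1:ℝ) ≤ k := by exact_mod_cast (by omega : 1 ≤ k)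
  have hsk : 0 < √(k:ℝ) := Real.sqrt_pos.mpr hk'
  have hsk2 : √(k:ℝ) ^ 2 = k := Real.sq_sqrt hk'.le
  have hskn : √(k:ℝ) ≤ n := by
    rw [Real.sqrt_le_left (by positivity)]; nlinarith
  have hq1 : (k:ℝ) / n ≤ 1 := by rw [div_le_one hn']; linarith
  have h0 := countB (k := k) b y ((k:ℝ) / n) (by positivity) hq1
  have hone : 1 ≤ p / (n * √k) := by
    rw [le_div_iff₀ (by positivity)]
    nlinarith
  have hone2 : 1 ≤ p / √k := by
    rw [le_div_iff₀ (by positivity)]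
    nlinarith
  have hθ : ∀ θ : ZMod p, ∑ φ : ZMod p, ∏ i, ‖(1 - (((k:ℝ) / n : ℝ)) : ℂ) + ((k:ℝ) / n : ℝ) * (ZMod.stdAddChar (θ * b i + φ) : ℂ)‖
      ≤ (if Ddef b θ ≤ 1/2 then Real.exp (-(k / 4 * Ddef b θ)) * (38 * (p / √k)) else 0) + p * Real.exp (-(k / 8)) := by
    intro θ
    obtain ⟨u, hu, hb⟩ := prod_bound (p := p) (by omega : 1 ≤ k) hkn b θ
    refine (Finset.sum_le_sum fun φ _ => hb φ).trans ?_
    rw [← mul_sum]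
    split_ifs with hD
    · have hρ : 1/2 ≤ ‖fsum b θ‖ / n := by
        unfold Ddef at hD
        have : 0 ≤ ‖fsum b θ‖ / n := by positivity
        nlinarith
      have h1 := phi_sum hp u hu (k / 9) (by positivity)
      have h2 : ∑ φ : ZMod p, Real.exp (-((k * (‖fsum b θ‖ / n) / 4) * ‖u * (ZMod.stdAddChar φ : ℂ) - 1‖ ^ 2))
        ≤ ∑ φ : ZMod p, Real.exp (-(k / 9 * ‖u * (ZMod.stdAddChar φ : ℂ) - 1‖ ^ 2)) := by
        refine Finset.sum_le_sum fun φ _ => Real.exp_le_exp.mpr (neg_le_neg ?_)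
        apply mul_le_mul_of_nonneg_right _ (by positivity)
        nlinarith
      have h3 : 2 + 12 * p / √((k:ℝ) / 9) = 2 + 36 * (p / √k) := by
        have : √(9:ℝ) = 3 := by rw [show (9:ℝ) = 3 ^ 2 by norm_num]; exact Real.sqrt_sq (by norm_num)
        rw [Real.sqrt_div' _ (by norm_num), this]
        field_simp
        ring
      have h4 := h2.trans (h1.trans (le_of_eq h3))
      have : 0 ≤ p * Real.exp (-((k:ℝ) / 8)) := by positivity
      have h5 : Real.exp (-(k / 4 * Ddef b θ)) * (∑ φ : ZMod p, Real.exp (-((k * (‖fsum b θ‖ / n) / 4) * ‖u * (ZMod.stdAddChar φ : ℂ) - 1‖ ^ 2))) ≤ Real.exp (-(k / 4 * Ddef b θ)) * (38 * (p / √k)) := by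
        apply mul_le_mul_of_nonneg_left _ (Real.exp_pos _).le
        linarith
      linarith
    · push Not at hD
      rw [zero_add]
      have h1 : ∑ φ : ZMod p, Real.exp (-((k * (‖fsum b θ‖ / n) / 4) * ‖u * (ZMod.stdAddChar φ : ℂ) - 1‖ ^ 2)) ≤ p := by
        refine (Finset.sum_le_sum (g := fun _ => (1:ℝ)) fun φ _ => ?_).trans ?_
        · rw [Real.exp_le_one_iff, neg_nonpos]; positivity
        · simp [ZMod.card]
      rw [mul_comm]
      have : Real.exp (-(k / 4 * Ddef b θ)) ≤ Real.exp (-((k:ℝ) / 8)) := by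
        apply Real.exp_le_exp.mpr
        nlinarith
      gcongr
  have h1 := h0.trans (Finset.sum_le_sum fun θ _ => hθ θ)
  rw [sum_add_distrib, ← sum_filter, ← sum_mul, sum_const, card_univ, ZMod.card, nsmul_eq_mul] at h1
  have h2 := theta_sum hp (by omega : 3 ≤ n) b hb (k / 4) (by positivity)
  have h3 : 2 + 24 * (p / n) / √((k:ℝ) / 4) = 2 + 48 * (p / (n * √k)) := by
    have : √(4:ℝ) = 2 := by rw [show (4:ℝ) = 2 ^ 2 by norm_num]; exact Real.sqrt_sq (by norm_num)
    rw [Real.sqrt_div' _ (by norm_num), this]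
    field_simp
    ring
  have h4 : ∑ θ ∈ univ.filter (fun θ => Ddef b θ ≤ 1/2), Real.exp (-(k / 4 * Ddef b θ)) ≤ 50 * (p / (n * √k)) := by
    rw [h3] at h2; linarith
  have h5 : (∑ θ ∈ univ.filter (fun θ => Ddef b θ ≤ 1/2), Real.exp (-(k / 4 * Ddef b θ))) * (38 * (p / √k))
     ≤ 50 * (p / (n * √k)) * (38 * (p / √k)) := by gcongr
  have h6 : 50 * (p / (n * √k)) * (38 * (p / √k)) = (p:ℝ)^2 * (1900 / (n * k)) := by
    field_simp; rw [hsk2]; ring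
  have h7 : Real.exp (-((k:ℝ) / 8)) ≤ 6144 / (n * k) := by
    refine (exp_cube k hk').trans ?_
    rw [div_le_div_iff₀ (by positivity) (by positivity)]
    nlinarith
  have h8 : (p:ℝ) * (p * Real.exp (-((k:ℝ) / 8))) ≤ p * (p * (6144 / (n * k))) := by gcongr
  have h9 : (p:ℝ)^2 * (1900 / (n * k)) + p * (p * (6144 / (n * k))) = (p:ℝ)^2 * (8044 / (n * k)) := by
    field_simp; norm_num
  refine le_of_mul_le_mul_left (h1.trans ?_) (by positivity : (0:ℝ) < (p:ℝ)^2)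
  linarith

lemma fact_upper (m : ℕ) (hm : 1 ≤ m) :
    (m.factorial : ℝ) ≤ Real.exp 1 * √m * (m / Real.exp 1) ^ m := by
  obtain ⟨j, rfl⟩ : ∃ j, m = j + 1 := ⟨m - 1, by omega⟩
  have h := Stirling.stirlingSeq'_antitone (Nat.zero_le j)
  simp only [Function.comp] at h
  rw [show Nat.succ 0 = 1 from rfl, Stirling.stirlingSeq_one, Stirling.stirlingSeq,
    div_le_iff₀ (by positivity)] at h
  refine h.trans (le_of_eq ?_)
  rw [Nat.succ_eq_add_one]
  rw [Real.sqrt_mul (by norm_num : (0:ℝ) ≤ 2)]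
  have : √(2:ℝ) ≠ 0 := by positivity
  field_simp

lemma binom_lower (n k : ℕ) (hk : 1 ≤ k) (hkn : k < n) :
    1 / (9 * √k) ≤ (n.choose k : ℝ) * (((k:ℝ) / n) ^ k * (1 - (k:ℝ) / n) ^ (n - k)) := by
  obtain ⟨m, rfl⟩ : ∃ m, n = k + m := ⟨n - k, by omega⟩
  have hm : 1 ≤ m := by omega
  have h1 := fact_upper k hk
  have h2 := fact_upper m hm
  have h3 := Stirling.le_factorial_stirling (k + m)
  have h4 : ((k+m).choose k : ℝ) * k.factorial * m.factorial = (k+m).factorial := by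
    have := Nat.add_choose_mul_factorial_mul_factorial k m
    rw [← Nat.choose_symm_add] at this
    exact_mod_cast this
  have hk' : (0:ℝ) < k := by exact_mod_cast hk
  have hm' : (0:ℝ) < m := by exact_mod_cast hm
  have hw : (1 - (k:ℝ) / (k + m : ℕ)) = m / (k + m : ℕ) := by
    push_cast; field_simp; ring
  rw [hw, Nat.add_sub_cancel_left]
  set e := Real.exp 1 with he
  have hepos : 0 < e := Real.exp_pos 1
  set n := k + m with hn
  have hn' : (0:ℝ) < n := by positivity
  set w := ((k:ℝ) / n) ^ k * ((m:ℝ) / n) ^ m with hwdef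
  have hN : ((k:ℝ) / e) ^ k * ((m:ℝ) / e) ^ m = w * ((n:ℝ) / e) ^ n := by
    rw [hwdef]
    have : ((n:ℝ) / e) ^ n = ((n:ℝ) / e) ^ k * ((n:ℝ) / e) ^ m := by rw [← pow_add]
    rw [this, mul_mul_mul_comm, ← mul_pow, ← mul_pow]
    congr 2 <;> field_simp
  have hNpos : 0 < ((n:ℝ) / e) ^ n := by positivity
  have hwpos : 0 < w := by positivity
  have hc : (0:ℝ) ≤ (n.choose k : ℝ) := by positivity
  have h5 : √(2 * Real.pi * n) * ((n:ℝ) / e) ^ n ≤ (n.choose k * w * (e ^ 2 * √k * √m)) * ((n:ℝ) / e) ^ n := by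
    calc _ ≤ (n.factorial : ℝ) := h3
      _ = (n.choose k : ℝ) * k.factorial * m.factorial := h4.symm
      _ ≤ (n.choose k : ℝ) * (e * √k * (k / e) ^ k) * (e * √m * (m / e) ^ m) := by gcongr
      _ = (n.choose k : ℝ) * (e ^ 2 * √k * √m) * (((k:ℝ) / e) ^ k * ((m:ℝ) / e) ^ m) := by ring
      _ = _ := by rw [hN]; ring
  have h6 := le_of_mul_le_mul_right h5 hNpos
  have h7 : √m ≤ √(2 * Real.pi * n) := by
    apply Real.sqrt_le_sqrt
    have : (m:ℝ) ≤ n := by rw [hn]; push_cast; linarith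
    nlinarith [Real.pi_gt_three]
  have hsm : 0 < √(m:ℝ) := Real.sqrt_pos.mpr hm'
  have hsk : 0 < √(k:ℝ) := Real.sqrt_pos.mpr hk'
  have h8 : 1 * √m ≤ (n.choose k * w * (e ^ 2 * √k)) * √m := by
    rw [one_mul]; refine (h7.trans h6).trans (le_of_eq (by ring))
  have h9 := le_of_mul_le_mul_right h8 hsm
  have he9 : e ^ 2 ≤ 9 := by
    have := Real.exp_one_lt_d9
    have : e ≤ 3 := by rw [he]; linarith
    nlinarith
  rw [div_le_iff₀ (by positivity)]
  calc 1 ≤ (n.choose k * w * (e ^ 2 * √k)) := h9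
    _ ≤ n.choose k * w * (9 * √k) := by gcongr

lemma to_zmod (n N : ℕ) (a : Fin n → ℝ) (ha : Function.Injective a) :
    ∃ p : ℕ, p.Prime ∧ N ≤ p ∧ ∃ b : Fin n → ZMod p, Function.Injective b ∧
      ∀ s t : Finset (Fin n), ∑ i ∈ s, a i = ∑ i ∈ t, a i → ∑ i ∈ s, b i = ∑ i ∈ t, b i := by
  obtain ⟨f, hf⟩ := Module.exists_dual_forall_apply_ne_zero (K := ℚ) (M := ℝ)
    (fun ij : {ij : Fin n × Fin n // ij.1 ≠ ij.2} => a ij.1.1 - a ij.1.2)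
    (fun ij => sub_ne_zero.mpr (fun h => ij.2 (ha h)))
  set M : ℕ := ∏ i, (f (a i)).den with hM
  have hMpos : M ≠ 0 := Finset.prod_ne_zero_iff.mpr fun i _ => (f (a i)).den_nz
  have hint : ∀ i, ∃ c : ℤ, (c : ℚ) = M * f (a i) := by
    intro i
    obtain ⟨d, hd⟩ : (f (a i)).den ∣ M := Finset.dvd_prod_of_mem _ (mem_univ i)
    refine ⟨d * (f (a i)).num, ?_⟩
    rw [hd]
    push_cast
    have := Rat.den_mul_eq_num (f (a i))
    rw [← this]; ring
  choose c hc using hint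
  have hcinj : Function.Injective c := by
    intro i j hij
    by_contra hne
    have := hf ⟨(i, j), hne⟩
    apply this
    have h1 : (M:ℚ) * f (a i) = M * f (a j) := by rw [← hc, ← hc, hij]
    have h2 := mul_left_cancel₀ (by exact_mod_cast hMpos) h1
    simp [h2]
  obtain ⟨p, hpN, hp⟩ := Nat.exists_infinite_primes (N + 1 + ∑ i, ∑ j, (c i - c j).natAbs)
  refine ⟨p, hp, by omega, fun i => (c i : ZMod p), ?_, ?_⟩
  · intro i j hij
    apply hcinj
    have h1 : (p:ℤ) ∣ c i - c j := by
      have := (ZMod.intCast_eq_intCast_iff_dvd_sub (c j) (c i) p).mp hij.symm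
      exact this
    have h2 : (c i - c j).natAbs ≤ ∑ i, ∑ j, (c i - c j).natAbs :=
      (Finset.single_le_sum (f := fun j => (c i - c j).natAbs) (fun _ _ => Nat.zero_le _) (mem_univ j)).trans
        (Finset.single_le_sum (f := fun i => ∑ j, (c i - c j).natAbs) (fun _ _ => Nat.zero_le _) (mem_univ i))
    have h3 : c i - c j = 0 := Int.eq_zero_of_dvd_of_natAbs_lt_natAbs h1 (by simp; omega)
    omega
  · intro s t hst
    have h1 : ∑ i ∈ s, c i = ∑ i ∈ t, c i := by
      have h : (∑ i ∈ s, (c i : ℚ)) = ∑ i ∈ t, (c i : ℚ) := by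
        simp_rw [hc, ← mul_sum, ← map_sum, hst]
      exact_mod_cast h
    have := congrArg (fun z : ℤ => (z : ZMod p)) h1
    push_cast at this
    exact this

lemma count_inj {p n k : ℕ} [NeZero p] (hn : 0 < n) (b : Fin n → ZMod p) (y : ZMod p) :
    #{s ∈ powersetCard k (univ : Finset (Fin n)) | ∑ i ∈ s, b i = y} * k.factorial
      ≤ #{h : Fin k → Fin n | ∑ j, b (h j) = y} := by
  have hcard : #{s ∈ powersetCard k (univ : Finset (Fin n)) | ∑ i ∈ s, b i = y} * k.factorial =
      #({s ∈ powersetCard k (univ : Finset (Fin n)) | ∑ i ∈ s, b i = y} ×ˢ (univ : Finset (Equiv.Perm (Fin k)))) := by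
    rw [card_product, card_univ, Fintype.card_perm, Fintype.card_fin]
  rw [hcard]
  set F : Finset (Fin n) × Equiv.Perm (Fin k) → (Fin k → Fin n) := fun x =>
    if h : #x.1 = k then (x.1.orderEmbOfFin h) ∘ x.2 else fun _ => ⟨0, hn⟩ with hF
  apply Finset.card_le_card_of_injOn F
  · rintro ⟨s, σ⟩ hs
    simp only [coe_product, coe_filter, mem_powersetCard, coe_univ, Set.mem_prod, Set.mem_ofPred_eq, mem_filter, mem_univ, true_and] at hs ⊢
    obtain ⟨⟨⟨_, hc⟩, hsum⟩, _⟩ := hs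
    simp only [mem_coe, mem_filter, mem_univ, true_and, hF, hc, dif_pos, Function.comp]
    rw [Equiv.sum_comp σ (fun j => b (s.orderEmbOfFin hc j)), ← hsum]
    conv_rhs => rw [← Finset.image_orderEmbOfFin_univ s hc]
    rw [Finset.sum_image (fun _ _ _ _ h => (s.orderEmbOfFin hc).injective h)]
  · rintro ⟨s, σ⟩ hs ⟨t, τ⟩ ht hst
    simp only [coe_product, coe_filter, mem_powersetCard, coe_univ, Set.mem_prod, Set.mem_ofPred_eq] at hs ht
    obtain ⟨⟨⟨_, hc⟩, hsum⟩, _⟩ := hs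
    obtain ⟨⟨⟨_, hc'⟩, hsum'⟩, _⟩ := ht
    simp only [hF, hc, hc', dif_pos] at hst
    have h1 : s = t := by
      have h2 := congrArg Set.range hst
      rw [EquivLike.range_comp, EquivLike.range_comp, Finset.range_orderEmbOfFin, Finset.range_orderEmbOfFin] at h2
      exact_mod_cast h2
    subst h1
    congr 1
    ext j
    have := congrFun hst j
    simp only [Function.comp] at this
    rw [(s.orderEmbOfFin hc).injective this]

lemma countA {p n k : ℕ} [NeZero p] (b : Fin n → ZMod p) (y : ZMod p) :
    (p:ℝ) * (#{h : Fin k → Fin n | ∑ j, b (h j) = y} : ℝ) ≤ ∑ θ, ‖fsum b θ‖ ^ k := by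
  have key : ∑ θ : ZMod p, fsum b θ ^ k * (ZMod.stdAddChar (-(θ * y)) : ℂ) =
      (((p:ℝ) * (#{h : Fin k → Fin n | ∑ j, b (h j) = y} : ℝ) : ℝ) : ℂ) := by
    have h1 : ∀ θ : ZMod p, fsum b θ ^ k * (ZMod.stdAddChar (-(θ * y)) : ℂ) =
        ∑ h : Fin k → Fin n, (ZMod.stdAddChar (θ * (∑ j, b (h j) - y)) : ℂ) := by
      intro θ
      rw [fsum, Fintype.sum_pow, sum_mul]
      refine Finset.sum_congr rfl fun h _ => ?_
      rw [← psi_sum, ← AddChar.map_add_eq_mul, ← mul_sum]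
      congr 1
      ring
    simp_rw [h1]
    rw [sum_comm]
    simp_rw [sum_psi, sub_eq_zero]
    rw [← sum_filter, sum_const, nsmul_eq_mul]
    push_cast
    ring
  have h2 := congrArg norm key
  rw [Complex.norm_real, Real.norm_eq_abs] at h2
  refine (le_abs_self _).trans ?_
  rw [← h2]
  refine (norm_sum_le _ _).trans (Finset.sum_le_sum fun θ _ => ?_)
  rw [norm_mul, psi_norm, mul_one, norm_pow]

lemma pow_le_desc (n k : ℕ) (hk : 1 ≤ k) (h : 2 * k ^ 2 ≤ n) :
    (n:ℝ) ^ k ≤ 2 * (k.factorial * n.choose k) := by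
  have h1 := Nat.pow_sub_le_descFactorial n k
  rw [Nat.descFactorial_eq_factorial_mul_choose] at h1
  have hkn : k ≤ n := by nlinarith
  have h2 : (((n + 1 - k : ℕ) : ℝ)) ^ k ≤ k.factorial * n.choose k := by exact_mod_cast h1
  have hn' : (0:ℝ) < n := by exact_mod_cast (by omega : 0 < n)
  have h3 : (1/2 : ℝ) ≤ (1 + -((k:ℝ) / n)) ^ k := by
    have hle : (k:ℝ) / n ≤ 1 := by rw [div_le_one hn']; exact_mod_cast hkn
    have := one_add_mul_le_pow (a := -((k:ℝ) / n)) (by linarith) k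
    have h5 : (k:ℝ) * (k / n) ≤ 1/2 := by
      rw [← mul_div_assoc, div_le_iff₀ hn']
      have : 2 * (k:ℝ)^2 ≤ n := by exact_mod_cast h
      nlinarith
    linarith
  have h4 : (n:ℝ) ^ k * (1 + -((k:ℝ) / n)) ^ k ≤ ((n + 1 - k : ℕ) : ℝ) ^ k := by
    rw [← mul_pow]
    have e : (n:ℝ) * (1 + -((k:ℝ) / n)) = n - k := by field_simp; ring
    rw [e]
    have : (k:ℝ) ≤ n := by exact_mod_cast hkn
    apply pow_le_pow_left₀ (by linarith)
    rw [Nat.cast_sub (by omega)]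
    push_cast; linarith
  have : 0 < (n:ℝ)^k := by positivity
  nlinarith

lemma three_quarter (k : ℕ) (hk : 2 ≤ k) : (3/4 : ℝ) ^ (k - 2) ≤ 6 / √k := by
  obtain ⟨m, rfl⟩ : ∃ m, k = m + 2 := ⟨k - 2, by omega⟩
  rw [Nat.add_sub_cancel]
  have h1 := one_add_mul_le_pow (a := (1/3 : ℝ)) (by norm_num) m
  have h2 : (3/4 : ℝ) ^ m * (1 + 1/3)^m = 1 := by rw [← mul_pow]; norm_num
  have h3 : 0 < (3/4 : ℝ)^m := by positivity
  have hm : (0:ℝ) ≤ m := by positivity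
  have hs : √((m + 2 : ℕ) : ℝ) ≤ m + 2 := by
    rw [Real.sqrt_le_left (by positivity)]; push_cast; nlinarith
  rw [le_div_iff₀ (by positivity)]
  calc (3/4 : ℝ) ^ m * √((m + 2 : ℕ) : ℝ) ≤ (3/4)^m * (6 * (1 + m * (1/3))) := by
        gcongr; linarith
    _ ≤ (3/4)^m * (6 * (1 + 1/3)^m) := by gcongr
    _ = 6 := by linarith

lemma caseA {p n k : ℕ} (hp : p.Prime) [NeZero p] (hk : 2 ≤ k) (hnk : 2 * k ^ 2 ≤ n)
    (hpn : n ^ 2 ≤ p) (b : Fin n → ZMod p) (hb : Function.Injective b) (y : ZMod p) :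
    (#{s ∈ powersetCard k (univ : Finset (Fin n)) | ∑ i ∈ s, b i = y} : ℝ) ≤ 
      112 / (n * √k) * n.choose k := by
  have hkn : k ≤ n := by nlinarith
  have hk' : (0:ℝ) < k := by exact_mod_cast (by omega : 0 < k)
  have hn' : (0:ℝ) < n := by exact_mod_cast (by omega : 0 < n)
  have hp' : (0:ℝ) < p := by exact_mod_cast hp.pos
  have hpn' : (n:ℝ) ^ 2 ≤ p := by exact_mod_cast hpn
  have hkn' : (k:ℝ) ≤ n := by exact_mod_cast hkn
  have hk1 : (1:ℝ) ≤ k := by exact_mod_cast (by omega : 1 ≤ k)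
  have hsk : 0 < √(k:ℝ) := Real.sqrt_pos.mpr hk'
  have hskn : √(k:ℝ) ≤ n := by
    rw [Real.sqrt_le_left (by positivity)]; nlinarith
  have hone : 1 ≤ p / (n * √k) := by
    rw [le_div_iff₀ (by positivity)]
    nlinarith
  have h1 := count_inj (k := k) (by omega : 0 < n) b y
  have h1' : (#{s ∈ powersetCard k (univ : Finset (Fin n)) | ∑ i ∈ s, b i = y} : ℝ) * k.factorial
      ≤ #{h : Fin k → Fin n | ∑ j, b (h j) = y} := by exact_mod_cast h1
  have h2 := countA (k := k) b y
  have h3 := pow_le_desc n k (by omega) hnk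
  have hpt : ∀ θ, (‖fsum b θ‖ / n) ^ k ≤ (if Ddef b θ ≤ 1/2 then Real.exp (-(k / 4 * Ddef b θ)) else 0)
      + (‖fsum b θ‖ / n) ^ 2 * (6 / √k) := by
    intro θ
    set ρ := ‖fsum b θ‖ / n with hρ
    have hρ0 : 0 ≤ ρ := by positivity
    have hD : Ddef b θ = 1 - ρ ^ 2 := rfl
    have hρ1 : ρ ≤ 1 := by rw [hρ, div_le_one hn']; exact fsum_norm_le b θ
    split_ifs with h
    · have h4 : ρ ^ k ≤ Real.exp (-(k / 4 * Ddef b θ)) := by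
        have h5 : ρ ≤ Real.exp (-(1/4 * Ddef b θ)) := by
          have := Real.add_one_le_exp (-(1/4 * Ddef b θ))
          rw [hD] at this ⊢
          nlinarith
        calc ρ ^ k ≤ Real.exp (-(1/4 * Ddef b θ)) ^ k := by gcongr
          _ = _ := by rw [← Real.exp_nat_mul]; congr 1; ring
      have : 0 ≤ ρ ^ 2 * (6 / √k) := by positivity
      linarith
    · rw [zero_add]
      push Not at h
      have h5 : ρ ≤ 3/4 := by rw [hD] at h; nlinarith
      calc ρ ^ k = ρ ^ 2 * ρ ^ (k - 2) := by rw [← pow_add]; congr 1; omega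
        _ ≤ ρ ^ 2 * (3/4) ^ (k - 2) := by gcongr
        _ ≤ _ := by
          have := three_quarter k hk
          gcongr
  have h4 : ∑ θ, (‖fsum b θ‖ / n) ^ k ≤ 56 * (p / (n * √k)) := by
    refine (Finset.sum_le_sum fun θ _ => hpt θ).trans ?_
    rw [sum_add_distrib, ← sum_filter, ← sum_mul]
    have e2 := theta_sum hp (by nlinarith : 3 ≤ n) b hb (k / 4) (by positivity)
    have e3 : 2 + 24 * (p / n) / √((k:ℝ) / 4) = 2 + 48 * (p / (n * √k)) := by
      have : √(4:ℝ) = 2 := by rw [show (4:ℝ) = 2 ^ 2 by norm_num]; exact Real.sqrt_sq (by norm_num)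
      rw [Real.sqrt_div' _ (by norm_num), this]
      field_simp
      ring
    have e4 : (∑ θ, (‖fsum b θ‖ / n) ^ 2) * (6 / √k) = 6 * (p / (n * √k)) := by
      simp_rw [div_pow]
      rw [← sum_div, sum_fsum_sq b hb]
      field_simp
    rw [e4]
    linarith
  have h5 : ∑ θ, ‖fsum b θ‖ ^ k = (n:ℝ)^k * ∑ θ, (‖fsum b θ‖ / n) ^ k := by
    rw [mul_sum]
    refine Finset.sum_congr rfl fun θ _ => ?_
    rw [div_pow]; field_simp
  set c : ℝ := (#{s ∈ powersetCard k (univ : Finset (Fin n)) | ∑ i ∈ s, b i = y} : ℝ) with hc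
  have hf : (0:ℝ) < k.factorial := by exact_mod_cast k.factorial_pos
  have h6 : (p * k.factorial : ℝ) * c ≤ (p * k.factorial : ℝ) * (112 / (n * √k) * n.choose k) := by
    calc (p * k.factorial : ℝ) * c = p * (c * k.factorial) := by ring
      _ ≤ p * (#{h : Fin k → Fin n | ∑ j, b (h j) = y} : ℝ) := by gcongr
      _ ≤ (n:ℝ)^k * ∑ θ, (‖fsum b θ‖ / n) ^ k := by rw [← h5]; exact h2
      _ ≤ (2 * (k.factorial * n.choose k)) * (56 * (p / (n * √k))) := by gcongr
      _ = _ := by ring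
  exact le_of_mul_le_mul_left h6 (by positivity)

lemma half_bound (n k : ℕ) (a : Fin n → ℝ) (hk : 1 ≤ k) (hkn : 2 * k ≤ n)
    (ha : Function.Injective a) (x : ℝ) :
    (#{s ∈ powersetCard k (univ : Finset (Fin n)) | ∑ i ∈ s, a i = x} : ℝ) / (n.choose k : ℝ)
      ≤ 100000 / ((n : ℝ) * √k) := by
  have hk' : (0:ℝ) < k := by exact_mod_cast (by omega : 0 < k)
  have hn' : (0:ℝ) < n := by exact_mod_cast (by omega : 0 < n)
  have hsk : 0 < √(k:ℝ) := Real.sqrt_pos.mpr hk'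
  have hsk2 : √(k:ℝ) ^ 2 = k := Real.sq_sqrt hk'.le
  have hch : (0:ℝ) < n.choose k := by exact_mod_cast Nat.choose_pos (by omega)
  rcases Nat.lt_or_ge k 2 with h1 | h2
  · obtain rfl : k = 1 := by omega
    have hc : #{s ∈ powersetCard 1 (univ : Finset (Fin n)) | ∑ i ∈ s, a i = x} ≤ 1 := by
      rw [Finset.card_le_one]
      intro s hs t ht
      rw [mem_filter, mem_powersetCard, card_eq_one] at hs ht
      obtain ⟨⟨_, i, rfl⟩, hi⟩ := hs
      obtain ⟨⟨_, j, rfl⟩, hj⟩ := ht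
      rw [sum_singleton] at hi hj
      rw [ha (hi.trans hj.symm)]
    have hc' : (#{s ∈ powersetCard 1 (univ : Finset (Fin n)) | ∑ i ∈ s, a i = x} : ℝ) ≤ 1 := by exact_mod_cast hc
    rw [Nat.choose_one_right, Nat.cast_one, Real.sqrt_one, mul_one]
    gcongr
    linarith
  · obtain ⟨p, hp, hpn, b, hb, hsum⟩ := to_zmod n (n ^ 2) a ha
    haveI : NeZero p := ⟨hp.ne_zero⟩
    obtain ⟨y, hy⟩ : ∃ y : ZMod p, ∀ s : Finset (Fin n), ∑ i ∈ s, a i = x → ∑ i ∈ s, b i = y := by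
      by_cases h : ∃ t : Finset (Fin n), ∑ i ∈ t, a i = x
      · obtain ⟨t, ht⟩ := h
        exact ⟨∑ i ∈ t, b i, fun s hs => hsum s t (hs.trans ht.symm)⟩
      · exact ⟨0, fun s hs => (h ⟨s, hs⟩).elim⟩
    have hle : (#{s ∈ powersetCard k (univ : Finset (Fin n)) | ∑ i ∈ s, a i = x} : ℝ) ≤
        #{s ∈ powersetCard k (univ : Finset (Fin n)) | ∑ i ∈ s, b i = y} := by
      norm_cast
      apply Finset.card_le_card
      intro s hs
      rw [mem_filter] at hs ⊢
      exact ⟨hs.1, hy s hs.2⟩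
    rw [div_le_iff₀ hch]
    refine hle.trans ?_
    rcases le_total (2 * k ^ 2) n with h3 | h3
    · refine (caseA hp h2 h3 hpn b hb y).trans ?_
      gcongr
      norm_num
    · have hB := caseB hp h2 hkn h3 hpn b hb y
      have hl := binom_lower n k hk (by omega)
      set w := (((k:ℝ) / n) ^ k * (1 - (k:ℝ) / n) ^ (n - k)) with hw
      set c : ℝ := (#{s ∈ powersetCard k (univ : Finset (Fin n)) | ∑ i ∈ s, b i = y} : ℝ) with hc
      have hc0 : 0 ≤ c := by positivity
      have e1 : c * (1 / (9 * √k)) ≤ n.choose k * (8044 / (n * k)) := by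
        calc c * (1 / (9 * √k)) ≤ c * (n.choose k * w) := by gcongr
          _ = n.choose k * (c * w) := by ring
          _ ≤ _ := by gcongr
      have e2 : c = (c * (1 / (9 * √k))) * (9 * √k) := by field_simp
      rw [e2]
      calc (c * (1 / (9 * √k))) * (9 * √k) ≤ (n.choose k * (8044 / (n * k))) * (9 * √k) := by gcongr
        _ = 72396 / (n * √k) * n.choose k := by
          rw [← hsk2, Real.sqrt_sq hsk.le]; field_simp; norm_num
        _ ≤ _ := by gcongr; norm_num

theorem stmt_1 :
    ∃ C : ℝ, 0 < C ∧ ∀ (n k : ℕ) (a : Fin n → ℝ), 1 ≤ k → k < n →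
      Function.Injective a →
      ∀ x : ℝ,
        (((Finset.univ.powersetCard k).filter
            (fun s : Finset (Fin n) => ∑ i ∈ s, a i = x)).card : ℝ) / (n.choose k : ℝ)
          ≤ C / ((n : ℝ) * Real.sqrt (min k (n - k))) := by
  refine ⟨100000, by norm_num, fun n k a hk hkn ha x => ?_⟩
  rcases le_total (2 * k) n with h | h
  · have hm : min (k:ℝ) ((n:ℝ) - k) = k := by
      apply min_eq_left
      have : 2 * (k:ℝ) ≤ n := by exact_mod_cast h
      linarith
    rw [hm]
    exact half_bound n k a hk h ha x
  · have hm : min (k:ℝ) ((n:ℝ) - k) = ((n - k : ℕ) : ℝ) := by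
      rw [Nat.cast_sub hkn.le]
      apply min_eq_right
      have : (n:ℝ) ≤ 2 * (k:ℝ) := by exact_mod_cast h
      linarith
    rw [hm]
    have hb := half_bound n (n - k) a (by omega) (by omega) ha (∑ i, a i - x)
    rw [Nat.choose_symm hkn.le] at hb
    refine le_trans ?_ hb
    apply div_le_div_of_nonneg_right _ (by positivity)
    norm_cast
    apply Finset.card_le_card_of_injOn (fun s => sᶜ)
    · intro s hs
      simp only [mem_coe, mem_filter, mem_powersetCard, subset_univ, true_and] at hs ⊢
      refine ⟨?_, ?_⟩
      · rw [card_compl, Fintype.card_fin, hs.1]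
      · rw [← hs.2, ← Finset.sum_add_sum_compl s a]; ring
    · intro s _ t _ hst
      exact compl_injective hst
end

section
/- Let w, v ∈ ℝ^n be nondecreasing vectors with Δ(v) := min_{i≠j} |v_i − v_j| > 0. Let i_1, i_2 be indices with i_1 + i_2 ≤ n and w_{n−i_2} − w_{i_1} > 0. Then there is an absolute constant C such that for every closed interval I, taking π uniformly random in S_n, P(∑_i w_{π(i)} v_i ∈ I) ≤ C (1 + |I| / (Δ(v)(w_{n−i_2} − w_{i_1}))) · 1/((i_1 + i_2) √(min(i_1, i_2))). -/
open scoped Classical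
open Finset


lemma linalg_card {E : Type*} [Fintype E] (A : E → E → ℝ) (B D : Finset E)
    (h : ∀ f : E → ℝ, (∀ e, e ∉ B → f e = 0) → (∀ e' ∈ D, ∑ e, A e' e * f e = 0) → f = 0) :
    B.card ≤ D.card := by
  let L : (B → ℝ) →ₗ[ℝ] (D → ℝ) :=
    { toFun := fun g e' => ∑ e : B, A e'.1 e.1 * g e
      map_add' := by
        intro x y; ext e'; simp [mul_add, Finset.sum_add_distrib]
      map_smul' := by
        intro c x; ext e'; simp [Finset.mul_sum, mul_left_comm] }
  have hinj : Function.Injective L := by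
    rw [injective_iff_map_eq_zero]
    intro g hg
    have := h (fun e => if he : e ∈ B then g ⟨e, he⟩ else 0) (by intro e he; simp [he]) (by
      intro e' he'
      have h1 := congrFun hg ⟨e', he'⟩
      simp only [L, LinearMap.coe_mk, AddHom.coe_mk, Pi.zero_apply] at h1
      refine Eq.trans ?_ h1
      rw [← Finset.sum_subset (Finset.subset_univ B)
        (by intro x _ hx; simp [hx]), ← Finset.sum_coe_sort B]
      refine Finset.sum_congr rfl fun x _ => ?_
      simp)
    ext ⟨e, he⟩
    have h2 := congrFun this e
    simpa [he] using h2
  have := LinearMap.finrank_le_finrank_of_injective hinj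
  simpa using this

lemma abel_fin (N : ℕ) (g : Fin (N+1) → ℝ) :
    ∑ i : Fin N, (((i:ℕ):ℝ) + 1) * ((N:ℝ) - (i:ℕ)) * (g i.castSucc - g i.succ)
      = ∑ k : Fin (N+1), ((N:ℝ) - 2 * (k:ℕ)) * g k := by
  have h1 : ∑ k : Fin (N+1), (((k:ℕ):ℝ) + 1) * ((N:ℝ) - (k:ℕ)) * g k
      = ∑ i : Fin N, (((i:ℕ):ℝ) + 1) * ((N:ℝ) - (i:ℕ)) * g i.castSucc := by
    rw [Fin.sum_univ_castSucc]; simp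
  have h2 : ∑ k : Fin (N+1), ((k:ℕ):ℝ) * ((N:ℝ) + 1 - (k:ℕ)) * g k
      = ∑ i : Fin N, (((i:ℕ):ℝ) + 1) * ((N:ℝ) - (i:ℕ)) * g i.succ := by
    rw [Fin.sum_univ_succ]; simp
  simp only [mul_sub (_ * _), Finset.sum_sub_distrib]
  rw [← h1, ← h2, ← Finset.sum_sub_distrib]
  refine Finset.sum_congr rfl fun k _ => ?_
  ring

def sw {N : ℕ} (i : Fin N) : Equiv.Perm (Fin (N+1)) := Equiv.swap i.castSucc i.succ

lemma sw_sq {N : ℕ} (i : Fin N) : sw i * sw i = 1 := by simp [sw]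

noncomputable def xo {N : ℕ} (hi : Fin (N+1) → Prop) (f : Equiv.Perm (Fin (N+1)) → ℝ) (i : Fin N)
    (e : Equiv.Perm (Fin (N+1))) : ℝ :=
  if ¬ hi (e i.castSucc) ∧ hi (e i.succ) then f (e * sw i) else 0

noncomputable def yo {N : ℕ} (hi : Fin (N+1) → Prop) (f : Equiv.Perm (Fin (N+1)) → ℝ) (i : Fin N)
    (e : Equiv.Perm (Fin (N+1))) : ℝ :=
  if hi (e i.castSucc) ∧ ¬ hi (e i.succ) then f (e * sw i) else 0

noncomputable def rk {N : ℕ} (hi : Fin (N+1) → Prop) (e : Equiv.Perm (Fin (N+1))) : ℕ :=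
  ∑ k : Fin (N+1), if hi (e k) then (k:ℕ) else 0

lemma sw_cast {N : ℕ} (i : Fin N) : sw i i.castSucc = i.succ := by simp [sw]
lemma sw_succ {N : ℕ} (i : Fin N) : sw i i.succ = i.castSucc := by simp [sw]

lemma xo_diag {N : ℕ} (hi : Fin (N+1) → Prop) (f : Equiv.Perm (Fin (N+1)) → ℝ) (i : Fin N) :
    ∑ e, xo hi f i e * xo hi f i e = ∑ e, yo hi f i e * yo hi f i e +
      ∑ e : Equiv.Perm (Fin (N+1)), ((if hi (e i.castSucc) then (1:ℝ) else 0) - (if hi (e i.succ) then 1 else 0))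
        * f e ^ 2 := by
  rw [← Equiv.sum_comp (Equiv.mulRight (sw i)) (fun e => xo hi f i e * xo hi f i e),
    ← Equiv.sum_comp (Equiv.mulRight (sw i)) (fun e => yo hi f i e * yo hi f i e),
    ← Finset.sum_add_distrib]
  refine Finset.sum_congr rfl fun e _ => ?_
  simp only [xo, yo, Equiv.coe_mulRight, Equiv.Perm.mul_apply, sw_cast, sw_succ, mul_assoc, sw_sq, mul_one]
  by_cases h1 : hi (e i.castSucc) <;> by_cases h2 : hi (e i.succ) <;> simp [h1, h2] <;> ring

lemma xo_off {N : ℕ} (hi : Fin (N+1) → Prop) (f : Equiv.Perm (Fin (N+1)) → ℝ) (i j : Fin N)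
    (hij : i ≠ j) :
    ∑ e, xo hi f i e * xo hi f j e = ∑ e, yo hi f i e * yo hi f j e := by
  by_cases hadj : (i:ℕ) + 1 = j ∨ (j:ℕ) + 1 = i
  · have key : i.succ = j.castSucc ∨ j.succ = i.castSucc := by
      rcases hadj with h | h
      · left; ext; simpa using h
      · right; ext; simpa using h
    have hx : ∀ e, xo hi f i e * xo hi f j e = 0 := by
      intro e; unfold xo
      rcases key with h | h <;> rw [h] <;> split_ifs <;> first | (exfalso; tauto) | simp
    have hy : ∀ e, yo hi f i e * yo hi f j e = 0 := by
      intro e; unfold yo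
      rcases key with h | h <;> rw [h] <;> split_ifs <;> first | (exfalso; tauto) | simp
    simp [hx, hy]
  · push Not at hadj
    have hv : (i:ℕ) ≠ j := fun h => hij (Fin.ext h)
    have a1 : sw i j.castSucc = j.castSucc := by
      apply Equiv.swap_apply_of_ne_of_ne <;> intro h <;> simp [Fin.ext_iff] at h <;> omega
    have a2 : sw i j.succ = j.succ := by
      apply Equiv.swap_apply_of_ne_of_ne <;> intro h <;> simp [Fin.ext_iff] at h <;> omega
    have a3 : sw j i.castSucc = i.castSucc := by
      apply Equiv.swap_apply_of_ne_of_ne <;> intro h <;> simp [Fin.ext_iff] at h <;> omega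
    have a4 : sw j i.succ = i.succ := by
      apply Equiv.swap_apply_of_ne_of_ne <;> intro h <;> simp [Fin.ext_iff] at h <;> omega
    have hc : sw i * sw j = sw j * sw i := by
      rw [← mul_inv_eq_iff_eq_mul]
      conv_rhs => rw [sw]
      conv_lhs => rw [sw.eq_1 j]
      rw [← Equiv.swap_apply_apply, a1, a2]
    rw [← Equiv.sum_comp (Equiv.mulRight (sw i * sw j)) (fun e => yo hi f i e * yo hi f j e)]
    refine Finset.sum_congr rfl fun e _ => ?_
    have e1 : e * (sw i * sw j) * sw i = e * sw j := by
      rw [hc, mul_assoc, mul_assoc, sw_sq, mul_one]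
    have e2 : e * (sw i * sw j) * sw j = e * sw i := by
      rw [mul_assoc, mul_assoc, sw_sq, mul_one]
    simp only [xo, yo, Equiv.coe_mulRight, e1, e2]
    simp only [Equiv.Perm.mul_apply, a1, a2, a3, a4, sw_cast, sw_succ]
    by_cases h1 : hi (e i.castSucc) <;> by_cases h2 : hi (e i.succ) <;>
    by_cases h3 : hi (e j.castSucc) <;> by_cases h4 : hi (e j.succ) <;> simp [h1, h2, h3, h4, mul_comm]

lemma sl2_identity {N : ℕ} (hi : Fin (N+1) → Prop) (f : Equiv.Perm (Fin (N+1)) → ℝ) :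
    ∑ e, (∑ i : Fin N, √((((i:ℕ):ℝ) + 1) * ((N:ℝ) - (i:ℕ))) * xo hi f i e) ^ 2
      = ∑ e, (∑ i : Fin N, √((((i:ℕ):ℝ) + 1) * ((N:ℝ) - (i:ℕ))) * yo hi f i e) ^ 2
      + ∑ e, (((univ.filter hi).card : ℝ) * N - 2 * (rk hi e : ℝ)) * f e ^ 2 := by
  set c : Fin N → ℝ := fun i => (((i:ℕ):ℝ) + 1) * ((N:ℝ) - (i:ℕ)) with hc
  have hc0 : ∀ i, 0 ≤ c i := by
    intro i
    have : ((i:ℕ):ℝ) ≤ N := by exact_mod_cast i.2.le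
    apply mul_nonneg <;> [positivity; linarith]
  have ex : ∀ z : Fin N → Equiv.Perm (Fin (N+1)) → ℝ,
      ∑ e, (∑ i : Fin N, √(c i) * z i e) ^ 2
        = ∑ i, ∑ j, √(c i) * √(c j) * ∑ e, z i e * z j e := by
    intro z
    simp only [sq, Finset.sum_mul_sum]
    simp only [Finset.mul_sum]
    rw [Finset.sum_comm]
    refine Finset.sum_congr rfl fun i _ => ?_
    rw [Finset.sum_comm]
    refine Finset.sum_congr rfl fun j _ => Finset.sum_congr rfl fun e _ => ?_
    ring
  rw [ex (xo hi f), ex (yo hi f)]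
  have hz : ∀ i j, ∑ e, xo hi f i e * xo hi f j e = ∑ e, yo hi f i e * yo hi f j e +
      if i = j then ∑ e : Equiv.Perm (Fin (N+1)), ((if hi (e i.castSucc) then (1:ℝ) else 0) - (if hi (e i.succ) then 1 else 0))
        * f e ^ 2 else 0 := by
    intro i j
    split_ifs with h
    · subst h; exact xo_diag hi f i
    · rw [add_zero]; exact xo_off hi f i j h
  simp only [hz, mul_add, Finset.sum_add_distrib]
  congr 1
  simp only [mul_ite, mul_zero, Finset.sum_ite_eq, Finset.mem_univ, if_true, Real.mul_self_sqrt (hc0 _)]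
  simp only [Finset.mul_sum]
  rw [Finset.sum_comm]
  refine Finset.sum_congr rfl fun e _ => ?_
  simp only [← mul_assoc]
  rw [← Finset.sum_mul]
  congr 1
  rw [abel_fin N (fun k => if hi (e k) then (1:ℝ) else 0)]
  simp only [sub_mul, Finset.sum_sub_distrib]
  congr 1
  · rw [← Finset.mul_sum, mul_comm]
    congr 1
    rw [Equiv.sum_comp e (fun k => if hi k then (1:ℝ) else 0)]
    simp
  · unfold rk
    push_cast
    rw [Finset.mul_sum]
    refine Finset.sum_congr rfl fun k _ => ?_
    split_ifs <;> simp


lemma linalg_card' {E : Type*} [Fintype E] (T : (E → ℝ) →ₗ[ℝ] (E → ℝ)) (B D : Finset E)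
    (h : ∀ f : E → ℝ, (∀ e, e ∉ B → f e = 0) → (∀ e' ∈ D, T f e' = 0) → f = 0) :
    B.card ≤ D.card := by
  refine linalg_card (fun e' e => T (Pi.single e 1) e') B D ?_
  intro f h1 h2
  refine h f h1 fun e' he' => ?_
  rw [← h2 e' he', LinearMap.pi_apply_eq_sum_univ T f]
  simp only [Finset.sum_apply, Pi.smul_apply, smul_eq_mul]
  refine Finset.sum_congr rfl fun x _ => ?_
  rw [mul_comm]
  congr 1
  refine congrFun (congrArg T ?_) e'
  ext j
  simp [Pi.single_apply, eq_comm]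

noncomputable def Xop {N : ℕ} (hi : Fin (N+1) → Prop) :
    (Equiv.Perm (Fin (N+1)) → ℝ) →ₗ[ℝ] (Equiv.Perm (Fin (N+1)) → ℝ) where
  toFun f e := ∑ i : Fin N, √((((i:ℕ):ℝ) + 1) * ((N:ℝ) - (i:ℕ))) * xo hi f i e
  map_add' f g := by
    ext e
    simp only [Pi.add_apply, ← Finset.sum_add_distrib, ← mul_add]
    refine Finset.sum_congr rfl fun i _ => ?_
    simp only [xo]; split_ifs <;> simp
  map_smul' c f := by
    ext e
    simp only [Pi.smul_apply, smul_eq_mul, Finset.mul_sum, RingHom.id_apply]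
    refine Finset.sum_congr rfl fun i _ => ?_
    simp only [xo]; split_ifs <;> simp [mul_left_comm]

noncomputable def Yop {N : ℕ} (hi : Fin (N+1) → Prop) :
    (Equiv.Perm (Fin (N+1)) → ℝ) →ₗ[ℝ] (Equiv.Perm (Fin (N+1)) → ℝ) where
  toFun f e := ∑ i : Fin N, √((((i:ℕ):ℝ) + 1) * ((N:ℝ) - (i:ℕ))) * yo hi f i e
  map_add' f g := by
    ext e
    simp only [Pi.add_apply, ← Finset.sum_add_distrib, ← mul_add]
    refine Finset.sum_congr rfl fun i _ => ?_
    simp only [yo]; split_ifs <;> simp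
  map_smul' c f := by
    ext e
    simp only [Pi.smul_apply, smul_eq_mul, Finset.mul_sum, RingHom.id_apply]
    refine Finset.sum_congr rfl fun i _ => ?_
    simp only [yo]; split_ifs <;> simp [mul_left_comm]

def Rup {N : ℕ} (hi : Fin (N+1) → Prop) (e e' : Equiv.Perm (Fin (N+1))) : Prop :=
  ∃ i : Fin N, hi (e i.castSucc) ∧ ¬ hi (e i.succ) ∧ e' = e * sw i

lemma sl2' {N : ℕ} (hi : Fin (N+1) → Prop) (f : Equiv.Perm (Fin (N+1)) → ℝ) :
    ∑ e, (Xop hi f e) ^ 2 = ∑ e, (Yop hi f e) ^ 2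
      + ∑ e, (((univ.filter hi).card : ℝ) * N - 2 * (rk hi e : ℝ)) * f e ^ 2 :=
  sl2_identity hi f

lemma shadow_up {N : ℕ} (hi : Fin (N+1) → Prop) (B : Finset (Equiv.Perm (Fin (N+1)))) (r : ℕ)
    (hr : 2 * r < (univ.filter hi).card * N) (hB : ∀ e ∈ B, rk hi e = r) :
    B.card ≤ (univ.filter (fun e' => ∃ e ∈ B, Rup hi e e')).card := by
  refine linalg_card' (Xop hi) B _ ?_
  intro f hf h0
  have hX : ∀ e', Xop hi f e' = 0 := by
    intro e'
    by_cases h : e' ∈ univ.filter (fun e' => ∃ e ∈ B, Rup hi e e')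
    · exact h0 e' h
    · simp only [Xop, LinearMap.coe_mk, AddHom.coe_mk]
      refine Finset.sum_eq_zero fun i _ => ?_
      simp only [xo]
      split_ifs with hh
      · rw [hf, mul_zero]
        intro hm
        apply h
        simp only [mem_filter, mem_univ, true_and]
        refine ⟨_, hm, i, ?_, ?_, ?_⟩
        · simpa [Equiv.Perm.mul_apply, sw_cast] using hh.2
        · simpa [Equiv.Perm.mul_apply, sw_succ] using hh.1
        · rw [mul_assoc, sw_sq, mul_one]
      · simp
  have hid := sl2' hi f
  have hr' : (2:ℝ) * r < (univ.filter hi).card * N := by exact_mod_cast hr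
  have hnn : ∀ e ∈ (univ : Finset (Equiv.Perm (Fin (N+1)))), 0 ≤ (((univ.filter hi).card : ℝ) * N - 2 * (rk hi e : ℝ)) * f e ^ 2 := by
    intro e _
    by_cases he : e ∈ B
    · rw [hB e he]; apply mul_nonneg <;> [linarith; positivity]
    · simp [hf e he]
  have hy : 0 ≤ ∑ e, (Yop hi f e) ^ 2 := by positivity
  have hs := Finset.sum_nonneg hnn
  have hz : ∑ e, (((univ.filter hi).card : ℝ) * N - 2 * (rk hi e : ℝ)) * f e ^ 2 = 0 := by
    have h00 : ∑ e : Equiv.Perm (Fin (N+1)), (Xop hi f e) ^ 2 = 0 :=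
      Finset.sum_eq_zero fun e _ => by rw [hX e]; norm_num
    rw [h00] at hid
    linarith
  rw [Finset.sum_eq_zero_iff_of_nonneg hnn] at hz
  ext e
  by_cases he : e ∈ B
  · have := hz e (mem_univ _)
    rw [hB e he] at this
    rcases mul_eq_zero.1 this with h | h
    · linarith
    · simpa using h
  · exact hf e he

lemma shadow_down {N : ℕ} (hi : Fin (N+1) → Prop) (B : Finset (Equiv.Perm (Fin (N+1)))) (r : ℕ)
    (hr : (univ.filter hi).card * N < 2 * r) (hB : ∀ e ∈ B, rk hi e = r) :
    B.card ≤ (univ.filter (fun e' => ∃ e ∈ B, Rup hi e' e)).card := by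
  refine linalg_card' (Yop hi) B _ ?_
  intro f hf h0
  have hX : ∀ e', Yop hi f e' = 0 := by
    intro e'
    by_cases h : e' ∈ univ.filter (fun e' => ∃ e ∈ B, Rup hi e' e)
    · exact h0 e' h
    · simp only [Yop, LinearMap.coe_mk, AddHom.coe_mk]
      refine Finset.sum_eq_zero fun i _ => ?_
      simp only [yo]
      split_ifs with hh
      · rw [hf, mul_zero]
        intro hm
        apply h
        simp only [mem_filter, mem_univ, true_and]
        exact ⟨_, hm, i, hh.1, hh.2, rfl⟩
      · simp
  have hid := sl2' hi f
  have hr' : ((univ.filter hi).card * N : ℝ) < 2 * r := by exact_mod_cast hr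
  have hnn : ∀ e ∈ (univ : Finset (Equiv.Perm (Fin (N+1)))), 0 ≤ -((((univ.filter hi).card : ℝ) * N - 2 * (rk hi e : ℝ)) * f e ^ 2) := by
    intro e _
    rw [← neg_mul]
    by_cases he : e ∈ B
    · rw [hB e he]; apply mul_nonneg <;> [linarith; positivity]
    · simp [hf e he]
  have hy : 0 ≤ ∑ e, (Xop hi f e) ^ 2 := by positivity
  have hs := Finset.sum_nonneg hnn
  have hz : ∑ e, -((((univ.filter hi).card : ℝ) * N - 2 * (rk hi e : ℝ)) * f e ^ 2) = 0 := by
    have h00 : ∑ e : Equiv.Perm (Fin (N+1)), (Yop hi f e) ^ 2 = 0 :=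
      Finset.sum_eq_zero fun e _ => by rw [hX e]; norm_num
    rw [h00] at hid
    rw [Finset.sum_neg_distrib] at hs ⊢
    linarith
  rw [Finset.sum_eq_zero_iff_of_nonneg hnn] at hz
  ext e
  by_cases he : e ∈ B
  · have := hz e (mem_univ _)
    rw [hB e he] at this
    rcases mul_eq_zero.1 (neg_eq_zero.1 this) with h | h
    · linarith
    · simpa using h
  · exact hf e he

lemma rk_up {N : ℕ} (hi : Fin (N+1) → Prop) (e e' : Equiv.Perm (Fin (N+1))) (h : Rup hi e e') :
    rk hi e' = rk hi e + 1 := by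
  obtain ⟨i, h1, h2, rfl⟩ := h
  unfold rk
  rw [← Equiv.sum_comp (sw i)]
  have : (∑ k : Fin (N+1), if k = i.castSucc then 1 else 0) = (1:ℕ) := by simp
  refine Eq.trans ?_ (congrArg (fun t => (∑ k : Fin (N+1), if hi (e k) then (k:ℕ) else 0) + t) this)
  rw [← Finset.sum_add_distrib]
  refine Finset.sum_congr rfl fun k _ => ?_
  have hk : (e * sw i) (sw i k) = e k := by simp [sw]
  rw [hk]
  by_cases a : k = i.castSucc
  · subst a; simp [h1, sw_cast]
  · by_cases b : k = i.succ
    · subst b; simp [h2]; 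
      intro h; exact absurd h a
    · have : sw i k = k := Equiv.swap_apply_of_ne_of_ne a b
      simp [this, a]

lemma half_shift {E : Type*} [Fintype E] (R : E → E → Prop) (A : Finset E) (Q : E → Prop) (ρ : E → ℤ)
    (μ : ℤ) (hR : ∀ e e', R e e' → ρ e' = ρ e + 1)
    (hQ : ∀ e e', R e e' → (e ∈ A ∨ Q e) → Q e') (hAQ : ∀ e ∈ A, ¬ Q e)
    (hsh : ∀ r < μ, ∀ B : Finset E, (∀ e ∈ B, ρ e = r) →
      B.card ≤ (univ.filter (fun e' => ∃ e ∈ B, R e e')).card) :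
    ∃ B : Finset E, (∀ e ∈ B, ρ e = μ ∧ Q e) ∧ (A.filter (fun e => ρ e < μ)).card ≤ B.card := by
  obtain ⟨r0, hr0, hr0'⟩ : ∃ r0 : ℤ, r0 ≤ μ ∧ ∀ e, r0 ≤ ρ e := by
    refine ⟨-(∑ e, |ρ e|) - |μ|, ?_, fun e => ?_⟩
    · have : 0 ≤ ∑ e, |ρ e| := Finset.sum_nonneg fun _ _ => abs_nonneg _
      have := neg_abs_le μ
      linarith
    · have := Finset.single_le_sum (f := fun e => |ρ e|) (fun _ _ => abs_nonneg _) (mem_univ e)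
      have h2 := neg_abs_le (ρ e)
      have := abs_nonneg μ
      linarith
  suffices H : ∀ r, r0 ≤ r → r ≤ μ → ∃ B : Finset E, (∀ e ∈ B, ρ e = r ∧ Q e) ∧
      (A.filter (fun e => ρ e < r)).card ≤ B.card from H μ hr0 le_rfl
  intro r hr
  induction r, hr using Int.leInduction with
  | base =>
    intro _
    refine ⟨∅, by simp, ?_⟩
    simp only [card_empty, Nat.le_zero, card_eq_zero]
    ext e; simp; intro _; exact hr0' e
  | succ r hr ih =>
    intro hle
    obtain ⟨B, hB, hc⟩ := ih (by omega)
    have hd : Disjoint B (A.filter (fun e => ρ e = r)) := by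
      rw [Finset.disjoint_left]
      intro e he he'
      exact hAQ e (mem_filter.1 he').1 (hB e he).2
    refine ⟨univ.filter (fun e' => ∃ e ∈ B ∪ A.filter (fun e => ρ e = r), R e e'), ?_, ?_⟩
    · intro e' he'
      simp only [mem_filter, mem_univ, true_and, mem_union] at he'
      obtain ⟨e, he, hre⟩ := he'
      rcases he with he | he
      · exact ⟨by rw [hR _ _ hre, (hB e he).1], hQ _ _ hre (Or.inr (hB e he).2)⟩
      · exact ⟨by rw [hR _ _ hre, he.2], hQ _ _ hre (Or.inl he.1)⟩
    · refine le_trans ?_ (hsh r (by omega) _ ?_)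
      · rw [Finset.card_union_of_disjoint hd]
        refine le_trans ?_ (Nat.add_le_add_right hc _)
        rw [← Finset.card_union_of_disjoint]
        · apply Finset.card_le_card
          intro e
          simp only [mem_filter, mem_union]
          rintro ⟨h1, h2⟩
          rcases lt_or_eq_of_le (Int.lt_add_one_iff.1 h2) with h | h
          · exact Or.inl ⟨h1, h⟩
          · exact Or.inr ⟨h1, h⟩
        · rw [Finset.disjoint_left]
          intro e he he'
          simp only [mem_filter] at he he'
          omega
      · intro e he
        simp only [mem_union, mem_filter] at he
        rcases he with he | he
        · exact (hB e he).1
        · exact he.2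

lemma sperner_perm {N : ℕ} (hi : Fin (N+1) → Prop) (F : Equiv.Perm (Fin (N+1)) → ℝ) (d a : ℝ)
    (hd : 0 < d)
    (hF : ∀ e e', Rup hi e e' → F e + d ≤ F e') :
    ∃ s, (univ.filter (fun e => a ≤ F e ∧ F e < a + d)).card ≤
      (univ.filter (fun e => rk hi e = s)).card := by
  set A := univ.filter (fun e => a ≤ F e ∧ F e < a + d) with hA
  set μ := (univ.filter hi).card * N / 2 with hμ
  obtain ⟨B, hB, hBc⟩ := half_shift (Rup hi) A (fun e => a + d ≤ F e) (fun e => (rk hi e : ℤ)) μ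
    (by intro e e' h; rw [rk_up hi e e' h]; push_cast; rfl)
    (by
      intro e e' h h'
      have := hF e e' h
      rcases h' with h' | h'
      · simp only [hA, mem_filter] at h'; linarith [h'.2.1]
      · linarith)
    (by intro e he; simp only [hA, mem_filter] at he; push Not; exact he.2.2)
    (by
      intro r hr B hB
      rcases B.eq_empty_or_nonempty with h | ⟨e, he⟩
      · simp [h]
      · have := hB e he
        refine shadow_up hi B (rk hi e) (by omega) ?_
        intro e' he'; have := hB e' he'; omega)
  obtain ⟨C, hC, hCc⟩ := half_shift (fun e e' => Rup hi e' e) A (fun e => F e < a) (fun e => -(rk hi e : ℤ)) (-μ)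
    (by intro e e' h; rw [rk_up hi e' e h]; push_cast; ring)
    (by
      intro e e' h h'
      have := hF e' e h
      rcases h' with h' | h'
      · simp only [hA, mem_filter] at h'; linarith [h'.2.2]
      · linarith)
    (by intro e he; simp only [hA, mem_filter] at he; push Not; exact he.2.1)
    (by
      intro r hr B hB
      rcases B.eq_empty_or_nonempty with h | ⟨e, he⟩
      · simp [h]
      · have := hB e he
        refine shadow_down hi B (rk hi e) (by omega) ?_
        intro e' he'; have := hB e' he'; omega)
  refine ⟨μ, ?_⟩
  have hsplit : A.card ≤ (A.filter (fun e => (rk hi e : ℤ) < μ)).card + (A.filter (fun e => rk hi e = μ)).card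
      + (A.filter (fun e => -(rk hi e : ℤ) < -μ)).card := by
    refine le_trans (Finset.card_le_card ?_) (le_trans (Finset.card_union_le _ _) (Nat.add_le_add_right (Finset.card_union_le _ _) _))
    intro e he
    simp only [mem_union, mem_filter, he, true_and]
    omega
  have d1 : Disjoint B (A.filter (fun e => rk hi e = μ)) := by
    rw [Finset.disjoint_left]; intro e h1 h2
    have := (hB e h1).2
    simp only [hA, mem_filter] at h2
    linarith [h2.1.2.2]
  have d2 : Disjoint (B ∪ (A.filter (fun e => rk hi e = μ))) C := by
    rw [Finset.disjoint_left]; intro e h1 h2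
    have h3 := (hC e h2).2
    rw [mem_union] at h1
    rcases h1 with h1 | h1
    · have := (hB e h1).2; linarith
    · simp only [hA, mem_filter] at h1
      linarith [h1.1.2.1]
  calc A.card ≤ _ := hsplit
    _ ≤ B.card + (A.filter (fun e => rk hi e = μ)).card + C.card := by omega
    _ = (B ∪ (A.filter (fun e => rk hi e = μ)) ∪ C).card := by
      rw [Finset.card_union_of_disjoint d2, Finset.card_union_of_disjoint d1]
    _ ≤ _ := by
      apply Finset.card_le_card
      intro e he
      simp only [mem_union, mem_filter, mem_univ, true_and] at he ⊢
      rcases he with (he | he) | he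
      · have := (hB e he).1; simpa using this
      · exact he.2
      · have := (hC e he).1; simpa using this


lemma centralBinom_sq (j : ℕ) : (Nat.centralBinom j) ^ 2 * (2 * j + 1) ≤ 16 ^ j := by
  induction j with
  | zero => simp
  | succ j ih =>
    have h := Nat.succ_mul_centralBinom_succ j
    have hp : 0 < (j + 1) ^ 2 := by positivity
    refine Nat.le_of_mul_le_mul_left ?_ hp
    calc (j+1)^2 * ((Nat.centralBinom (j+1)) ^ 2 * (2 * (j+1) + 1))
        = ((j+1) * Nat.centralBinom (j+1))^2 * (2*j+3) := by ring
      _ = (Nat.centralBinom j ^ 2 * (2*j+1)) * (4 * (2*j+1) * (2*j+3)) := by rw [h]; ring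
      _ ≤ 16 ^ j * (4 * (2*j+1) * (2*j+3)) := Nat.mul_le_mul_right _ ih
      _ ≤ 16 ^ j * (16 * (j+1)^2) := by
        apply Nat.mul_le_mul_left; nlinarith
      _ = _ := by ring

lemma choose_sq (k e : ℕ) : (k.choose e) ^ 2 * (k + 1) ≤ 4 ^ k := by
  have h0 : k.choose e ≤ k.choose (k/2) := Nat.choose_le_middle e k
  refine le_trans (Nat.mul_le_mul_right _ (Nat.pow_le_pow_left h0 2)) ?_
  rcases Nat.even_or_odd' k with ⟨j, rfl | rfl⟩
  · have := centralBinom_sq j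
    rw [Nat.centralBinom] at this
    rw [Nat.mul_div_cancel_left _ (by norm_num)]
    calc _ ≤ _ := this
      _ = _ := by rw [pow_mul]; norm_num
  · have h1 := centralBinom_sq (j+1)
    have h2 : (2*j+1)/2 = j := by omega
    have h3 : Nat.centralBinom (j+1) = 2 * (2*j+1).choose j := by
      rw [Nat.centralBinom_eq_two_mul_choose]
      have : 2 * (j+1) = (2*j+1) + 1 := by ring
      rw [this, Nat.choose_succ_succ, Nat.choose_symm_half]; ring
    rw [h3] at h1
    rw [h2]
    have h4 : (16:ℕ)^(j+1) = 4 * 4^(2*j+1) := by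
      have : (16:ℕ) = 4^2 := by norm_num
      rw [this, ← pow_mul]; ring
    rw [h4] at h1
    nlinarith [sq_nonneg ((2*j+1).choose j)]

lemma choose_real (k e : ℕ) : (k.choose e : ℝ) ≤ 2 ^ k / √((k:ℝ) + 1) := by
  have h : ((k.choose e : ℝ)) ^ 2 * ((k:ℝ) + 1) ≤ 4 ^ k := by exact_mod_cast choose_sq k e
  rw [le_div_iff₀ (by positivity)]
  refine (sq_le_sq₀ (by positivity) (by positivity)).1 ?_
  rw [mul_pow, Real.sq_sqrt (by positivity)]
  calc _ ≤ _ := h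
    _ = _ := by rw [← pow_mul, mul_comm, pow_mul]; norm_num

def pt {h : ℕ} (x : Fin h × Bool) : Fin h × Bool := (x.1, !x.2)
lemma pt_pt {h : ℕ} (x : Fin h × Bool) : pt (pt x) = x := by simp [pt]
lemma pt_ne {h : ℕ} (x : Fin h × Bool) : pt x ≠ x := by
  intro hx; have := congrArg Prod.snd hx; simp [pt] at this

noncomputable def sing {h : ℕ} (S : Finset (Fin h × Bool)) : Finset (Fin h × Bool) :=
  S.filter (fun x => pt x ∉ S)

noncomputable def Kc {h : ℕ} (S : Finset (Fin h × Bool)) : ℕ := (sing S).card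

lemma Kc_insert {h : ℕ} (S : Finset (Fin h × Bool)) (x : Fin h × Bool) (h1 : x ∉ S) (h2 : pt x ∉ S) :
    Kc (insert x S) = Kc S + 1 := by
  have : sing (insert x S) = insert x (sing S) := by
    ext y
    simp only [sing, mem_filter, mem_insert]
    by_cases hy : y = x
    · subst hy; simp [h2, pt_ne]
    · have : y ∈ S → pt y ≠ x := by
        rintro hS rfl; rw [pt_pt] at h2; exact h2 hS
      simp only [hy, false_or]
      tauto
  rw [Kc, this, card_insert_of_notMem (by simp [sing, h1]), Kc]

lemma Kc_erase {h : ℕ} (S : Finset (Fin h × Bool)) (x : Fin h × Bool) :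
    Kc (S.erase x) ≤ Kc S + 1 := by
  have : sing (S.erase x) ⊆ insert (pt x) (sing S) := by
    intro y
    simp only [sing, mem_filter, mem_insert, mem_erase]
    rintro ⟨⟨h1, h2⟩, h3⟩
    by_cases hy : pt y = x
    · left; rw [← hy, pt_pt]
    · right; exact ⟨h2, fun h => h3 ⟨hy, h⟩⟩
  exact le_trans (card_le_card this) (card_insert_le _ _)

lemma D1 (h q : ℕ) :
    ∑ S ∈ powersetCard q (univ : Finset (Fin h × Bool)), ((2 * h - 2 * q : ℝ) * (1 / ((Kc S : ℝ) + 1)))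
      ≤ (2 * h).choose (q + 1) := by
  let Em : Finset (Fin h × Bool) → Finset (Fin h × Bool) := fun S => univ.filter (fun x => x ∉ S ∧ pt x ∉ S)
  have hE : ∀ S ∈ powersetCard q (univ : Finset (Fin h × Bool)), (2 * h - 2 * q : ℝ) ≤ (Em S).card := by
    intro S hS
    have hc := (mem_powersetCard.1 hS).2
    have : (univ : Finset (Fin h × Bool)) ⊆ Em S ∪ (S ∪ S.image pt) := by
      intro x _
      simp only [Em, mem_union, mem_filter, mem_univ, true_and, mem_image]
      by_cases h1 : x ∈ S
      · simp [h1]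
      · by_cases h2 : pt x ∈ S
        · right; right; exact ⟨_, h2, pt_pt x⟩
        · left; exact ⟨h1, h2⟩
    have h1 := card_le_card this
    have h2 := card_union_le (Em S) (S ∪ S.image pt)
    have h3 := card_union_le S (S.image pt)
    have h4 : (S.image pt).card ≤ S.card := card_image_le
    simp at h1
    have : 2 * h ≤ (Em S).card + 2 * q := by omega
    have : (2 * h : ℝ) ≤ (Em S).card + 2 * q := by exact_mod_cast this
    linarith
  calc _ ≤ ∑ S ∈ powersetCard q (univ : Finset (Fin h × Bool)), ∑ x ∈ Em S, (1 / ((Kc S : ℝ) + 1)) := by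
        refine sum_le_sum fun S hS => ?_
        rw [sum_const, nsmul_eq_mul]
        exact mul_le_mul_of_nonneg_right (hE S hS) (by positivity)
    _ = ∑ T ∈ powersetCard (q+1) (univ : Finset (Fin h × Bool)), ∑ x ∈ sing T, (1 / (Kc T : ℝ)) := by
        rw [sum_sigma', sum_sigma']
        refine sum_bij' (fun p _ => ⟨insert p.2 p.1, p.2⟩) (fun p _ => ⟨p.1.erase p.2, p.2⟩) ?_ ?_ ?_ ?_ ?_
        · rintro ⟨S, x⟩ hp
          simp only [mem_sigma, mem_powersetCard, Em, mem_filter, mem_univ, true_and, subset_univ] at hp ⊢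
          obtain ⟨h1, h2, h3⟩ := hp
          refine ⟨by rw [card_insert_of_notMem h2, h1], ?_⟩
          simp [sing, h3, pt_ne]
        · rintro ⟨T, x⟩ hp
          simp only [mem_sigma, mem_powersetCard, Em, mem_filter, mem_univ, true_and, subset_univ, sing] at hp ⊢
          obtain ⟨h1, h2, h3⟩ := hp
          refine ⟨by rw [card_erase_of_mem h2, h1]; rfl, by simp, fun h => h3 (mem_of_mem_erase h)⟩
        · rintro ⟨S, x⟩ hp
          simp only [mem_sigma, Em, mem_filter] at hp
          simp [erase_insert hp.2.2.1]
        · rintro ⟨T, x⟩ hp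
          simp only [mem_sigma, sing, mem_filter] at hp
          simp [insert_erase hp.2.1]
        · rintro ⟨S, x⟩ hp
          simp only [mem_sigma, Em, mem_filter] at hp
          simp only [Kc_insert S x hp.2.2.1 hp.2.2.2]
          push_cast; rfl
    _ ≤ ∑ T ∈ powersetCard (q+1) (univ : Finset (Fin h × Bool)), 1 := by
        refine sum_le_sum fun T _ => ?_
        rw [sum_const, nsmul_eq_mul, mul_one_div]
        exact div_self_le_one _
    _ = _ := by
        simp [mul_comm]

lemma D2 (h q s : ℕ) (g : Finset (Fin h × Bool) → ℝ) (hg0 : ∀ S, 0 ≤ g S)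
    (hg : ∀ S, ∀ x ∈ S, g S ≤ 2 * g (S.erase x)) :
    ((q:ℝ) + 1) * ∑ S ∈ (powersetCard (q+1) (univ : Finset (Fin h × Bool))).filter
        (fun S => (∑ x ∈ S, (x.1 : ℕ)) ≡ s [MOD h]), g S
      ≤ 4 * ∑ S ∈ powersetCard q (univ : Finset (Fin h × Bool)), g S := by
  let Ex : Finset (Fin h × Bool) → Finset (Fin h × Bool) := fun S =>
    univ.filter (fun x => x ∉ S ∧ (∑ x ∈ insert x S, (x.1 : ℕ)) ≡ s [MOD h])
  have hEx : ∀ S, (Ex S).card ≤ 2 := by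
    intro S
    rcases (Ex S).eq_empty_or_nonempty with he | ⟨y, hy⟩
    · simp [he]
    have : Ex S ⊆ {(y.1, false), (y.1, true)} := by
      intro x hx
      simp only [Ex, mem_filter, mem_univ, true_and] at hx hy
      rw [sum_insert hx.1] at hx
      rw [sum_insert hy.1] at hy
      have h1 : (x.1:ℕ) ≡ y.1 [MOD h] := Nat.ModEq.add_right_cancel' _ (hx.2.trans hy.2.symm)
      have h2 : x.1 = y.1 := Fin.ext (Nat.ModEq.eq_of_lt_of_lt h1 x.1.2 y.1.2)
      obtain ⟨i, b⟩ := x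
      simp only at h2; subst h2
      cases b <;> simp
    exact le_trans (card_le_card this) (card_le_two)
  calc _ = ∑ S ∈ (powersetCard (q+1) (univ : Finset (Fin h × Bool))).filter
        (fun S => (∑ x ∈ S, (x.1 : ℕ)) ≡ s [MOD h]), ∑ x ∈ S, g S := by
        rw [mul_sum]
        refine sum_congr rfl fun S hS => ?_
        rw [sum_const, nsmul_eq_mul, (mem_powersetCard.1 (mem_filter.1 hS).1).2]
        push_cast; rfl
    _ ≤ ∑ S ∈ (powersetCard (q+1) (univ : Finset (Fin h × Bool))).filter
        (fun S => (∑ x ∈ S, (x.1 : ℕ)) ≡ s [MOD h]), ∑ x ∈ S, 2 * g (S.erase x) :=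
        sum_le_sum fun S _ => sum_le_sum fun x hx => hg S x hx
    _ = ∑ S ∈ powersetCard q (univ : Finset (Fin h × Bool)), ∑ x ∈ Ex S, 2 * g S := by
        rw [sum_sigma', sum_sigma']
        refine sum_bij' (fun p _ => ⟨p.1.erase p.2, p.2⟩) (fun p _ => ⟨insert p.2 p.1, p.2⟩) ?_ ?_ ?_ ?_ ?_
        · rintro ⟨T, x⟩ hp
          simp only [mem_sigma, mem_powersetCard, Ex, mem_filter, mem_univ, true_and, subset_univ] at hp ⊢
          obtain ⟨⟨h1, h2⟩, h3⟩ := hp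
          refine ⟨by rw [card_erase_of_mem h3, h1]; rfl, by simp, ?_⟩
          rw [insert_erase h3]; exact h2
        · rintro ⟨S, x⟩ hp
          simp only [mem_sigma, mem_powersetCard, Ex, mem_filter, mem_univ, true_and, subset_univ] at hp ⊢
          obtain ⟨h1, h2, h3⟩ := hp
          exact ⟨⟨by rw [card_insert_of_notMem h2, h1], h3⟩, by simp⟩
        · rintro ⟨T, x⟩ hp
          simp only [mem_sigma] at hp
          simp [insert_erase hp.2]
        · rintro ⟨S, x⟩ hp
          simp only [mem_sigma, Ex, mem_filter] at hp
          simp [erase_insert hp.2.2.1]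
        · rintro ⟨S, x⟩ hp
          rfl
    _ ≤ ∑ S ∈ powersetCard q (univ : Finset (Fin h × Bool)), 4 * g S := by
        refine sum_le_sum fun S _ => ?_
        rw [sum_const, nsmul_eq_mul]
        have : ((Ex S).card : ℝ) ≤ 2 := by exact_mod_cast hEx S
        nlinarith [hg0 S]
    _ = _ := by rw [mul_sum]


noncomputable def flipE {h : ℕ} (F : Finset (Fin h)) : (Fin h × Bool) ≃ (Fin h × Bool) where
  toFun x := (x.1, xor x.2 (decide (x.1 ∈ F)))
  invFun x := (x.1, xor x.2 (decide (x.1 ∈ F)))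
  left_inv x := by simp
  right_inv x := by simp

def vl {h : ℕ} (x : Fin h × Bool) : ℕ := x.1 + if x.2 then h else 0

lemma vl_flip {h : ℕ} (F : Finset (Fin h)) (S : Finset (Fin h × Bool)) :
    ∑ x ∈ S.map (flipE F).toEmbedding, vl x = ∑ x ∈ S, (x.1 : ℕ) +
      h * (S.filter (fun x => xor x.2 (decide (x.1 ∈ F)) = true)).card := by
  rw [sum_map, card_filter, mul_sum, ← sum_add_distrib]
  refine sum_congr rfl fun x _ => ?_
  have e : (flipE F).toEmbedding x = (x.1, xor x.2 (decide (x.1 ∈ F))) := rfl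
  rw [e]
  generalize (x.2 ^^ decide (x.1 ∈ F)) = b
  cases b <;> simp [vl]

noncomputable def Ds {h : ℕ} (S : Finset (Fin h × Bool)) : Finset (Fin h) :=
  univ.filter (fun i => ((i, false) ∈ S ∧ (i, true) ∉ S) ∨ ((i, true) ∈ S ∧ (i, false) ∉ S))

lemma Ds_card {h : ℕ} (S : Finset (Fin h × Bool)) : (Ds S).card = Kc S := by
  have e1 : sing S = univ.filter (fun x => x ∈ S ∧ pt x ∉ S) := by ext; simp [sing]
  rw [Kc, e1, Ds, card_filter, card_filter, Fintype.sum_prod_type]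
  refine sum_congr rfl fun i _ => ?_
  rw [Fintype.sum_bool]
  by_cases a : (i, false) ∈ S <;> by_cases b : (i, true) ∈ S <;> simp [a, b, pt]

lemma count_F {h : ℕ} (S : Finset (Fin h × Bool)) (c : ℕ) :
    ((univ.filter (fun F : Finset (Fin h) =>
      (S.filter (fun x => xor x.2 (decide (x.1 ∈ F)) = true)).card = c)).card : ℝ)
      ≤ 2 ^ h * (1 / √((Kc S : ℝ) + 1)) := by
  set D := Ds S with hD
  set D1 : Finset (Fin h) := univ.filter (fun i => (i, false) ∉ S ∧ (i, true) ∈ S) with hD1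
  set J := (univ.filter (fun i : Fin h => (i, false) ∈ S ∧ (i, true) ∈ S)).card with hJ
  have key : ∀ F : Finset (Fin h), (S.filter (fun x => xor x.2 (decide (x.1 ∈ F)) = true)).card
      = (symmDiff F D1 ∩ D).card + J := by
    intro F
    have e1 : S.filter (fun x => xor x.2 (decide (x.1 ∈ F)) = true)
      = univ.filter (fun x => x ∈ S ∧ xor x.2 (decide (x.1 ∈ F)) = true) := by ext; simp
    have e2 : symmDiff F D1 ∩ D = univ.filter (fun i => i ∈ symmDiff F D1 ∩ D) := by ext; simp
    rw [e1, e2, hJ, card_filter, card_filter, card_filter, Fintype.sum_prod_type, ← sum_add_distrib]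
    refine sum_congr rfl fun i _ => ?_
    rw [Fintype.sum_bool]
    simp only [mem_inter, mem_symmDiff, hD1, hD, Ds, mem_filter, mem_univ, true_and]
    by_cases a : (i, false) ∈ S <;> by_cases b : (i, true) ∈ S <;> by_cases c : i ∈ F <;> simp [a, b, c]
  have hcard : (univ.filter (fun F : Finset (Fin h) =>
      (S.filter (fun x => xor x.2 (decide (x.1 ∈ F)) = true)).card = c)).card
      ≤ (powersetCard (c - J) D ×ˢ powerset Dᶜ).card := by
    refine card_le_card_of_injOn (fun F => (symmDiff F D1 ∩ D, symmDiff F D1 \ D)) ?_ ?_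
    · intro F hF
      simp only [coe_filter, mem_univ, true_and, Set.mem_ofPred_eq, key F] at hF
      simp only [coe_product, Set.mem_prod, mem_coe, mem_powersetCard, mem_powerset]
      refine ⟨⟨inter_subset_right, by omega⟩, ?_⟩
      intro i hi; simp at hi ⊢; exact hi.2
    · intro F _ G _ hFG
      simp only [Prod.mk.injEq] at hFG
      have : symmDiff F D1 = symmDiff G D1 := by
        rw [← Finset.sdiff_union_inter (symmDiff F D1) D, ← Finset.sdiff_union_inter (symmDiff G D1) D, hFG.1, hFG.2]
      exact symmDiff_left_injective D1 this
  have hDc : D.card = Kc S := Ds_card S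
  have hle : Kc S ≤ h := by rw [← hDc]; simpa using card_le_univ D
  rw [card_product, card_powersetCard, card_powerset, card_compl, hDc, Fintype.card_fin] at hcard
  calc _ ≤ (((Kc S).choose (c - J) * 2 ^ (h - Kc S) : ℕ) : ℝ) := by exact_mod_cast hcard
    _ = ((Kc S).choose (c - J) : ℝ) * 2 ^ (h - Kc S) := by push_cast; rfl
    _ ≤ (2 ^ (Kc S) / √((Kc S : ℝ) + 1)) * 2 ^ (h - Kc S) :=
        mul_le_mul_of_nonneg_right (choose_real _ _) (by positivity)
    _ = (2 ^ (Kc S) * 2 ^ (h - Kc S)) * (1 / √((Kc S : ℝ) + 1)) := by ring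
    _ = _ := by rw [← pow_add, Nat.add_sub_cancel' hle]

lemma D3 (h m s : ℕ) (hh : 0 < h) :
    (((powersetCard m (univ : Finset (Fin h × Bool))).filter (fun S => ∑ x ∈ S, vl x = s)).card : ℝ)
      ≤ ∑ S ∈ (powersetCard m (univ : Finset (Fin h × Bool))).filter
        (fun S => (∑ x ∈ S, (x.1 : ℕ)) ≡ s [MOD h]), 1 / √((Kc S : ℝ) + 1) := by
  set P := powersetCard m (univ : Finset (Fin h × Bool)) with hP
  have hF : ∀ F : Finset (Fin h), (P.filter (fun S => ∑ x ∈ S, vl x = s)).card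
      = (P.filter (fun S => ∑ x ∈ S.map (flipE F).toEmbedding, vl x = s)).card := by
    intro F
    symm
    refine card_bij (fun S _ => S.map (flipE F).toEmbedding) ?_ ?_ ?_
    · intro S hS
      simp only [hP, mem_filter, mem_powersetCard, subset_univ, true_and, card_map] at hS ⊢
      exact hS
    · intro S _ T _ h
      exact map_injective _ h
    · intro T hT
      have hfl : (T.map (flipE F).toEmbedding).map (flipE F).toEmbedding = T := by
        rw [map_map]
        ext x
        simp [flipE]
      refine ⟨T.map (flipE F).toEmbedding, ?_, hfl⟩
      simp only [mem_filter, hfl]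
      simp only [hP, mem_filter, mem_powersetCard, subset_univ, true_and, card_map] at hT ⊢
      exact hT
  have hsum : (2:ℝ)^h * ((P.filter (fun S => ∑ x ∈ S, vl x = s)).card : ℝ)
      = ∑ S ∈ P, ((univ.filter (fun F : Finset (Fin h) => ∑ x ∈ S.map (flipE F).toEmbedding, vl x = s)).card : ℝ) := by
    calc _ = ∑ F : Finset (Fin h), ((P.filter (fun S => ∑ x ∈ S, vl x = s)).card : ℝ) := by simp
      _ = ∑ F : Finset (Fin h), ((P.filter (fun S => ∑ x ∈ S.map (flipE F).toEmbedding, vl x = s)).card : ℝ) :=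
        sum_congr rfl fun F _ => by rw [hF F]
      _ = _ := by
        simp only [card_filter]
        push_cast
        rw [sum_comm]
  have hb : ∀ S ∈ P, ((univ.filter (fun F : Finset (Fin h) => ∑ x ∈ S.map (flipE F).toEmbedding, vl x = s)).card : ℝ)
      ≤ if (∑ x ∈ S, (x.1 : ℕ)) ≡ s [MOD h] then 2^h * (1 / √((Kc S : ℝ) + 1)) else 0 := by
    intro S _
    split_ifs with hmod
    · refine le_trans ?_ (count_F S ((s - ∑ x ∈ S, (x.1:ℕ)) / h))
      refine Nat.cast_le.2 (card_le_card ?_)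
      intro F
      simp only [mem_filter, mem_univ, true_and]
      intro hv
      rw [vl_flip] at hv
      rw [← hv, Nat.add_sub_cancel_left, Nat.mul_div_cancel_left _ hh]
    · refine le_of_eq ?_
      rw [Nat.cast_eq_zero, card_eq_zero, filter_eq_empty_iff]
      intro F _ hv
      apply hmod
      rw [vl_flip] at hv
      rw [← hv]
      simp [Nat.ModEq]
  have := sum_le_sum hb
  rw [← hsum, ← sum_filter, ← mul_sum] at this
  exact le_of_mul_le_mul_left this (by positivity)

lemma D_main (h m s : ℕ) (hh : 0 < h) (hm : 0 < m) (hmh : 3 * (m - 1) ≤ 2 * h) :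
    (((powersetCard m (univ : Finset (Fin h × Bool))).filter (fun S => ∑ x ∈ S, vl x = s)).card : ℝ)
      ≤ 12 * (2 * h).choose m / ((2 * h) * √m) := by
  obtain ⟨q, rfl⟩ : ∃ q, m = q + 1 := ⟨m - 1, by omega⟩
  simp only [Nat.add_sub_cancel] at hmh
  have hmhR : (3:ℝ) * q ≤ 2 * h := by exact_mod_cast hmh
  have hhR : (0:ℝ) < h := by exact_mod_cast hh
  have hqR : (0:ℝ) ≤ q := by positivity
  have hqh : q < 2 * h := by omega
  set t : ℝ := √((q + 1 : ℕ) : ℝ) with ht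
  have ht0 : 0 < t := by rw [ht]; positivity
  have htsq : t ^ 2 = q + 1 := by rw [ht, Real.sq_sqrt (by positivity)]; push_cast; rfl
  set g : Finset (Fin h × Bool) → ℝ := fun S => t * (1 / ((Kc S : ℝ) + 1)) + 1 / t with hg
  have hg0 : ∀ S, 0 ≤ g S := fun S => by simp only [hg]; positivity
  have hg2 : ∀ S, ∀ x ∈ S, g S ≤ 2 * g (S.erase x) := by
    intro S x _
    have h1 : (Kc (S.erase x) : ℝ) ≤ Kc S + 1 := by exact_mod_cast Kc_erase S x
    have h2 : (1 / ((Kc S : ℝ) + 1)) ≤ 2 * (1 / ((Kc (S.erase x) : ℝ) + 1)) := by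
      rw [mul_one_div, div_le_div_iff₀ (by positivity) (by positivity)]
      have : (0:ℝ) ≤ Kc S := by positivity
      linarith
    have h3 : 0 < 1 / t := by positivity
    simp only [hg]
    nlinarith [mul_le_mul_of_nonneg_left h2 ht0.le]
  have hsq : ∀ S : Finset (Fin h × Bool), 1 / √((Kc S : ℝ) + 1) ≤ (1/2) * g S := by
    intro S
    set k := √((Kc S : ℝ) + 1) with hk
    have hk0 : 0 < k := by rw [hk]; positivity
    have hk2 : ((Kc S : ℝ) + 1) = k ^ 2 := by rw [hk, Real.sq_sqrt (by positivity)]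
    simp only [hg]
    rw [hk2]
    have : (1/2) * (t * (1 / k ^ 2) + 1 / t) - 1 / k = (t - k)^2 / (2 * k^2 * t) := by
      field_simp; ring
    have h2 : 0 ≤ (t - k)^2 / (2 * k^2 * t) := by positivity
    linarith
  have a1 := D3 h (q+1) s hh
  have a2 := D2 h q s g hg0 hg2
  have a3 := D1 h q
  rw [← mul_sum] at a3
  set Z := ∑ S ∈ powersetCard q (univ : Finset (Fin h × Bool)), (1 / ((Kc S : ℝ) + 1)) with hZ
  have a4 : ∑ S ∈ powersetCard q (univ : Finset (Fin h × Bool)), g S = t * Z + (2*h).choose q / t := by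
    simp only [hg, sum_add_distrib, ← mul_sum, hZ]
    congr 1
    simp [mul_comm, div_eq_mul_inv]
  have a5 : ((2*h).choose q : ℝ) * (2 * h - q) = (2*h).choose (q+1) * (q+1) := by
    have := Nat.choose_succ_right_eq (2*h) q
    have h2 : (((2*h).choose (q+1) * (q+1) : ℕ) : ℝ) = (((2*h).choose q * (2*h - q) : ℕ) : ℝ) := by rw [this]
    push_cast [Nat.cast_sub hqh.le] at h2
    linarith
  have a6 : ∑ S ∈ (powersetCard (q+1) (univ : Finset (Fin h × Bool))).filter
        (fun S => (∑ x ∈ S, (x.1 : ℕ)) ≡ s [MOD h]), 1 / √((Kc S : ℝ) + 1)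
      ≤ (1/2) * ∑ S ∈ (powersetCard (q+1) (univ : Finset (Fin h × Bool))).filter
        (fun S => (∑ x ∈ S, (x.1 : ℕ)) ≡ s [MOD h]), g S := by
    rw [mul_sum]; exact sum_le_sum fun S _ => hsq S
  set G := ∑ S ∈ (powersetCard (q+1) (univ : Finset (Fin h × Bool))).filter
        (fun S => (∑ x ∈ S, (x.1 : ℕ)) ≡ s [MOD h]), g S with hG
  set c0 : ℝ := ((2*h).choose q : ℝ) with hc0
  set c1 : ℝ := ((2*h).choose (q+1) : ℝ) with hc1
  have hc1' : 0 ≤ c1 := by positivity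
  have hpos : (0:ℝ) < 2 * h - 2 * q := by linarith
  have b1 : Z ≤ 3 * c1 / (2*h) := by
    rw [le_div_iff₀ (by positivity)]
    have hZ0 : 0 ≤ Z := by rw [hZ]; exact sum_nonneg fun _ _ => by positivity
    nlinarith
  have b2 : c0 ≤ 3 * c1 * (q+1) / (2*h) := by
    rw [le_div_iff₀ (by positivity)]
    have : 0 ≤ c0 := by positivity
    nlinarith
  rw [a4] at a2
  have b3 : t * Z + c0 / t ≤ 6 * c1 * t / (2*h) := by
    have e1 : t * Z ≤ t * (3 * c1 / (2*h)) := mul_le_mul_of_nonneg_left b1 ht0.le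
    have e2 : c0 / t ≤ (3 * c1 * (q+1) / (2*h)) / t := div_le_div_of_nonneg_right b2 ht0.le
    rw [← htsq] at e2
    have e3 : (3 * c1 * t^2 / (2*h)) / t = t * (3 * c1 / (2*h)) := by field_simp
    have e4 : 6 * c1 * t / (2*h) = t * (3 * c1 / (2*h)) + t * (3 * c1 / (2*h)) := by ring
    linarith
  have b4 : (t^2) * G ≤ 24 * c1 * t / (2*h) := by
    rw [htsq]
    have : 4 * (6 * c1 * t / (2*h)) = 24 * c1 * t / (2*h) := by ring
    linarith
  have b5 : G ≤ 24 * c1 / ((2*h) * t) := by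
    have : (t^2) * (24 * c1 / ((2*h) * t)) = 24 * c1 * t / (2*h) := by field_simp
    rw [← this] at b4
    exact le_of_mul_le_mul_left b4 (by positivity)
  have : (1/2) * (24 * c1 / ((2*h) * t)) = 12 * c1 / ((2*h) * t) := by ring
  linarith


noncomputable def Sx {M : ℕ} (hi : Fin M → Prop) (e : Equiv.Perm (Fin M)) : Finset (Fin M) :=
  univ.filter (fun k => hi (e k))

lemma Sx_card {M : ℕ} (hi : Fin M → Prop) (e : Equiv.Perm (Fin M)) :
    (Sx hi e).card = (univ.filter hi).card := by
  refine card_bij (fun k _ => e k) ?_ ?_ ?_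
  · intro a ha; simpa [Sx] using ha
  · intro a _ b _ h; exact e.injective h
  · intro b hb; exact ⟨e.symm b, by simpa [Sx] using hb, by simp⟩

lemma fib_le {M : ℕ} (hi : Fin M → Prop) (S S' : Finset (Fin M)) (h : S.card = S'.card) :
    (univ.filter (fun e => Sx hi e = S)).card ≤ (univ.filter (fun e => Sx hi e = S')).card := by
  have e0 : {x // x ∈ S} ≃ {x // x ∈ S'} := Finset.equivOfCardEq h
  let p : Equiv.Perm (Fin M) := Equiv.extendSubtype e0
  have hp : ∀ x, p x ∈ S' ↔ x ∈ S := by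
    intro x
    constructor
    · intro hx
      by_contra hn
      exact Equiv.extendSubtype_not_mem e0 x hn hx
    · exact fun hx => Equiv.extendSubtype_mem e0 x hx
  refine card_le_card_of_injOn (fun e => e * p⁻¹) ?_ ?_
  · intro e he
    simp only [coe_filter, mem_univ, true_and, Set.mem_ofPred_eq] at he ⊢
    ext k
    have h1 : k ∈ S' ↔ p⁻¹ k ∈ S := by rw [← hp]; simp
    rw [h1, ← he]
    rw [Sx, Sx, mem_filter, mem_filter]
    simp only [mem_univ, true_and]
    rfl
  · intro a _ b _ hab
    exact mul_right_cancel hab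

lemma rank_count {N : ℕ} (hi : Fin (N+1) → Prop) (m : ℕ) (hm : (univ.filter hi).card = m) :
    ∃ T : ℕ, (N+1).choose m * T = (N+1).factorial ∧ ∀ s,
      (univ.filter (fun e => rk hi e = s)).card =
      ((powersetCard m (univ : Finset (Fin (N+1)))).filter (fun S => ∑ k ∈ S, k.val = s)).card * T := by
  have hfib : ∀ S ∈ powersetCard m (univ : Finset (Fin (N+1))),
      (univ.filter (fun e => Sx hi e = S)).card = (univ.filter (fun e => Sx hi e = univ.filter hi)).card := by
    intro S hS
    have : S.card = (univ.filter hi).card := by rw [(mem_powersetCard.1 hS).2, hm]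
    exact le_antisymm (fib_le hi _ _ this) (fib_le hi _ _ this.symm)
  have hmem : ∀ e, Sx hi e ∈ powersetCard m (univ : Finset (Fin (N+1))) := fun e => by
    rw [mem_powersetCard]; exact ⟨subset_univ _, by rw [Sx_card, hm]⟩
  have hrk : ∀ e, rk hi e = ∑ k ∈ Sx hi e, (k : ℕ) := by
    intro e; rw [rk, Sx, sum_filter]
  refine ⟨(univ.filter (fun e => Sx hi e = univ.filter hi)).card, ?_, ?_⟩
  · have := card_eq_sum_card_fiberwise (s := (univ : Finset (Equiv.Perm (Fin (N+1)))))
      (f := Sx hi) (t := powersetCard m univ) (fun e _ => hmem e)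
    rw [sum_congr rfl hfib, sum_const, card_powersetCard, card_univ, card_univ, Fintype.card_perm,
      Fintype.card_fin, smul_eq_mul] at this
    exact this.symm
  · intro s
    have := card_eq_sum_card_fiberwise (s := (univ.filter (fun e => rk hi e = s)))
      (f := Sx hi) (t := (powersetCard m univ).filter (fun S => ∑ k ∈ S, k.val = s)) (by
        intro e he
        simp only [coe_filter, mem_univ, true_and, Set.mem_ofPred_eq] at he ⊢
        exact ⟨hmem e, by rw [← hrk, he]⟩)
    rw [this, ← smul_eq_mul, ← sum_const]
    refine sum_congr rfl fun S hS => ?_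
    rw [mem_filter] at hS
    rw [← hfib S hS.1, filter_filter]
    congr 1
    ext e
    simp only [mem_filter, mem_univ, true_and]
    constructor
    · exact fun h => h.2
    · intro h; exact ⟨by rw [hrk, h, hS.2], h⟩

lemma subset_transfer (h M m s : ℕ) (hM : M = 2 * h) :
    ((powersetCard m (univ : Finset (Fin M))).filter (fun S => ∑ k ∈ S, k.val = s)).card ≤
    ((powersetCard m (univ : Finset (Fin h × Bool))).filter (fun S => ∑ x ∈ S, vl x = s)).card := by
  subst hM
  let f : Fin (2 * h) → Fin h × Bool := fun k =>
    (⟨if (k:ℕ) < h then k else k - h, by have := k.2; split_ifs <;> omega⟩, decide (h ≤ (k:ℕ)))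
  have hv : ∀ k, vl (f k) = k := by
    intro k
    by_cases hk : (k:ℕ) < h
    · have : ¬ h ≤ (k:ℕ) := by omega
      simp [f, vl, hk, this]
    · have : h ≤ (k:ℕ) := by omega
      simp [f, vl, hk, this]
  have hf : Function.Injective f := fun a b hab => by
    apply Fin.ext; rw [← hv a, ← hv b, hab]
  refine card_le_card_of_injOn (fun S => S.map ⟨f, hf⟩) ?_ ?_
  · intro S hS
    simp only [coe_filter, mem_powersetCard, Set.mem_ofPred_eq] at hS ⊢
    refine ⟨⟨subset_univ _, by rw [card_map]; exact hS.1.2⟩, ?_⟩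
    rw [sum_map, ← hS.2]
    exact sum_congr rfl fun k _ => hv k
  · intro a _ b _ hab
    exact Finset.map_injective _ hab

lemma rank_bound1 {N h m : ℕ} (hi : Fin (N+1) → Prop) (hm : (univ.filter hi).card = m)
    (hN : N + 1 = 2 * h) (hm0 : 0 < m) (hmh : 3 * (m - 1) ≤ 2 * h) (s : ℕ) :
    ((univ.filter (fun e => rk hi e = s)).card : ℝ) ≤
      12 * ((N+1).factorial : ℝ) / ((2 * h) * √m) := by
  obtain ⟨T, hT, hs⟩ := rank_count hi m hm
  rw [hs s, ← hT]
  have h1 := D_main h m s (by omega) hm0 hmh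
  have h2 := subset_transfer h (N+1) m s hN
  have h3 : (((powersetCard m (univ : Finset (Fin (N+1)))).filter
      (fun S => ∑ k ∈ S, k.val = s)).card : ℝ) ≤ 12 * (2 * h).choose m / ((2 * h) * √m) :=
    le_trans (by exact_mod_cast h2) h1
  have := mul_le_mul_of_nonneg_right h3 (Nat.cast_nonneg (α := ℝ) T)
  push_cast
  refine this.trans (le_of_eq ?_)
  rw [hN]; ring

lemma rank_bound {N h m : ℕ} (hi : Fin (N+1) → Prop)
    (hm : (univ.filter hi).card = m ∨ (univ.filter (fun x => ¬ hi x)).card = m)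
    (hN : N + 1 = 2 * h) (hm0 : 0 < m) (hmh : 3 * (m - 1) ≤ 2 * h) (s : ℕ) :
    ((univ.filter (fun e => rk hi e = s)).card : ℝ) ≤
      12 * ((N+1).factorial : ℝ) / ((2 * h) * √m) := by
  rcases hm with hm | hm
  · exact rank_bound1 hi hm hN hm0 hmh s
  · refine le_trans ?_ (rank_bound1 (fun x => ¬ hi x) (by convert hm) hN hm0 hmh (∑ k : Fin (N+1), (k:ℕ) - s))
    have : ∀ e, rk hi e + rk (fun x => ¬ hi x) e = ∑ k : Fin (N+1), (k:ℕ) := by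
      intro e
      rw [rk, rk, ← sum_add_distrib]
      refine sum_congr rfl fun k _ => ?_
      by_cases hk : hi (e k) <;> simp [hk]
    have : univ.filter (fun e => rk hi e = s) ⊆
        univ.filter (fun e => rk (fun x => ¬ hi x) e = ∑ k : Fin (N+1), (k:ℕ) - s) := by
      intro e he
      simp only [mem_filter, mem_univ, true_and] at he ⊢
      have := this e
      omega
    exact_mod_cast card_le_card this

lemma F_swap {N : ℕ} (W u : Fin (N+1) → ℝ) (e : Equiv.Perm (Fin (N+1))) (i : Fin N) :
    ∑ k, W ((e * sw i) k) * u k = ∑ k, W (e k) * u k +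
      (W (e i.castSucc) - W (e i.succ)) * (u i.succ - u i.castSucc) := by
  have h1 : ∑ k, W ((e * sw i) k) * u k = ∑ k, W (e k) * u (sw i k) := by
    refine Fintype.sum_equiv (sw i) _ _ fun k => ?_
    have : sw i (sw i k) = k := by simp [sw]
    rw [Equiv.Perm.mul_apply, this]
  rw [h1, ← sub_eq_iff_eq_add', ← sum_sub_distrib]
  have hne : i.castSucc ≠ i.succ := (Fin.castSucc_lt_succ).ne
  rw [← sum_subset (subset_univ {i.castSucc, i.succ})]
  · rw [sum_pair hne]
    simp only [sw, Equiv.swap_apply_left, Equiv.swap_apply_right]; ring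
  · intro k _ hk
    simp only [mem_insert, mem_singleton, not_or] at hk
    rw [sw, Equiv.swap_apply_of_ne_of_ne hk.1 hk.2, sub_self]

lemma core {N h m : ℕ} (hi : Fin (N+1) → Prop) (W u : Fin (N+1) → ℝ) (δ Δ : ℝ)
    (hδ : 0 < δ) (hΔ : 0 < Δ) (hW : ∀ x y, ¬ hi x → hi y → W x + δ ≤ W y)
    (hu : ∀ i : Fin N, u i.castSucc + Δ ≤ u i.succ)
    (hm : (univ.filter hi).card = m ∨ (univ.filter (fun x => ¬ hi x)).card = m)
    (hN : N + 1 = 2 * h) (hm0 : 0 < m) (hmh : 3 * (m - 1) ≤ 2 * h) (a b : ℝ) (hab : a ≤ b) :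
    ((univ.filter (fun e : Equiv.Perm (Fin (N+1)) =>
      ∑ k, W (e k) * u k ∈ Set.Icc a b)).card : ℝ) ≤
      (1 + (b - a) / (Δ * δ)) * (12 * ((N+1).factorial : ℝ) / ((2 * h) * √m)) := by
  set F : Equiv.Perm (Fin (N+1)) → ℝ := fun e => ∑ k, W (e k) * u k with hF
  set B := 12 * ((N+1).factorial : ℝ) / ((2 * h) * √m) with hB
  set d := Δ * δ with hd
  have hd0 : 0 < d := mul_pos hΔ hδ
  have hB0 : 0 ≤ B := by positivity
  have step : ∀ c, ((univ.filter (fun e => c ≤ F e ∧ F e < c + d)).card : ℝ) ≤ B := by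
    intro c
    obtain ⟨s, hs⟩ := sperner_perm hi F d c hd0 (by
      rintro e e' ⟨i, h1, h2, rfl⟩
      simp only [hF]
      rw [F_swap]
      have p1 := hW _ _ h2 h1
      have p2 := hu i
      have : d ≤ (W (e i.castSucc) - W (e i.succ)) * (u i.succ - u i.castSucc) := by
        rw [hd, mul_comm]
        exact mul_le_mul (by linarith) (by linarith) hΔ.le (by linarith)
      linarith)
    exact le_trans (by exact_mod_cast hs) (rank_bound hi hm hN hm0 hmh s)
  set K := ⌊(b - a) / d⌋₊ with hK
  have hcov : univ.filter (fun e => F e ∈ Set.Icc a b) ⊆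
      (range (K+1)).biUnion (fun j => univ.filter
        (fun e => a + j * d ≤ F e ∧ F e < (a + j * d) + d)) := by
    intro e he
    simp only [mem_filter, mem_univ, true_and, Set.mem_Icc] at he
    simp only [mem_biUnion, mem_range, mem_filter, mem_univ, true_and]
    have q0 : 0 ≤ (F e - a) / d := div_nonneg (by linarith) hd0.le
    refine ⟨⌊(F e - a) / d⌋₊, ?_, ?_, ?_⟩
    · have : ⌊(F e - a) / d⌋₊ ≤ K := Nat.floor_le_floor (by gcongr; exact he.2)
      omega
    · have := Nat.floor_le q0
      rw [le_div_iff₀ hd0] at this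
      linarith
    · have := Nat.lt_floor_add_one ((F e - a) / d)
      rw [div_lt_iff₀ hd0] at this
      linarith
  have h1 : ((univ.filter (fun e => F e ∈ Set.Icc a b)).card : ℝ) ≤ ∑ j ∈ range (K+1),
      ((univ.filter (fun e => a + j * d ≤ F e ∧ F e < (a + j * d) + d)).card : ℝ) := by
    exact_mod_cast (card_le_card hcov).trans card_biUnion_le
  refine h1.trans ((sum_le_sum fun (j : ℕ) _ => step (a + j * d)).trans ?_)
  rw [sum_const, card_range, nsmul_eq_mul]
  refine mul_le_mul_of_nonneg_right ?_ hB0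
  push_cast
  have := Nat.floor_le (div_nonneg (sub_nonneg.2 hab) hd0.le)
  linarith


lemma fixed_pi {n N h m : ℕ} (hi : Fin (N+1) → Prop) (ι : Fin (N+1) ↪ Fin n)
    (w v : Fin n → ℝ) (δ Δ : ℝ)
    (hδ : 0 < δ) (hΔ : 0 < Δ) (hW : ∀ x y, ¬ hi x → hi y → w (ι x) + δ ≤ w (ι y))
    (hv : ∀ i j : Fin n, i ≠ j → Δ ≤ |v i - v j|)
    (hm : (univ.filter hi).card = m ∨ (univ.filter (fun x => ¬ hi x)).card = m)
    (hN : N + 1 = 2 * h) (hm0 : 0 < m) (hmh : 3 * (m - 1) ≤ 2 * h) (a b : ℝ) (hab : a ≤ b)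
    (π : Equiv.Perm (Fin n)) :
    ((univ.filter (fun g : Equiv.Perm (Fin (N+1)) =>
      ∑ i, w ((g.viaEmbedding ι * π) i) * v i ∈ Set.Icc a b)).card : ℝ) ≤
      (1 + (b - a) / (Δ * δ)) * (12 * ((N+1).factorial : ℝ) / ((2 * h) * √m)) := by
  set u' : Fin (N+1) → ℝ := fun k => v (π.symm (ι k)) with hu'
  set τ := Tuple.sort u' with hτ
  set u : Fin (N+1) → ℝ := fun k => u' (τ k) with hu
  have hmono : Monotone u := Tuple.monotone_sort u'
  have hgap : ∀ i : Fin N, u i.castSucc + Δ ≤ u i.succ := by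
    intro i
    have h1 := hmono (Fin.castSucc_lt_succ (i := i)).le
    have h2 := hv (π.symm (ι (τ i.succ))) (π.symm (ι (τ i.castSucc))) (by
      intro hh
      have := τ.injective (ι.injective (π.symm.injective hh))
      exact (Fin.castSucc_lt_succ (i := i)).ne this.symm)
    have h3 : v (π.symm (ι (τ i.succ))) - v (π.symm (ι (τ i.castSucc))) =
      u i.succ - u i.castSucc := rfl
    rw [h3, abs_of_nonneg (by linarith)] at h2
    linarith
  set c : ℝ := ∑ j ∈ (univ.map ι)ᶜ, w j * v (π.symm j) with hc
  have hf : ∀ g : Equiv.Perm (Fin (N+1)), ∑ i, w ((g.viaEmbedding ι * π) i) * v i =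
      c + ∑ k, w (ι ((g * τ) k)) * u k := by
    intro g
    have e1 : ∑ i, w ((g.viaEmbedding ι * π) i) * v i =
        ∑ j, w (g.viaEmbedding ι j) * v (π.symm j) := by
      refine Fintype.sum_equiv π _ _ fun i => ?_
      simp
    have e2 : ∑ j ∈ univ.map ι, w (g.viaEmbedding ι j) * v (π.symm j) =
        ∑ k, w (ι ((g * τ) k)) * u k := by
      rw [sum_map]
      refine (Fintype.sum_equiv τ _ _ fun k => ?_).symm
      rw [Equiv.Perm.viaEmbedding_apply]
      rfl
    have e3 : ∑ j ∈ (univ.map ι)ᶜ, w (g.viaEmbedding ι j) * v (π.symm j) = c := by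
      refine sum_congr rfl fun j hj => ?_
      rw [Equiv.Perm.viaEmbedding_apply_of_notMem]
      simpa using hj
    rw [e1, ← sum_add_sum_compl (univ.map ι), e2, e3, add_comm]
  have hcore := core hi (fun x => w (ι x)) u δ Δ hδ hΔ hW hgap hm hN hm0 hmh (a - c) (b - c)
    (by linarith)
  rw [show b - c - (a - c) = b - a by ring] at hcore
  refine le_trans ?_ hcore
  have : (univ.filter (fun g : Equiv.Perm (Fin (N+1)) =>
      ∑ i, w ((g.viaEmbedding ι * π) i) * v i ∈ Set.Icc a b)).card ≤
      (univ.filter (fun e : Equiv.Perm (Fin (N+1)) =>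
        ∑ k, w (ι (e k)) * u k ∈ Set.Icc (a - c) (b - c))).card := by
    refine card_le_card_of_injOn (fun g => g * τ) ?_ ?_
    · intro g hg
      simp only [coe_filter, mem_univ, true_and, Set.mem_ofPred_eq, hf g, Set.mem_Icc] at hg ⊢
      constructor <;> linarith [hg.1, hg.2]
    · intro g _ g' _ hgg
      exact mul_right_cancel hgg
  exact_mod_cast this

lemma averaging {n M : ℕ} (ψ : Equiv.Perm (Fin M) → Equiv.Perm (Fin n))
    (P : Equiv.Perm (Fin n) → Prop) (B : ℝ)
    (hB : ∀ π, ((univ.filter (fun g => P (ψ g * π))).card : ℝ) ≤ B) :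
    (M.factorial : ℝ) * ((univ.filter P).card : ℝ) ≤ n.factorial * B := by
  have h1 : ∀ g, ∑ π, (if P (ψ g * π) then (1:ℝ) else 0) = ((univ.filter P).card : ℝ) := by
    intro g
    rw [card_filter]
    push_cast
    exact Fintype.sum_equiv (Equiv.mulLeft (ψ g)) _ _ fun π => rfl
  have h2 : ∑ g, ∑ π, (if P (ψ g * π) then (1:ℝ) else 0) =
      (M.factorial : ℝ) * ((univ.filter P).card : ℝ) := by
    rw [sum_congr rfl fun g _ => h1 g, sum_const, card_univ, Fintype.card_perm, Fintype.card_fin,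
      nsmul_eq_mul]
  rw [← h2, sum_comm]
  calc _ ≤ ∑ π : Equiv.Perm (Fin n), B := by
        refine sum_le_sum fun π _ => ?_
        refine le_trans (le_of_eq ?_) (hB π)
        rw [card_filter]; push_cast; rfl
    _ = _ := by rw [sum_const, card_univ, Fintype.card_perm, Fintype.card_fin, nsmul_eq_mul]

lemma main_pq {n : ℕ} (w v : Fin n → ℝ) (Δ : ℝ) (hw : Monotone w) (hΔ : 0 < Δ)
    (hv : ∀ i j : Fin n, i ≠ j → Δ ≤ |v i - v j|)
    (i₁ i₂ : ℕ) (h1 : 1 ≤ i₁) (h2 : 1 ≤ i₂) (hle : i₁ + i₂ ≤ n) (δ : ℝ) (hδ : 0 < δ)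
    (X Y : Fin n) (hX : (X:ℕ) = i₁ - 1) (hY : (Y:ℕ) = n - i₂ - 1) (hδe : δ = w Y - w X)
    (p q h m : ℕ) (hp : p ≤ i₁) (hq : q ≤ i₂) (hpq : p + q = 2 * h) (hm : m = p ∨ m = q)
    (hm0 : 0 < m) (hmh : 3 * (m - 1) ≤ 2 * h) (a b : ℝ) (hab : a ≤ b) :
    ((univ.filter (fun π : Equiv.Perm (Fin n) =>
      (∑ i, w (π i) * v i) ∈ Set.Icc a b)).card : ℝ) / (n.factorial : ℝ) ≤
      (1 + (b - a) / (Δ * δ)) * (12 / ((2 * h) * √m)) := by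
  obtain ⟨N, hN⟩ : ∃ N, N + 1 = 2 * h := ⟨2 * h - 1, by omega⟩
  let ι : Fin (N+1) ↪ Fin n := ⟨fun k => ⟨if (k:ℕ) < p then k else n - (p + q) + k, by
    have := k.2; split_ifs <;> omega⟩, by
    intro k l hkl
    have := congrArg Fin.val hkl
    simp only at this
    apply Fin.ext
    split_ifs at this <;> omega⟩
  let hi : Fin (N+1) → Prop := fun k => p ≤ (k:ℕ)
  have hlo : (univ.filter (fun x => ¬ hi x)).card = p := by
    have : (univ.filter (fun x : Fin (N+1) => ¬ hi x)) =
        univ.filter (fun x : Fin (N+1) => (x:ℕ) < p) := by ext x; simp [hi]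
    rw [this, Fin.card_filter_val_lt]; omega
  have hhi : (univ.filter hi).card = q := by
    have := card_filter_add_card_filter_not (s := (univ : Finset (Fin (N+1)))) hi
    rw [card_univ, Fintype.card_fin] at this
    omega
  have hιv : ∀ k, ((ι k : Fin n) : ℕ) = if (k:ℕ) < p then (k:ℕ) else n - (p + q) + k := fun k => rfl
  have hW : ∀ x y, ¬ hi x → hi y → w (ι x) + δ ≤ w (ι y) := by
    intro x y hx hy
    have hx' : (x:ℕ) < p := not_le.1 hx
    have hy' : ¬ (y:ℕ) < p := not_lt.2 hy
    have e1 : w (ι x) ≤ w X := hw (by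
      rw [Fin.le_def]; rw [hιv, if_pos hx']; omega)
    have e2 : w Y ≤ w (ι y) := hw (by
      rw [Fin.le_def]; rw [hιv, if_neg hy']; omega)
    linarith
  have hm' : (univ.filter hi).card = m ∨ (univ.filter (fun x => ¬ hi x)).card = m := by
    rcases hm with hm | hm
    · right; rw [hm]; exact hlo
    · left; rw [hm]; exact hhi
  have key : ((N+1).factorial : ℝ) * ((univ.filter (fun π : Equiv.Perm (Fin n) =>
      (∑ i, w (π i) * v i) ∈ Set.Icc a b)).card : ℝ) ≤ n.factorial *
      ((1 + (b - a) / (Δ * δ)) * (12 * ((N+1).factorial : ℝ) / ((2 * h) * √m))) := by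
    have hfix := fixed_pi hi ι w v δ Δ hδ hΔ hW hv (m := m) (by convert hm') hN hm0 hmh a b hab
    have := averaging (fun g : Equiv.Perm (Fin (N+1)) => g.viaEmbedding ι)
      (fun π : Equiv.Perm (Fin n) => (∑ i, w (π i) * v i) ∈ Set.Icc a b)
      ((1 + (b - a) / (Δ * δ)) * (12 * ((N+1).factorial : ℝ) / ((2 * h) * √m)))
      (fun π => by convert hfix π)
    convert this
  have f1 : (0:ℝ) < (n.factorial : ℝ) := by positivity
  have f2 : (0:ℝ) < ((N+1).factorial : ℝ) := by positivity
  rw [div_le_iff₀ f1]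
  refine le_of_mul_le_mul_left (key.trans (le_of_eq ?_)) f2
  ring

theorem stmt_3 :
    ∃ C : ℝ, 0 < C ∧ ∀ (n : ℕ) (w v : Fin n → ℝ) (Δ : ℝ),
      Monotone w → Monotone v → 0 < Δ → (∀ i j : Fin n, i ≠ j → Δ ≤ |v i - v j|) →
      ∀ (i₁ i₂ : ℕ) (h1 : 1 ≤ i₁) (h2 : 1 ≤ i₂) (hle : i₁ + i₂ ≤ n),
        0 < w ⟨n - i₂ - 1, by omega⟩ - w ⟨i₁ - 1, by omega⟩ →
        ∀ a b : ℝ, a ≤ b →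
          ((Finset.univ.filter (fun π : Equiv.Perm (Fin n) =>
              (∑ i, w (π i) * v i) ∈ Set.Icc a b)).card : ℝ) / (Nat.factorial n : ℝ)
            ≤ C * (1 + (b - a) / (Δ * (w ⟨n - i₂ - 1, by omega⟩ - w ⟨i₁ - 1, by omega⟩)))
                * (1 / (((i₁ : ℝ) + i₂) * Real.sqrt (min i₁ i₂))) := by
  refine ⟨96, by norm_num, ?_⟩
  intro n w v Δ hw _ hΔ hv i₁ i₂ h1 h2 hle hδ a b hab
  obtain ⟨p, q, h, m, hp, hq, hpq, hm, hm0, hmh, hA, hB⟩ : ∃ p q h m : ℕ, p ≤ i₁ ∧ q ≤ i₂ ∧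
      p + q = 2 * h ∧ (m = p ∨ m = q) ∧ 0 < m ∧ 3 * (m - 1) ≤ 2 * h ∧
      i₁ + i₂ ≤ 4 * (2 * h) ∧ min i₁ i₂ ≤ 4 * m := by
    rcases le_total i₁ i₂ with hl | hl
    · refine ⟨(i₁ + 1) / 2, i₂ - ((i₁ + 1) / 2 + i₂) % 2,
        ((i₁ + 1) / 2 + (i₂ - ((i₁ + 1) / 2 + i₂) % 2)) / 2, (i₁ + 1) / 2, ?_, ?_, ?_, Or.inl rfl,
        ?_, ?_, ?_, ?_⟩ <;> omega
    · refine ⟨i₁ - ((i₂ + 1) / 2 + i₁) % 2, (i₂ + 1) / 2,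
        ((i₂ + 1) / 2 + (i₁ - ((i₂ + 1) / 2 + i₁) % 2)) / 2, (i₂ + 1) / 2, ?_, ?_, ?_, Or.inr rfl,
        ?_, ?_, ?_, ?_⟩ <;> omega
  have key := main_pq w v Δ hw hΔ hv i₁ i₂ h1 h2 hle _ hδ _ _ rfl rfl rfl p q h m hp hq hpq hm hm0 hmh a b hab
  refine key.trans ?_
  set δ := w ⟨n - i₂ - 1, by omega⟩ - w ⟨i₁ - 1, by omega⟩ with hδe
  have hpos : 0 ≤ 1 + (b - a) / (Δ * δ) := by
    have : 0 ≤ (b - a) / (Δ * δ) := div_nonneg (by linarith) (by positivity)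
    linarith
  have hsq : √((min i₁ i₂ : ℕ) : ℝ) ≤ 2 * √(m : ℝ) := by
    rw [show (2:ℝ) * √(m:ℝ) = √(4 * (m:ℝ)) by
      rw [Real.sqrt_mul (by norm_num), show (4:ℝ) = 2 ^ 2 by norm_num,
        Real.sqrt_sq (by norm_num)]]
    exact Real.sqrt_le_sqrt (by exact_mod_cast hB)
  have hsq' : √(min (i₁:ℝ) (i₂:ℝ)) ≤ 2 * √(m : ℝ) := by
    rw [← Nat.cast_min]; exact hsq
  have hA' : (i₁:ℝ) + i₂ ≤ 4 * (2 * h) := by exact_mod_cast hA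
  have hi1 : (1:ℝ) ≤ i₁ := by exact_mod_cast h1
  have hi2 : (1:ℝ) ≤ i₂ := by exact_mod_cast h2
  have hminpos : 0 < √(min (i₁:ℝ) (i₂:ℝ)) := Real.sqrt_pos.2 (lt_min (by linarith) (by linarith))
  have hmpos : 0 < √(m:ℝ) := by linarith
  have hhpos : (0:ℝ) < 2 * h := by linarith
  have hfin : 12 / ((2 * h) * √(m:ℝ)) ≤ 96 * (1 / (((i₁ : ℝ) + i₂) * √(min (i₁:ℝ) (i₂:ℝ)))) := by
    rw [mul_one_div, div_le_div_iff₀ (by positivity) (by positivity)]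
    have := mul_le_mul hA' hsq' hminpos.le (by positivity)
    nlinarith
  calc _ ≤ (1 + (b - a) / (Δ * δ)) *
        (96 * (1 / (((i₁ : ℝ) + i₂) * √(min (i₁:ℝ) (i₂:ℝ))))) :=
        mul_le_mul_of_nonneg_left hfin hpos
    _ = _ := by ring
end

section
/- Let v ∈ ℝ^n have all distinct coordinates, and let w ∈ ℝ^n be such that no value is repeated among the w_i more than (1−ε)n times, for some ε > 0. Then there is an absolute constant C such that for every x ∈ ℝ, with π a uniformly random permutation of {1,...,n}, P(∑_i w_{π(i)} v_i = x) ≤ C / (ε n^{3/2}). -/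
open scoped Classical
open Finset

open scoped Pointwise in
theorem dbl (p : ℕ) [Fact p.Prime] (F : ZMod p → ℝ) (h0 : F 0 = 0)
    (h2 : ∀ a b, F (a+b) ≤ 2 * F a + 2 * F b) (R : ℕ)
    (hR : (univ.filter (fun θ => F θ ≤ 4^R)).card < p) (s : ℕ) (hs : s ≤ R) :
    ((univ.filter (fun θ => F θ ≤ 4^s)).card : ℝ) ≤ 1 + 2^s / 2^R * (univ.filter (fun θ => F θ ≤ 4^R)).card := by
  have key : ∀ m, m ≤ R → 2^m * (((univ.filter (fun θ => F θ ≤ 4^(R-m))).card : ℝ) - 1) ≤ ((univ.filter (fun θ => F θ ≤ 4^R)).card : ℝ) - 1 := by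
    intro m
    induction m with
    | zero => simp
    | succ m ih =>
      intro hm
      refine le_trans ?_ (ih (by omega))
      rw [pow_succ, mul_assoc]
      apply mul_le_mul_of_nonneg_left _ (by positivity)
      set A := univ.filter (fun θ => F θ ≤ 4^(R-(m+1))) with hA
      set A' := univ.filter (fun θ => F θ ≤ 4^(R-m)) with hA'
      have hne : A.Nonempty := ⟨0, by simp [hA, h0]⟩
      have hsub : A + A ⊆ A' := by
        intro x hx
        obtain ⟨a, ha, b, hb, rfl⟩ := Finset.mem_add.1 hx
        simp only [hA, mem_filter, mem_univ, true_and] at ha hb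
        simp only [hA', mem_filter, mem_univ, true_and]
        have : R - m = R - (m+1) + 1 := by omega
        rw [this, pow_succ]
        linarith [h2 a b]
      have hcd := ZMod.cauchy_davenport (p := p) Fact.out hne hne
      have hle := card_le_card hsub
      have hlt : A'.card < p := by
        refine lt_of_le_of_lt (card_le_card ?_) hR
        intro x hx
        simp only [hA', mem_filter, mem_univ, true_and] at hx ⊢
        exact hx.trans (pow_le_pow_right₀ (by norm_num) (by omega))
      have h3 : A.card + A.card - 1 ≤ A'.card := by
        rcases min_le_iff.1 (hcd.trans hle) with h | h <;> omega
      have h4 : A.card + A.card ≤ A'.card + 1 := by omega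
      have h5 : (A.card : ℝ) + A.card ≤ A'.card + 1 := by exact_mod_cast h4
      linarith
  have := key (R - s) (by omega)
  have e : R - (R - s) = s := by omega
  rw [e] at this
  have h6 : (2:ℝ)^R = 2^(R-s) * 2^s := by rw [← pow_add]; congr 1; omega
  rw [h6]
  have h7 : (2:ℝ)^s / (2^(R-s) * 2^s) = 1 / 2^(R-s) := by field_simp
  rw [h7]
  have h8 : (0:ℝ) < 2^(R-s) := by positivity
  rw [← sub_le_iff_le_add', one_div_mul_eq_div, le_div_iff₀ h8]
  linarith

theorem ptw (R : ℕ) (f : ℝ) (hf : 0 ≤ f) : Real.exp (-f/2) ≤ ∑ s ∈ range (R+1), 8/4^s * (if f ≤ 4^s then (1:ℝ) else 0) + 8 / 16^R := by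
  have hnn : ∀ s ∈ range (R+1), 0 ≤ 8/4^s * (if f ≤ 4^s then (1:ℝ) else 0) := by
    intro s _; split_ifs <;> positivity
  by_cases h : f ≤ 4^R
  · have hex : ∃ s, f ≤ 4^s := ⟨R, h⟩
    have hs := Nat.find_spec hex
    have hsR : Nat.find hex ≤ R := Nat.find_min' hex h
    have h1 := single_le_sum hnn (mem_range.2 (Nat.lt_succ_of_le hsR))
    simp only [hs, if_true] at h1
    have : Real.exp (-f/2) ≤ 8 / 4^(Nat.find hex) := by
      rcases Nat.eq_zero_or_pos (Nat.find hex) with h0 | h0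
      · rw [h0]
        have : Real.exp (-f/2) ≤ 1 := Real.exp_le_one_iff.2 (by linarith)
        norm_num; linarith
      · have h3 := Nat.find_min hex (m := Nat.find hex - 1) (by omega)
        push Not at h3
        set t := Nat.find hex with ht
        have h4 : (4:ℝ)^t = 4^(t-1) * 4 := by rw [← pow_succ]; congr 1; omega
        have h5 : Real.exp (-f/2) * Real.exp (f/2) = 1 := by rw [← Real.exp_add]; simp; ring
        have h6 := Real.add_one_le_exp (f/2)
        have h7 := Real.exp_pos (-f/2)
        rw [le_div_iff₀ (by positivity), h4]
        nlinarith
    have : (0:ℝ) ≤ 8/16^R := by positivity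
    linarith
  · push Not at h
    have h1 := sum_nonneg hnn
    have h2 : Real.exp (-f/2) ≤ 8 / 16^R := by
      have h5 : Real.exp (-f/2) * Real.exp (f/2) = 1 := by rw [← Real.exp_add]; simp; ring
      have h6 := Real.quadratic_le_exp_of_nonneg (x := f/2) (by linarith)
      have h7 := Real.exp_pos (-f/2)
      rw [le_div_iff₀ (by positivity)]
      have h8 : (16:ℝ)^R = 4^R * 4^R := by rw [← mul_pow]; norm_num
      have h9 : (16:ℝ)^R ≤ f * f := by rw [h8]; gcongr
      nlinarith
    linarith

theorem expsum (p : ℕ) [Fact p.Prime] (F : ZMod p → ℝ) (h0 : F 0 = 0) (hF : ∀ a, 0 ≤ F a)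
    (h2 : ∀ a b, F (a+b) ≤ 2 * F a + 2 * F b) (R : ℕ)
    (hR : (univ.filter (fun θ => F θ ≤ 4^R)).card < p) :
    ∑ θ, Real.exp (-F θ/2) ≤ 16 + 16 / 2^R * (univ.filter (fun θ => F θ ≤ 4^R)).card + p * (8/16^R) := by
  have h1 : ∑ θ, Real.exp (-F θ/2) ≤ ∑ s ∈ range (R+1), 8/4^s * ((univ.filter (fun θ => F θ ≤ 4^s)).card : ℝ) + p * (8/16^R) := by
    refine (sum_le_sum (fun θ _ => ptw R (F θ) (hF θ))).trans ?_
    rw [sum_add_distrib, sum_comm]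
    simp only [← mul_sum, sum_boole, sum_const, card_univ, ZMod.card, nsmul_eq_mul, le_refl]
  refine h1.trans ?_
  gcongr
  have geo : ∀ m : ℕ, ∑ s ∈ range m, (1/2:ℝ)^s ≤ 2 := by
    intro m
    rw [geom_sum_eq (by norm_num)]
    have h : (0:ℝ) ≤ (1/2)^m := by positivity
    have e : ((1/2:ℝ)^m-1)/(1/2-1) = 2 - 2*(1/2)^m := by ring
    rw [e]; linarith
  set c := ((univ.filter (fun θ => F θ ≤ 4^R)).card : ℝ) with hc
  have hc0 : 0 ≤ c := by positivity
  calc _ ≤ ∑ s ∈ range (R+1), (8 + 8/2^R * c) * (1/2:ℝ)^s := by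
        apply sum_le_sum
        intro s hs
        have := dbl p F h0 h2 R hR s (by simpa [Nat.lt_succ_iff] using hs)
        refine (mul_le_mul_of_nonneg_left this (by positivity)).trans ?_
        have e4 : (4:ℝ)^s = 2^s * 2^s := by rw [← mul_pow]; norm_num
        have e1 : (1:ℝ) ≤ 2^s := one_le_pow₀ (by norm_num)
        rw [← hc, e4, one_div, inv_pow, add_mul, mul_add]
        apply add_le_add
        · rw [mul_one, ← div_eq_mul_inv]
          gcongr
          nlinarith
        · apply le_of_eq; field_simp
    _ ≤ (8 + 8/2^R * c) * 2 := by
        rw [← mul_sum]; gcongr; exact geo _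
    _ = _ := by ring

/-- number of additive collisions between differences -/
noncomputable def Ncol {ι κ A : Type*} [Fintype ι] [Fintype κ] [AddCommGroup A] (c : ι → κ → A) : ℕ :=
  (univ.filter (fun q : (ι × κ × κ) × (ι × κ × κ) =>
    (q.1.2.1 ≠ q.1.2.2 ∧ q.2.2.1 ≠ q.2.2.2) ∧
      c q.1.1 q.1.2.1 - c q.1.1 q.1.2.2 = c q.2.1 q.2.2.1 - c q.2.1 q.2.2.2)).card

theorem parseval {J : Type*} (p : ℕ) [Fact p.Prime] (Δ : Finset J) (d : J → ZMod p) :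
    ∑ θ : ZMod p, ‖∑ q ∈ Δ, (ZMod.stdAddChar (θ * d q) : ℂ)‖^2
      = p * (((Δ ×ˢ Δ).filter (fun q => d q.1 = d q.2)).card : ℝ) := by
  have h : ∀ θ : ZMod p, ((‖∑ q ∈ Δ, (ZMod.stdAddChar (θ * d q) : ℂ)‖^2 : ℝ) : ℂ)
      = ∑ q ∈ Δ ×ˢ Δ, ZMod.stdAddChar (θ * (d q.1 - d q.2)) := by
    intro θ
    rw [Complex.ofReal_pow, ← Complex.mul_conj', map_sum, sum_mul_sum, sum_product]
    refine sum_congr rfl fun a _ => sum_congr rfl fun b _ => ?_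
    rw [← AddChar.map_neg_eq_conj, ← AddChar.map_add_eq_mul]
    congr 1; ring
  apply Complex.ofReal_injective
  rw [Complex.ofReal_sum]
  simp_rw [h]
  rw [sum_comm]
  simp_rw [AddChar.sum_mulShift _ (ZMod.isPrimitive_stdAddChar p), sub_eq_zero, ZMod.card]
  push_cast
  rw [← sum_filter, sum_const, nsmul_eq_mul, mul_comm]

theorem char_sum {ι : Type*} (p : ℕ) [Fact p.Prime] (s : Finset ι) (f : ι → ZMod p) :
    (ZMod.stdAddChar (∑ j ∈ s, f j) : ℂ) = ∏ j ∈ s, ZMod.stdAddChar (f j) := by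
  induction s using Finset.induction_on with
  | empty => simp
  | insert a s ha ih => rw [sum_insert ha, prod_insert ha, AddChar.map_add_eq_mul, ih]

theorem inversion {ι κ : Type*} [Fintype ι] [Fintype κ] (p : ℕ) [Fact p.Prime]
    (c : ι → κ → ZMod p) (y : ZMod p) :
    (p : ℝ) * ((univ.filter (fun u : ι → κ => ∑ j, c j (u j) = y)).card : ℝ)
      ≤ ∑ θ : ZMod p, ∏ j, ‖∑ b, (ZMod.stdAddChar (θ * c j b) : ℂ)‖ := by
  have h : ((p : ℂ) * ((univ.filter (fun u : ι → κ => ∑ j, c j (u j) = y)).card : ℂ))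
      = ∑ θ : ZMod p, ZMod.stdAddChar (-(θ * y)) * ∏ j, ∑ b, (ZMod.stdAddChar (θ * c j b) : ℂ) := by
    have h1 : ∀ θ : ZMod p, ZMod.stdAddChar (-(θ * y)) * ∏ j, ∑ b, (ZMod.stdAddChar (θ * c j b) : ℂ)
        = ∑ u : ι → κ, ZMod.stdAddChar (θ * ((∑ j, c j (u j)) - y)) := by
      intro θ
      rw [prod_univ_sum, Fintype.piFinset_univ, mul_sum]
      refine sum_congr rfl fun u _ => ?_
      rw [← char_sum p, ← AddChar.map_add_eq_mul]
      congr 1; rw [← mul_sum]; ring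
    simp_rw [h1]
    rw [sum_comm]
    simp_rw [AddChar.sum_mulShift _ (ZMod.isPrimitive_stdAddChar p), sub_eq_zero, ZMod.card]
    push_cast
    rw [← sum_filter, sum_const, nsmul_eq_mul, mul_comm]
  have h2 : (p : ℝ) * ((univ.filter (fun u : ι → κ => ∑ j, c j (u j) = y)).card : ℝ)
     = ‖((p : ℂ) * ((univ.filter (fun u : ι → κ => ∑ j, c j (u j) = y)).card : ℂ))‖ := by
    rw [norm_mul, Complex.norm_natCast, Complex.norm_natCast]
  rw [h2, h]
  refine (norm_sum_le _ _).trans (sum_le_sum fun θ _ => ?_)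
  rw [norm_mul, AddChar.norm_apply, one_mul, norm_prod]

theorem chsub (p : ℕ) [Fact p.Prime] (a b : ZMod p) :
    1 - (ZMod.stdAddChar (a+b) : ℂ).re ≤ 2 * (1 - (ZMod.stdAddChar a : ℂ).re) + 2 * (1 - (ZMod.stdAddChar b : ℂ).re) := by
  rw [AddChar.map_add_eq_mul, Complex.mul_re]
  have ha := AddChar.norm_apply (ZMod.stdAddChar (N := p)) a
  have hb := AddChar.norm_apply (ZMod.stdAddChar (N := p)) b
  set x := (ZMod.stdAddChar a : ℂ)
  set z := (ZMod.stdAddChar b : ℂ)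
  have ha2 : x.re^2 + x.im^2 = 1 := by
    have := Complex.sq_norm x; rw [ha, Complex.normSq_apply] at this; nlinarith
  have hb2 : z.re^2 + z.im^2 = 1 := by
    have := Complex.sq_norm z; rw [hb, Complex.normSq_apply] at this; nlinarith
  nlinarith [sq_nonneg (x.re + z.re - 2), sq_nonneg (x.im - z.im), sq_nonneg (x.im + z.im)]

theorem chle (p : ℕ) [Fact p.Prime] (a : ZMod p) : (ZMod.stdAddChar a : ℂ).re ≤ 1 := by
  have ha := AddChar.norm_apply (ZMod.stdAddChar (N := p)) a
  rw [← ha]; exact Complex.re_le_norm _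

theorem sqexp {κ : Type*} [Fintype κ] (p : ℕ) [Fact p.Prime] (c : κ → ZMod p) (θ : ZMod p) :
    ‖∑ b, (ZMod.stdAddChar (θ * c b) : ℂ)‖^2 = ∑ b, ∑ b', (ZMod.stdAddChar (θ * (c b - c b')) : ℂ).re := by
  have h : ((‖∑ q, (ZMod.stdAddChar (θ * c q) : ℂ)‖^2 : ℝ) : ℂ)
      = ∑ b, ∑ b', (ZMod.stdAddChar (θ * (c b - c b')) : ℂ) := by
    rw [Complex.ofReal_pow, ← Complex.mul_conj', map_sum, sum_mul_sum]
    refine sum_congr rfl fun a _ => sum_congr rfl fun b _ => ?_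
    rw [← AddChar.map_neg_eq_conj, ← AddChar.map_add_eq_mul]
    congr 1; ring
  have := congrArg Complex.re h
  rw [Complex.ofReal_re] at this
  simpa using this

theorem coreZ {ι κ : Type*} [Fintype ι] [Fintype κ] (p : ℕ) [Fact p.Prime]
    (c : ι → κ → ZMod p) (hc : ∀ j, Function.Injective (c j)) (y : ZMod p)
    (hB : 2 ≤ Fintype.card κ) (hk : 4 ≤ Fintype.card ι) (hp : (Fintype.card ι)^2 ≤ p) :
    ((univ.filter (fun u : ι → κ => ∑ j, c j (u j) = y)).card : ℝ) ≤
      (Fintype.card κ : ℝ)^(Fintype.card ι) * (3000 * (1 / (Fintype.card ι : ℝ)^2 +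
        Ncol c / ((Fintype.card ι : ℝ)^2 * √(Fintype.card ι) * (Fintype.card κ : ℝ)^4))) := by
  set k := Fintype.card ι with hkdef
  set B := Fintype.card κ with hBdef
  have hp0 : (0:ℝ) < p := by exact_mod_cast (Fact.out : p.Prime).pos
  have hBr : (2:ℝ) ≤ B := by exact_mod_cast hB
  have hkr : (4:ℝ) ≤ k := by exact_mod_cast hk
  have hpr : (k:ℝ)^2 ≤ p := by exact_mod_cast hp
  set F : ZMod p → ℝ := fun θ => (∑ j, ∑ b, ∑ b', (1 - (ZMod.stdAddChar (θ * (c j b - c j b')) : ℂ).re)) / B^2 with hFdef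
  have hF0 : F 0 = 0 := by simp [hFdef]
  have hFnn : ∀ a, 0 ≤ F a := fun a => div_nonneg
    (sum_nonneg fun j _ => sum_nonneg fun b _ => sum_nonneg fun b' _ => sub_nonneg.2 (chle p _)) (by positivity)
  have hF2 : ∀ a b, F (a+b) ≤ 2 * F a + 2 * F b := by
    intro a b
    simp only [hFdef, ← mul_div_assoc, ← add_div, mul_sum, ← sum_add_distrib]
    gcongr with j _ x _ x' _
    rw [add_mul]; exact chsub p _ _
  -- product bound
  have hprod : ∀ θ, ∏ j, ‖∑ b, (ZMod.stdAddChar (θ * c j b) : ℂ)‖ ≤ (B:ℝ)^k * Real.exp (-F θ / 2) := by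
    intro θ
    have h1 : ∀ j, ‖∑ b, (ZMod.stdAddChar (θ * c j b) : ℂ)‖ ≤
        B * Real.exp (-((∑ b, ∑ b', (1 - (ZMod.stdAddChar (θ * (c j b - c j b')) : ℂ).re)) / B^2) / 2) := by
      intro j
      refine (pow_le_pow_iff_left₀ (norm_nonneg _) (by positivity) two_ne_zero).1 ?_
      rw [sqexp, mul_pow, ← Real.exp_nat_mul]
      simp only [sum_sub_distrib, sum_const, card_univ, ← hBdef, nsmul_eq_mul, mul_one]
      set S := ∑ b, ∑ b', (ZMod.stdAddChar (θ * (c j b - c j b')) : ℂ).re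
      have := Real.add_one_le_exp ((2:ℕ) * (-(((B:ℝ) * B - S) / B^2) / 2))
      have h3 : ((2:ℕ):ℝ) * (-(((B:ℝ) * B - S) / B^2) / 2) + 1 = S / B^2 := by
        push_cast; field_simp; ring
      rw [h3, div_le_iff₀ (by positivity)] at this
      linarith
    refine (prod_le_prod (fun j _ => norm_nonneg _) (fun j _ => h1 j)).trans (le_of_eq ?_)
    rw [prod_mul_distrib, prod_const, card_univ, ← Real.exp_sum]
    congr 2
    simp only [hFdef]
    rw [← sum_div, sum_neg_distrib, ← sum_div]
  -- G
  set Δ : Finset (ι × κ × κ) := univ.filter (fun q => q.2.1 ≠ q.2.2) with hΔ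
  set d : ι × κ × κ → ZMod p := fun q => c q.1 q.2.1 - c q.1 q.2.2 with hd
  have hFG : ∀ θ, F θ * B^2 = k * (B^2 - B) - (∑ q ∈ Δ, (ZMod.stdAddChar (θ * d q) : ℂ)).re := by
    intro θ
    simp only [hFdef]
    rw [div_mul_cancel₀ _ (by positivity), Complex.re_sum, hΔ, sum_filter]
    rw [Fintype.sum_prod_type]
    simp_rw [Fintype.sum_prod_type]
    have : (k:ℝ) * (B^2 - B) = ∑ j : ι, ((B:ℝ)^2 - B) := by rw [sum_const, card_univ, nsmul_eq_mul]
    rw [this, ← sum_sub_distrib]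
    refine sum_congr rfl fun j _ => ?_
    have : ((B:ℝ)^2 - B) = ∑ b : κ, ((B:ℝ) - 1) := by simp [hBdef]; ring
    rw [this, ← sum_sub_distrib]
    refine sum_congr rfl fun b _ => ?_
    have h5 : ∀ b', (if b ≠ b' then (ZMod.stdAddChar (θ * d (j, b, b')) : ℂ).re else 0) = (ZMod.stdAddChar (θ * d (j, b, b')) : ℂ).re - (if b = b' then 1 else 0) := by
      intro b'
      by_cases h : b = b'
      · subst h; simp [hd]
      · simp [h]
    simp only [h5, sum_sub_distrib]
    simp [hd, hBdef]
  have hGbig : ∀ θ, F θ ≤ k/4 → (k:ℝ) * B^2 / 4 ≤ (∑ q ∈ Δ, (ZMod.stdAddChar (θ * d q) : ℂ)).re := by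
    intro θ h
    have h1 := hFG θ
    have h2 : F θ * B^2 ≤ k/4 * B^2 := by gcongr
    have h3 : (k:ℝ) * (2 * B) ≤ k * (B * B) := by gcongr
    nlinarith
  have hN : (((Δ ×ˢ Δ).filter (fun q => d q.1 = d q.2)).card) = Ncol c := by
    unfold Ncol
    congr 1
    ext q
    simp [hΔ, hd]
  obtain ⟨R, hR1, hR2⟩ : ∃ R : ℕ, (4:ℝ)^R ≤ k/4 ∧ (k:ℝ)/4 < 4^(R+1) :=
    exists_nat_pow_near (by linarith) (by norm_num)
  set T := univ.filter (fun θ => F θ ≤ 4^R) with hT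
  have hTlt : T.card < p := by
    by_contra hcon
    have hTu : T = univ := by
      apply eq_univ_of_card
      have := card_le_univ T
      rw [ZMod.card] at *
      omega
    have hall : ∀ θ, (k:ℝ) * B^2 / 4 ≤ (∑ q ∈ Δ, (ZMod.stdAddChar (θ * d q) : ℂ)).re := by
      intro θ
      apply hGbig
      have : θ ∈ T := by rw [hTu]; simp
      exact ((mem_filter.1 this).2).trans hR1
    have hsum : ∑ θ : ZMod p, (∑ q ∈ Δ, (ZMod.stdAddChar (θ * d q) : ℂ)) = 0 := by
      rw [sum_comm]
      apply sum_eq_zero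
      intro q hq
      rw [AddChar.sum_mulShift _ (ZMod.isPrimitive_stdAddChar p), if_neg]
      · simp
      · simp only [hd, sub_eq_zero]
        intro h
        exact (mem_filter.1 hq).2 (hc _ h)
    have h2 := congrArg Complex.re hsum
    rw [Complex.re_sum] at h2
    have h3 : ∑ θ : ZMod p, (k:ℝ) * B^2 / 4 ≤ 0 := by
      rw [Complex.zero_re] at h2
      rw [← h2]; exact sum_le_sum fun θ _ => hall θ
    rw [sum_const, card_univ, ZMod.card, nsmul_eq_mul] at h3
    have : 0 < (p:ℝ) * ((k:ℝ) * B^2 / 4) := by positivity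
    linarith
  have hTN : (T.card : ℝ) * ((k:ℝ) * B^2 / 4)^2 ≤ p * Ncol c := by
    rw [← hN, ← parseval, ← nsmul_eq_mul, ← sum_const]
    refine (sum_le_sum fun θ hθ => ?_).trans (sum_le_sum_of_subset_of_nonneg (subset_univ T) fun _ _ _ => by positivity)
    have h1 := hGbig θ (((mem_filter.1 hθ).2).trans hR1)
    have h2 := h1.trans (Complex.re_le_norm _)
    gcongr
  have hmain := (inversion p c y).trans (sum_le_sum fun θ _ => hprod θ)
  rw [← mul_sum] at hmain
  have hE := expsum p F hF0 hFnn hF2 R hTlt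
  have hsk : (0:ℝ) < √k := Real.sqrt_pos.2 (by linarith)
  have hsk2 : √(k:ℝ) * √k = k := Real.mul_self_sqrt (by linarith)
  have h2R : √(k:ℝ) ≤ 4 * 2^R := by
    refine Real.sqrt_le_iff.2 ⟨by positivity, ?_⟩
    have : (4:ℝ)^R = 2^R * 2^R := by rw [← mul_pow]; norm_num
    rw [pow_succ] at hR2
    nlinarith
  have h16 : (k:ℝ)^2 ≤ 256 * 16^R := by
    have : (16:ℝ)^R = 4^R * 4^R := by rw [← mul_pow]; norm_num
    rw [pow_succ] at hR2
    have : (k:ℝ) ≤ 16 * 4^R := by linarith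
    nlinarith [mul_self_le_mul_self (by linarith : (0:ℝ) ≤ k) this]
  have hb1 : (16:ℝ) ≤ p * (16 * (1/(k:ℝ)^2)) := by
    rw [mul_one_div, ← mul_div_assoc, le_div_iff₀ (by positivity)]; linarith
  have hb3 : (p:ℝ) * (8/16^R) ≤ p * (2048 * (1/(k:ℝ)^2)) := by
    gcongr
    rw [mul_one_div, div_le_div_iff₀ (by positivity) (by positivity)]; linarith
  have hb2 : 16 / 2^R * (T.card:ℝ) ≤ p * (1024 * (Ncol c / ((k:ℝ)^2 * √k * (B:ℝ)^4))) := by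
    have e1 : (T.card:ℝ) ≤ 16 * (p * Ncol c) / (k^2 * B^4) := by
      rw [le_div_iff₀ (by positivity)]; nlinarith
    have e2 : 16 / (2:ℝ)^R ≤ 64 / √k := by
      rw [div_le_div_iff₀ (by positivity) (by positivity)]; linarith
    calc _ ≤ 64 / √k * (16 * (p * Ncol c) / (k^2 * B^4)) := by gcongr
      _ = _ := by field_simp; ring
  have hfin : ∑ θ, Real.exp (-F θ / 2) ≤ p * (3000 * (1 / (k : ℝ)^2 +
        Ncol c / ((k : ℝ)^2 * √k * (B : ℝ)^4))) := by
    have e1 : 0 ≤ (p:ℝ) * (1/(k:ℝ)^2) := by positivity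
    have e2 : 0 ≤ (p:ℝ) * (Ncol c / ((k : ℝ)^2 * √k * (B : ℝ)^4)) := by positivity
    nlinarith
  have := hmain.trans (mul_le_mul_of_nonneg_left hfin (by positivity))
  refine le_of_mul_le_mul_left ?_ hp0
  linarith

theorem transfer (s : Set ℝ) (hs : s.Finite) (E : Finset (Submodule.span ℤ s)) (N : ℕ) :
    ∃ p : ℕ, p.Prime ∧ N ≤ p ∧ ∃ χ : Submodule.span ℤ s →+ ZMod p, ∀ h ∈ E, h ≠ 0 → χ h ≠ 0 := by
  have : Module.Finite ℤ (Submodule.span ℤ s) := Module.Finite.span_of_finite ℤ hs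
  let b := Module.finBasis ℤ (Submodule.span ℤ s)
  let L : Submodule.span ℤ s →ₗ[ℤ] Polynomial ℤ :=
    (Polynomial.degreeLT ℤ _).subtype ∘ₗ (Polynomial.degreeLTEquiv ℤ _).symm.toLinearMap ∘ₗ b.equivFun.toLinearMap
  have hL : Function.Injective L := by
    simp only [L, LinearMap.coe_comp]
    exact (Submodule.injective_subtype _).comp ((LinearEquiv.injective _).comp (LinearEquiv.injective _))
  set P : Polynomial ℤ := ∏ h ∈ E.filter (fun h => h ≠ 0), L h with hP
  have hP0 : P ≠ 0 := by
    rw [hP, prod_ne_zero_iff]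
    intro h hh
    rw [Ne, map_eq_zero_iff L hL]
    exact (mem_filter.1 hh).2
  obtain ⟨t, ht⟩ : ∃ t : ℤ, P.eval t ≠ 0 := by
    by_contra hcon
    push Not at hcon
    exact hP0 (Polynomial.funext (by simpa using hcon))
  obtain ⟨p, hp1, hp2⟩ := Nat.exists_infinite_primes (N + (P.eval t).natAbs + 1)
  refine ⟨p, hp2, by omega, (Int.castRingHom (ZMod p)).toAddMonoidHom.comp
    ((Polynomial.evalRingHom t).toAddMonoidHom.comp L.toAddMonoidHom), ?_⟩
  intro h hh h0 hcon
  have hcon' : (((L h).eval t : ℤ) : ZMod p) = 0 := by simpa using hcon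
  rw [ZMod.intCast_zmod_eq_zero_iff_dvd] at hcon'
  have hdvd : (L h).eval t ∣ P.eval t := by
    rw [hP, Polynomial.eval_prod]
    exact dvd_prod_of_mem (fun h => (L h).eval t) (mem_filter.2 ⟨hh, h0⟩)
  have h3 := Int.natAbs_dvd_natAbs.2 (hcon'.trans hdvd)
  have h4 := Nat.le_of_dvd (Int.natAbs_pos.2 ht) h3
  simp at h4
  omega

theorem coreR {ι κ : Type*} [Fintype ι] [Fintype κ]
    (c : ι → κ → ℝ) (hc : ∀ j, Function.Injective (c j)) (y : ℝ)
    (hB : 2 ≤ Fintype.card κ) (hk : 4 ≤ Fintype.card ι) :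
    ((univ.filter (fun u : ι → κ => ∑ j, c j (u j) = y)).card : ℝ) ≤
      (Fintype.card κ : ℝ)^(Fintype.card ι) * (3000 * (1 / (Fintype.card ι : ℝ)^2 +
        Ncol c / ((Fintype.card ι : ℝ)^2 * √(Fintype.card ι) * (Fintype.card κ : ℝ)^4))) := by
  set s : Set ℝ := Set.range (fun q : ι × κ => c q.1 q.2) ∪ {y} with hs
  have hsf : s.Finite := (Set.finite_range _).union (Set.finite_singleton y)
  have hcm : ∀ j b, c j b ∈ Submodule.span ℤ s := fun j b =>
    Submodule.subset_span (Or.inl ⟨(j, b), rfl⟩)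
  let c' : ι → κ → Submodule.span ℤ s := fun j b => ⟨c j b, hcm j b⟩
  let y' : Submodule.span ℤ s := ⟨y, Submodule.subset_span (Or.inr rfl)⟩
  obtain ⟨p, hp, hkp, χ, hχ⟩ := transfer s hsf
    (univ.image (fun q : ι × κ × κ => c' q.1 q.2.1 - c' q.1 q.2.2) ∪
     univ.image (fun q : (ι × κ × κ) × (ι × κ × κ) => (c' q.1.1 q.1.2.1 - c' q.1.1 q.1.2.2) - (c' q.2.1 q.2.2.1 - c' q.2.1 q.2.2.2)))
    ((Fintype.card ι)^2)
  have : Fact p.Prime := ⟨hp⟩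
  have hinj : ∀ j, Function.Injective (fun b => χ (c' j b)) := by
    intro j b b' h
    by_contra hne
    refine hχ (c' j b - c' j b') ?_ ?_ ?_
    · exact mem_union_left _ (mem_image.2 ⟨(j, b, b'), mem_univ _, rfl⟩)
    · intro h0
      exact hne (hc j (congrArg Subtype.val (sub_eq_zero.1 h0)))
    · rw [map_sub]; exact sub_eq_zero.2 h
  have h1 := coreZ p (fun j b => χ (c' j b)) hinj (χ y') hB hk hkp
  have hN : Ncol (fun j b => χ (c' j b)) ≤ Ncol c := by
    unfold Ncol
    apply card_le_card
    intro q hq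
    simp only [mem_filter, mem_univ, true_and] at hq ⊢
    refine ⟨hq.1, ?_⟩
    by_contra hne
    refine hχ ((c' q.1.1 q.1.2.1 - c' q.1.1 q.1.2.2) - (c' q.2.1 q.2.2.1 - c' q.2.1 q.2.2.2)) ?_ ?_ ?_
    · exact mem_union_right _ (mem_image.2 ⟨q, mem_univ _, rfl⟩)
    · intro h0
      exact hne (congrArg Subtype.val (sub_eq_zero.1 h0))
    · rw [map_sub, map_sub, map_sub]; exact sub_eq_zero.2 hq.2
  have hS : (univ.filter (fun u : ι → κ => ∑ j, c j (u j) = y)).card ≤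
      (univ.filter (fun u : ι → κ => ∑ j, χ (c' j (u j)) = χ y')).card := by
    apply card_le_card
    intro u hu
    simp only [mem_filter, mem_univ, true_and] at hu ⊢
    rw [← map_sum]
    congr 1
    apply Subtype.ext
    change _ = y
    rw [← hu]
    simp [c']
  have hS' : ((univ.filter (fun u : ι → κ => ∑ j, c j (u j) = y)).card : ℝ) ≤
      ((univ.filter (fun u : ι → κ => ∑ j, χ (c' j (u j)) = χ y')).card : ℝ) := by exact_mod_cast hS
  refine hS'.trans (h1.trans ?_)
  gcongr

theorem swaplem {n : ℕ} (E : Equiv.Perm (Fin n) → Prop) (z : Fin n) (Y : Finset (Fin n))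
    (h : ∀ g, (Y.filter (fun y => E (g * Equiv.swap z y))).card ≤ 1) :
    (univ.filter E).card * Y.card ≤ n.factorial := by
  have h1 : ∀ y, (univ.filter E).card = (univ.filter (fun g => E (g * Equiv.swap z y))).card := by
    intro y
    symm
    apply card_bij (fun g _ => g * Equiv.swap z y)
    · intro g hg; simpa using hg
    · intro a _ b _ hab; exact mul_right_cancel hab
    · intro b hb
      exact ⟨b * Equiv.swap z y, by simpa [mul_assoc] using hb, by simp [mul_assoc]⟩
  calc (univ.filter E).card * Y.card = ∑ y ∈ Y, (univ.filter (fun g => E (g * Equiv.swap z y))).card := by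
        rw [← sum_congr rfl (fun y _ => h1 y), sum_const, smul_eq_mul, mul_comm]
    _ = ∑ g : Equiv.Perm (Fin n), (Y.filter (fun y => E (g * Equiv.swap z y))).card := by
        simp only [card_filter]; rw [sum_comm]
    _ ≤ ∑ g : Equiv.Perm (Fin n), 1 := sum_le_sum fun g _ => h g
    _ = n.factorial := by simp [Fintype.card_perm]

theorem ptlem {n : ℕ} (P : Fin n → Fin n → Fin n → Fin n → Prop) (a1 a2 a3 z : Fin n)
    (h1 : a1 ≠ z) (h2 : a2 ≠ z) (h3 : a3 ≠ z)
    (hP : ∀ a b c t t', P a b c t → P a b c t' → t = t') :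
    (univ.filter (fun g : Equiv.Perm (Fin n) => P (g a1) (g a2) (g a3) (g z))).card * (n - 3) ≤ n.factorial := by
  have hY : n - 3 ≤ (univ \ {a1, a2, a3} : Finset (Fin n)).card := by
    rw [card_sdiff_of_subset (subset_univ _), card_univ, Fintype.card_fin]
    have := card_le_three (a := a1) (b := a2) (c := a3)
    omega
  refine (Nat.mul_le_mul_left _ hY).trans (swaplem _ z _ ?_)
  intro g
  rw [card_le_one]
  intro y hy y' hy'
  simp only [mem_filter, mem_sdiff, mem_univ, true_and, mem_insert, mem_singleton, not_or,
    Equiv.Perm.coe_mul, Function.comp_apply, Equiv.swap_apply_left] at hy hy'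
  obtain ⟨⟨q1, q2, q3⟩, hy⟩ := hy
  obtain ⟨⟨q1', q2', q3'⟩, hy'⟩ := hy'
  rw [Equiv.swap_apply_of_ne_of_ne h1 (Ne.symm q1), Equiv.swap_apply_of_ne_of_ne h2 (Ne.symm q2), Equiv.swap_apply_of_ne_of_ne h3 (Ne.symm q3)] at hy
  rw [Equiv.swap_apply_of_ne_of_ne h1 (Ne.symm q1'), Equiv.swap_apply_of_ne_of_ne h2 (Ne.symm q2'), Equiv.swap_apply_of_ne_of_ne h3 (Ne.symm q3')] at hy'
  exact g.injective (hP _ _ _ _ _ hy hy')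

theorem colsum {ι κ : Type*} [Fintype ι] [Fintype κ] {n : ℕ} (e : ι × κ ↪ Fin n) (δ : ι → ℝ)
    (hδ : ∀ j, δ j ≠ 0) (v : Fin n → ℝ) (hv : Function.Injective v) :
    (∑ g : Equiv.Perm (Fin n), Ncol (fun j b => δ j * v (g (e (j, b))))) * (n - 3) ≤
      n.factorial * ((Fintype.card ι * Fintype.card κ ^ 2)^2 + (n - 3) * (2 * (Fintype.card ι * Fintype.card κ ^ 2))) := by
  let Sp : (ι × κ × κ) × (ι × κ × κ) → Prop := fun q => q.2 = q.1 ∨ q.2 = (q.1.1, q.1.2.2, q.1.2.1)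
  have hq : ∀ q : (ι × κ × κ) × (ι × κ × κ), (univ.filter (fun g : Equiv.Perm (Fin n) =>
      (q.1.2.1 ≠ q.1.2.2 ∧ q.2.2.1 ≠ q.2.2.2) ∧
      δ q.1.1 * v (g (e (q.1.1, q.1.2.1))) - δ q.1.1 * v (g (e (q.1.1, q.1.2.2))) =
       δ q.2.1 * v (g (e (q.2.1, q.2.2.1))) - δ q.2.1 * v (g (e (q.2.1, q.2.2.2))))).card * (n - 3)
      ≤ n.factorial * (1 + (n-3) * (if Sp q then 1 else 0)) := by
    rintro ⟨⟨j, b, b'⟩, ⟨l, x, x'⟩⟩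
    by_cases hS : Sp ((j, b, b'), (l, x, x'))
    · simp only [hS, if_true]
      have : ∀ s : Finset (Equiv.Perm (Fin n)), s.card ≤ n.factorial := by
        intro s
        refine (card_le_univ s).trans ?_
        simp [Fintype.card_perm]
      refine (Nat.mul_le_mul_right _ (this _)).trans (Nat.mul_le_mul_left _ (by omega))
    · simp only [hS, if_false, mul_zero, add_zero, mul_one]
      by_cases hbx : b ≠ b' ∧ x ≠ x'
      swap
      · simp [hbx]
      simp only [hbx, ne_eq, not_false_eq_true, and_self, true_and]
      simp only [Sp, Prod.mk.injEq, not_or, not_and] at hS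
      by_cases hc1 : e (j, b) ≠ e (l, x') ∧ e (j, b') ≠ e (l, x')
      · refine ptlem (fun a b c t => δ j * v a - δ j * v b = δ l * v c - δ l * v t) (e (j,b)) (e (j, b')) (e (l, x)) (e (l, x')) hc1.1 hc1.2 ?_ ?_
        · intro h; exact hbx.2 (by simpa using h)
        · intro a b c t t' h h'
          exact hv (mul_left_cancel₀ (hδ l) (by linarith))
      by_cases hc2 : e (j, b) ≠ e (l, x) ∧ e (j, b') ≠ e (l, x)
      · refine ptlem (fun a b c t => δ j * v a - δ j * v b = δ l * v t - δ l * v c) (e (j,b)) (e (j, b')) (e (l, x')) (e (l, x)) hc2.1 hc2.2 ?_ ?_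
        · intro h; exact hbx.2 (by simpa using h.symm)
        · intro a b c t t' h h'
          exact hv (mul_left_cancel₀ (hδ l) (by linarith))
      exfalso
      simp only [ne_eq, EmbeddingLike.apply_eq_iff_eq, Prod.mk.injEq] at hc1 hc2
      grind
  have hsp : (univ.filter Sp).card ≤ 2 * (Fintype.card ι * Fintype.card κ ^ 2) := by
    have hsub : univ.filter Sp ⊆ univ.image (fun q : ι × κ × κ => (q, q)) ∪
        univ.image (fun q : ι × κ × κ => (q, (q.1, q.2.2, q.2.1))) := by
      rintro ⟨q, q'⟩ h
      rcases (mem_filter.1 h).2 with h | h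
      · exact mem_union_left _ (mem_image.2 ⟨q, mem_univ _, by simp at h; simp [h]⟩)
      · exact mem_union_right _ (mem_image.2 ⟨q, mem_univ _, by simp at h; simp [h]⟩)
    have hcard : (univ : Finset (ι × κ × κ)).card = Fintype.card ι * Fintype.card κ ^ 2 := by
      simp [sq]
    refine (card_le_card hsub).trans ((card_union_le _ _).trans ?_)
    rw [two_mul, ← hcard]
    exact add_le_add card_image_le card_image_le
  have hswap : (∑ g : Equiv.Perm (Fin n), Ncol (fun j b => δ j * v (g (e (j, b))))) =
      ∑ q : (ι × κ × κ) × (ι × κ × κ), (univ.filter (fun g : Equiv.Perm (Fin n) =>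
      (q.1.2.1 ≠ q.1.2.2 ∧ q.2.2.1 ≠ q.2.2.2) ∧
      δ q.1.1 * v (g (e (q.1.1, q.1.2.1))) - δ q.1.1 * v (g (e (q.1.1, q.1.2.2))) =
       δ q.2.1 * v (g (e (q.2.1, q.2.2.1))) - δ q.2.1 * v (g (e (q.2.1, q.2.2.2))))).card := by
    simp only [Ncol, card_filter]
    rw [sum_comm]
  rw [hswap, sum_mul]
  refine (sum_le_sum fun q _ => hq q).trans ?_
  rw [← mul_sum, sum_add_distrib, ← mul_sum, ← card_filter]
  gcongr
  simp only [sum_const, card_univ, Fintype.card_prod, smul_eq_mul, mul_one]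
  apply le_of_eq; ring

theorem blockthm {ι κ : Type*} [Fintype ι] [Fintype κ] {n : ℕ} (e : ι × κ ↪ Fin n) (o : κ)
    (w v : Fin n → ℝ) (β δ : ι → ℝ)
    (hδ : ∀ j, δ j ≠ 0) (hv : Function.Injective v)
    (hw : ∀ j b, w (e (j, b)) = β j + if b = o then δ j else 0) (x : ℝ)
    (hB : 2 ≤ Fintype.card κ) (hk : 4 ≤ Fintype.card ι) (hn : 4 ≤ n) :
    ((univ.filter (fun π : Equiv.Perm (Fin n) => ∑ i, w (π i) * v i = x)).card : ℝ) ≤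
      n.factorial * (3000 * (1 / (Fintype.card ι : ℝ)^2 +
        (((Fintype.card ι : ℝ) * Fintype.card κ ^ 2)^2 / ((n:ℝ) - 3) + 2 * (Fintype.card ι * (Fintype.card κ : ℝ) ^ 2)) / ((Fintype.card ι : ℝ)^2 * √(Fintype.card ι) * (Fintype.card κ : ℝ)^4))) := by
  let τ : (ι → κ) → Equiv.Perm (Fin n) := fun u =>
    Equiv.Perm.viaFintypeEmbedding (Equiv.prodCongrRight (fun j => Equiv.swap o (u j))) e
  have hτ : ∀ (u : ι → κ) (g : Equiv.Perm (Fin n)), ∑ m, w (τ u m) * v (g m) =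
      (∑ m, w m * v (g m) - ∑ j, δ j * v (g (e (j, o)))) + ∑ j, δ j * v (g (e (j, u j))) := by
    intro u g
    have h1 : ∑ m, (w (τ u m) - w m) * v (g m) = ∑ q : ι × κ, (w (e (q.1, Equiv.swap o (u q.1) q.2)) - w (e q)) * v (g (e q)) := by
      symm
      apply Fintype.sum_of_injective e e.injective
      · intro m hm
        have : τ u m = m := Equiv.Perm.viaFintypeEmbedding_apply_notMem_range _ _ hm
        rw [this]; simp
      · intro q
        have : τ u (e q) = e (q.1, Equiv.swap o (u q.1) q.2) :=
          Equiv.Perm.viaFintypeEmbedding_apply_image _ _ _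
        rw [this]
    have h2 : ∑ q : ι × κ, (w (e (q.1, Equiv.swap o (u q.1) q.2)) - w (e q)) * v (g (e q)) =
        ∑ j, (δ j * v (g (e (j, u j))) - δ j * v (g (e (j, o)))) := by
      rw [Fintype.sum_prod_type]
      refine sum_congr rfl fun j _ => ?_
      have h3 : ∀ b, (w (e (j, Equiv.swap o (u j) b)) - w (e (j, b))) * v (g (e (j, b))) =
        (if b = u j then δ j * v (g (e (j, b))) else 0) - (if b = o then δ j * v (g (e (j, b))) else 0) := by
        intro b
        rw [hw, hw]
        have : (Equiv.swap o (u j) b = o) ↔ b = u j := by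
          rw [Equiv.swap_apply_eq_iff, Equiv.swap_apply_left]
        simp only [this]
        split_ifs <;> ring
      simp only [h3, sum_sub_distrib, sum_ite_eq', mem_univ, if_true]
    rw [h2] at h1
    simp only [sub_mul, sum_sub_distrib] at h1
    linarith
  set k := Fintype.card ι with hkdef
  set B := Fintype.card κ with hBdef
  set cnt := (univ.filter (fun π : Equiv.Perm (Fin n) => ∑ i, w (π i) * v i = x)).card with hcnt
  have hshift : ∀ u, cnt = (univ.filter (fun π : Equiv.Perm (Fin n) => ∑ i, w (τ u (π i)) * v i = x)).card := by
    intro u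
    symm
    apply card_bij (fun π _ => τ u * π)
    · intro g hg; simpa using hg
    · intro a _ b _ hab; exact mul_left_cancel hab
    · intro b hb
      exact ⟨(τ u)⁻¹ * b, by simpa using hb, by simp⟩
  have hsum : (cnt : ℝ) * B^k = ∑ π : Equiv.Perm (Fin n), ((univ.filter (fun u : ι → κ => ∑ i, w (τ u (π i)) * v i = x)).card : ℝ) := by
    have : cnt * B^k = ∑ π : Equiv.Perm (Fin n), (univ.filter (fun u : ι → κ => ∑ i, w (τ u (π i)) * v i = x)).card := by
      have h1 : cnt * B^k = ∑ u : ι → κ, cnt := by simp [hkdef, hBdef, mul_comm]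
      rw [h1, sum_congr rfl (fun u _ => hshift u)]
      simp only [card_filter]; rw [sum_comm]
    exact_mod_cast this
  have hper : ∀ π : Equiv.Perm (Fin n), ((univ.filter (fun u : ι → κ => ∑ i, w (τ u (π i)) * v i = x)).card : ℝ)
      ≤ (B:ℝ)^k * (3000 * (1 / (k : ℝ)^2 + Ncol (fun j b => δ j * v (π⁻¹ (e (j, b)))) / ((k : ℝ)^2 * √k * (B : ℝ)^4))) := by
    intro π
    have h1 := coreR (fun j b => δ j * v (π⁻¹ (e (j, b)))) (fun j b b' h => by
      have := e.injective ((π⁻¹).injective (hv (mul_left_cancel₀ (hδ j) h)))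
      simpa using this) (x - (∑ m, w m * v (π⁻¹ m) - ∑ j, δ j * v (π⁻¹ (e (j, o))))) hB hk
    refine le_trans (le_of_eq ?_) h1
    congr 2
    ext u
    simp only [mem_filter, mem_univ, true_and]
    have h2 : ∑ i, w (τ u (π i)) * v i = ∑ m, w (τ u m) * v (π⁻¹ m) := by
      refine Fintype.sum_equiv π _ _ fun i => ?_
      simp
    rw [h2, hτ u]
    constructor <;> intro h <;> linarith
  have hcol := colsum e δ hδ v hv
  have hinv : ∑ π : Equiv.Perm (Fin n), Ncol (fun j b => δ j * v (π⁻¹ (e (j, b)))) =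
      ∑ g : Equiv.Perm (Fin n), Ncol (fun j b => δ j * v (g (e (j, b)))) :=
    Fintype.sum_equiv (Equiv.inv _) _ _ fun i => rfl
  rw [← hinv] at hcol
  have hcol' : (∑ π : Equiv.Perm (Fin n), (Ncol (fun j b => δ j * v (π⁻¹ (e (j, b)))) : ℝ)) * ((n:ℝ) - 3) ≤
      n.factorial * (((k:ℝ) * B ^ 2)^2 + ((n:ℝ) - 3) * (2 * (k * (B:ℝ) ^ 2))) := by
    have h3 : ((n - 3 : ℕ) : ℝ) = (n:ℝ) - 3 := by push_cast [Nat.cast_sub (by omega : 3 ≤ n)]; ring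
    rw [← h3]
    exact_mod_cast hcol
  have hn3 : (0:ℝ) < (n:ℝ) - 3 := by
    have : (4:ℝ) ≤ n := by exact_mod_cast hn
    linarith
  have hkr : (4:ℝ) ≤ k := by exact_mod_cast hk
  have hBr : (2:ℝ) ≤ B := by exact_mod_cast hB
  have hsk : (0:ℝ) < √k := Real.sqrt_pos.2 (by linarith)
  have hcol2 : (∑ π : Equiv.Perm (Fin n), (Ncol (fun j b => δ j * v (π⁻¹ (e (j, b)))) : ℝ)) ≤
      n.factorial * (((k:ℝ) * B ^ 2)^2 / ((n:ℝ) - 3) + 2 * (k * (B:ℝ) ^ 2)) := by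
    rw [← le_div_iff₀ hn3] at hcol'
    refine hcol'.trans (le_of_eq ?_)
    field_simp
  have htot : (cnt : ℝ) * B^k ≤ B^k * (n.factorial * (3000 * (1 / (k : ℝ)^2 +
        (((k : ℝ) * B ^ 2)^2 / ((n:ℝ) - 3) + 2 * (k * (B : ℝ) ^ 2)) / ((k : ℝ)^2 * √k * (B : ℝ)^4)))) := by
    rw [hsum]
    refine (sum_le_sum fun π _ => hper π).trans ?_
    rw [← mul_sum, ← mul_sum, sum_add_distrib, sum_const, card_univ, Fintype.card_perm, Fintype.card_fin, nsmul_eq_mul, ← sum_div]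
    apply mul_le_mul_of_nonneg_left _ (by positivity)
    rw [mul_left_comm]
    apply mul_le_mul_of_nonneg_left _ (by positivity)
    rw [mul_add]
    refine add_le_add le_rfl ?_
    rw [← mul_div_assoc]
    gcongr
  rw [mul_comm] at htot
  exact le_of_mul_le_mul_left htot (by positivity)

theorem blocknum {ι κ : Type*} [Fintype ι] [Fintype κ] {n : ℕ} (e : ι × κ ↪ Fin n) (o : κ)
    (w v : Fin n → ℝ) (β δ : ι → ℝ)
    (hδ : ∀ j, δ j ≠ 0) (hv : Function.Injective v)
    (hw : ∀ j b, w (e (j, b)) = β j + if b = o then δ j else 0) (x : ℝ)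
    (hB : 2 ≤ Fintype.card κ) (hk : 4 ≤ Fintype.card ι) (hn : 6 ≤ n)
    (h1 : n ≤ 2 * (Fintype.card ι * Fintype.card κ)) (h2 : n ≤ Fintype.card ι ^ 2)
    (h3 : Fintype.card ι ≤ n) :
    ((univ.filter (fun π : Equiv.Perm (Fin n) => ∑ i, w (π i) * v i = x)).card : ℝ) ≤
      n.factorial * (21000 / (Fintype.card ι * √n)) := by
  refine (blockthm e o w v β δ hδ hv hw x hB hk (by omega)).trans ?_
  apply mul_le_mul_of_nonneg_left _ (by positivity)
  set k := Fintype.card ι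
  set B := Fintype.card κ
  have hkr : (4:ℝ) ≤ k := by exact_mod_cast hk
  have hBr : (2:ℝ) ≤ B := by exact_mod_cast hB
  have hnr : (6:ℝ) ≤ n := by exact_mod_cast hn
  have h1r : (n:ℝ) ≤ 2 * (k * B) := by exact_mod_cast h1
  have h2r : (n:ℝ) ≤ k ^ 2 := by exact_mod_cast h2
  have h3r : (k:ℝ) ≤ n := by exact_mod_cast h3
  have hsk : (0:ℝ) < √k := Real.sqrt_pos.2 (by linarith)
  have hsk2 : √(k:ℝ) * √k = k := Real.mul_self_sqrt (by linarith)
  have hsn : (0:ℝ) < √n := Real.sqrt_pos.2 (by linarith)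
  have hsn2 : √(n:ℝ) * √n = n := Real.mul_self_sqrt (by linarith)
  have hsnk : √(n:ℝ) ≤ k := Real.sqrt_le_iff.2 ⟨by linarith, h2r⟩
  have hskn : √(k:ℝ) ≤ √n := Real.sqrt_le_sqrt h3r
  have a1 : 1/(k:ℝ)^2 ≤ 1 / (k * √n) := by
    apply one_div_le_one_div_of_le (by positivity)
    nlinarith
  have a0 : (k:ℝ) * √n ≤ n * √k := by
    have : (k:ℝ) * √n = √k * √n * √k := by nlinarith
    have h' : (n:ℝ) * √k = √n * √n * √k := by rw [hsn2]
    rw [this, h']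
    gcongr
  have a2 : 1/(((n:ℝ) - 3) * √k) ≤ 2 / (k * √n) := by
    rw [div_le_div_iff₀ (by apply mul_pos; linarith; positivity) (by positivity)]
    nlinarith
  have a3 : 2/((k:ℝ) * B^2 * √k) ≤ 4 / (k * √n) := by
    rw [div_le_div_iff₀ (by positivity) (by positivity)]
    have : (n:ℝ) ≤ 2 * (k * B^2) := by nlinarith
    have := mul_le_mul_of_nonneg_right this hsk.le
    nlinarith
  have hn3 : (n:ℝ) - 3 ≠ 0 := by linarith
  have key : (((k : ℝ) * B ^ 2)^2 / ((n:ℝ) - 3) + 2 * (k * (B : ℝ) ^ 2)) / ((k : ℝ)^2 * √k * (B : ℝ)^4) = 1/(((n:ℝ) - 3) * √k) + 2/((k:ℝ) * B^2 * √k) := by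
    field_simp
  rw [key]
  have : 21000 / ((k:ℝ) * √n) = 3000 * (1 / (k * √n) + (2 / (k * √n) + 4 / (k * √n))) := by ring
  rw [this]
  gcongr

theorem trivbound {n : ℕ} (w v : Fin n → ℝ) (hv : Function.Injective v) (t x : ℝ) (z : Fin n) (hz : w z ≠ t) :
    (univ.filter (fun π : Equiv.Perm (Fin n) => ∑ i, w (π i) * v i = x)).card *
      (univ.filter (fun i : Fin n => w i = t)).card ≤ n.factorial := by
  have h1 : (univ.filter (fun π : Equiv.Perm (Fin n) => ∑ i, w (π i) * v i = x)).card =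
      (univ.filter (fun g : Equiv.Perm (Fin n) => ∑ m, w m * v (g m) = x)).card := by
    have hs : ∀ π : Equiv.Perm (Fin n), ∑ i, w (π i) * v i = ∑ m, w m * v (π⁻¹ m) := by
      intro π
      refine Fintype.sum_equiv π _ _ fun i => ?_
      simp
    apply card_bij (fun π _ => π⁻¹)
    · intro π hπ
      simp only [mem_filter, mem_univ, true_and] at hπ ⊢
      rw [← hs, hπ]
    · intro a _ b _ hab; exact inv_injective hab
    · intro b hb
      refine ⟨b⁻¹, ?_, inv_inv b⟩
      simp only [mem_filter, mem_univ, true_and] at hb ⊢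
      rw [hs, inv_inv, hb]
  rw [h1]
  apply swaplem _ z
  intro g
  rw [card_le_one]
  have key : ∀ y, w y = t → ∑ m, w m * v ((g * Equiv.swap z y) m) = ∑ m, w m * v (g m) + ((t - w z) * v (g z) + (w z - t) * v (g y)) := by
    intro y hy
    have hzy : z ≠ y := fun h => hz (h ▸ hy)
    have e1 : ∑ m, w m * v ((g * Equiv.swap z y) m) = ∑ m, w (Equiv.swap z y m) * v (g m) := by
      refine Fintype.sum_equiv (Equiv.swap z y) _ _ fun i => ?_
      simp
    have e2 : ∑ m, (w (Equiv.swap z y m) - w m) * v (g m) = (t - w z) * v (g z) + (w z - t) * v (g y) := by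
      have e3 : ∀ m, (w (Equiv.swap z y m) - w m) * v (g m) = (if m = z then (t - w z) * v (g z) else 0) + (if m = y then (w z - t) * v (g y) else 0) := by
        intro m
        by_cases h1 : m = z
        · subst h1; simp [hzy, hy]
        · by_cases h2 : m = y
          · subst h2; simp [h1, hy]
          · rw [Equiv.swap_apply_of_ne_of_ne h1 h2]; simp [h1, h2]
      simp only [e3, sum_add_distrib, sum_ite_eq', mem_univ, if_true]
    rw [e1, ← e2, ← sum_add_distrib]
    refine sum_congr rfl fun m _ => ?_
    ring
  intro y hy y' hy'
  simp only [mem_filter, mem_univ, true_and] at hy hy'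
  have a := hy.2
  have a' := hy'.2
  rw [key y hy.1] at a
  rw [key y' hy'.1] at a'
  have : (w z - t) * v (g y) = (w z - t) * v (g y') := by linarith
  exact g.injective (hv (mul_left_cancel₀ (sub_ne_zero.2 hz) this))

theorem caseI {n : ℕ} (w v : Fin n → ℝ) (hv : Function.Injective v) (t x : ℝ) (hn : 16 ≤ n)
    (h2 : n ≤ 2 * (univ.filter (fun i : Fin n => w i = t)).card)
    (hk : 0 < (univ.filter (fun i : Fin n => w i ≠ t)).card) :
    ((univ.filter (fun π : Equiv.Perm (Fin n) => ∑ i, w (π i) * v i = x)).card : ℝ) ≤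
      n.factorial * (21000 / ((univ.filter (fun i : Fin n => w i ≠ t)).card * √n)) := by
  have hsum : (univ.filter (fun i : Fin n => w i = t)).card + (univ.filter (fun i : Fin n => w i ≠ t)).card = n := by
    rw [card_filter_add_card_filter_not]; simp
  set k := (univ.filter (fun i : Fin n => w i ≠ t)).card with hkdef
  set m := (univ.filter (fun i : Fin n => w i = t)).card with hmdef
  by_cases hkn : k^2 < n
  · obtain ⟨z, hz⟩ := card_pos.1 hk
    have h3 := trivbound w v hv t x z (mem_filter.1 hz).2
    rw [← hmdef] at h3
    have h3r : ((univ.filter (fun π : Equiv.Perm (Fin n) => ∑ i, w (π i) * v i = x)).card : ℝ) * m ≤ n.factorial := by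
      exact_mod_cast h3
    have h2r : (n:ℝ) ≤ 2 * m := by exact_mod_cast h2
    have hnr : (16:ℝ) ≤ n := by exact_mod_cast hn
    have hkr : (0:ℝ) < k := by exact_mod_cast hk
    have hknr : (k:ℝ)^2 ≤ n := by exact_mod_cast hkn.le
    have hsn : (0:ℝ) < √n := Real.sqrt_pos.2 (by linarith)
    have hsn2 : √(n:ℝ) * √n = n := Real.mul_self_sqrt (by linarith)
    have hks : (k:ℝ) ≤ √n := Real.le_sqrt_of_sq_le hknr
    rw [← mul_div_assoc, le_div_iff₀ (by positivity)]
    have h5 : (k:ℝ) * √n ≤ n := by nlinarith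
    have h6 : (k:ℝ) * √n ≤ 2 * m := h5.trans h2r
    have h7 := mul_le_mul_of_nonneg_left h6 (Nat.cast_nonneg (α := ℝ) (univ.filter (fun π : Equiv.Perm (Fin n) => ∑ i, w (π i) * v i = x)).card)
    have : (0:ℝ) ≤ n.factorial := by positivity
    linarith
  · push Not at hkn
    have hk4 : 4 ≤ k := by nlinarith
    have hB2 : 2 ≤ n / k := (Nat.le_div_iff_mul_le hk).2 (by omega)
    have hkB : k * (n / k) ≤ n := Nat.mul_div_le n k
    have hkB' : n < k * (n / k) + k := Nat.lt_mul_div_succ n hk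
    obtain ⟨b, hb⟩ : ∃ b, n / k = b + 1 := ⟨n / k - 1, by omega⟩
    rw [hb] at hkB hkB' hB2
    have hcι : Fintype.card {i // w i ≠ t} = k := by rw [Fintype.card_subtype]
    have hcm : Fintype.card {i // w i = t} = m := by rw [Fintype.card_subtype]
    have hemb : Nonempty ({i // w i ≠ t} × Fin b ↪ {i // w i = t}) := by
      apply Function.Embedding.nonempty_of_card_le
      rw [Fintype.card_prod, hcι, hcm, Fintype.card_fin]
      rw [mul_add] at hkB
      omega
    obtain ⟨f⟩ := hemb
    let e : {i // w i ≠ t} × Option (Fin b) ↪ Fin n :=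
      ⟨fun q => match q.2 with
        | none => q.1.1
        | some c => (f (q.1, c)).1, by
        rintro ⟨j, _ | c⟩ ⟨j', _ | c'⟩ h
        · simp only at h
          rw [Subtype.ext h]
        · simp only at h
          exact absurd (h ▸ (f (j', c')).2) j.2
        · simp only at h
          exact absurd (h ▸ (f (j, c)).2) j'.2
        · simp only at h
          have := f.injective (Subtype.ext h)
          simp only [Prod.mk.injEq] at this
          simp [this.1, this.2]⟩
    have hfin := blocknum e none w v (fun _ => t) (fun j => w j.1 - t) (fun j => sub_ne_zero.2 j.2) hv
      (by
        rintro j (_ | c)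
        · have h1 : e (j, none) = j.1 := rfl
          rw [h1]; simp
        · have h1 : e (j, some c) = (f (j, c)).1 := rfl
          rw [h1, (f (j, c)).2]; simp) x
      (by simpa using hB2) (by rw [hcι]; exact hk4) (by omega)
      (by rw [hcι]; simp only [Fintype.card_option, Fintype.card_fin]; omega)
      (by rw [hcι]; exact hkn) (by rw [hcι]; omega)
    rw [hcι] at hfin
    exact hfin

theorem caseII {n : ℕ} (w v : Fin n → ℝ) (hv : Function.Injective v) (x : ℝ) (hn : 16 ≤ n)
    (h2 : ∀ t, 2 * (univ.filter (fun i : Fin n => w i = t)).card < n) :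
    ((univ.filter (fun π : Equiv.Perm (Fin n) => ∑ i, w (π i) * v i = x)).card : ℝ) ≤
      n.factorial * (63000 / (n * √n)) := by
  set σ := Tuple.sort w
  have hmono : Monotone (w ∘ σ) := Tuple.monotone_sort w
  obtain ⟨h, hh⟩ : ∃ h, h = n / 2 := ⟨_, rfl⟩
  have hh1 : 2 * h ≤ n := by omega
  have hh2 : n < 2 * h + 2 := by omega
  let lo : Fin h → Fin n := fun j => ⟨j.1, by omega⟩
  let hi : Fin h → Fin n := fun j => ⟨j.1 + h, by omega⟩
  have hne : ∀ j, w (σ (lo j)) ≠ w (σ (hi j)) := by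
    intro j hj
    have hsub : (Finset.Icc (lo j) (hi j)).image σ ⊆ univ.filter (fun i : Fin n => w i = w (σ (hi j))) := by
      intro i hi'
      obtain ⟨a, ha, rfl⟩ := mem_image.1 hi'
      rw [mem_Icc] at ha
      have q1 := hmono ha.1
      have q2 := hmono ha.2
      simp only [Function.comp_apply] at q1 q2
      simp only [mem_filter, mem_univ, true_and]
      linarith
    have hc := card_le_card hsub
    rw [card_image_of_injective _ σ.injective, Fin.card_Icc] at hc
    have := h2 (w (σ (hi j)))
    simp only [lo, hi] at hc this
    omega
  let e : Fin h × Bool ↪ Fin n :=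
    ⟨fun q => if q.2 = true then σ (lo q.1) else σ (hi q.1), by
      rintro ⟨j, b⟩ ⟨j', b'⟩ hq
      have p1 := j.2
      have p2 := j'.2
      cases b <;> cases b' <;> simp [lo, hi, Fin.ext_iff] at hq ⊢ <;> omega⟩
  have hfin := blocknum e true w v (fun j => w (σ (hi j))) (fun j => w (σ (lo j)) - w (σ (hi j)))
    (fun j => sub_ne_zero.2 (hne j)) hv
    (by
      intro j b
      cases b
      · have h1 : e (j, false) = σ (hi j) := rfl
        rw [h1]; simp
      · have h1 : e (j, true) = σ (lo j) := rfl
        rw [h1]; simp) x (by simp) (by simp; omega) (by omega)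
    (by simp; omega) (by rw [Fintype.card_fin]; nlinarith) (by simp; omega)
  rw [Fintype.card_fin] at hfin
  refine hfin.trans ?_
  apply mul_le_mul_of_nonneg_left _ (by positivity)
  have hnr : (16:ℝ) ≤ n := by exact_mod_cast hn
  have hsn : (0:ℝ) < √n := Real.sqrt_pos.2 (by linarith)
  have h3 : (n:ℝ) ≤ 3 * h := by exact_mod_cast (by omega : n ≤ 3 * h)
  have h0 : (0:ℝ) < h := by linarith
  rw [div_le_div_iff₀ (by positivity) (by positivity)]
  nlinarith

theorem stmt_4 :
    ∃ C : ℝ, 0 < C ∧ ∀ (n : ℕ) (w v : Fin n → ℝ) (ε : ℝ), 1 ≤ n → 0 < ε →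
      Function.Injective v →
      (∀ t : ℝ, ((Finset.univ.filter (fun i : Fin n => w i = t)).card : ℝ) ≤ (1 - ε) * n) →
      ∀ x : ℝ,
        ((Finset.univ.filter (fun π : Equiv.Perm (Fin n) =>
            ∑ i, w (π i) * v i = x)).card : ℝ) / (Nat.factorial n : ℝ)
          ≤ C / (ε * (n : ℝ) ^ ((3 : ℝ) / 2)) := by
  refine ⟨63000, by norm_num, ?_⟩
  intro n w v ε hn hε hv hw x
  have hnr : (1:ℝ) ≤ n := by exact_mod_cast hn
  have hsn : (0:ℝ) < √n := Real.sqrt_pos.2 (by linarith)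
  have hsn2 : √(n:ℝ) * √n = n := Real.mul_self_sqrt (by linarith)
  have hpow : (n : ℝ) ^ ((3 : ℝ) / 2) = n * √n := by
    rw [show (3:ℝ)/2 = 1 + 1/2 by norm_num, Real.rpow_add (by linarith), Real.rpow_one, Real.sqrt_eq_rpow]
  have hε1 : ε ≤ 1 := by
    by_contra hcon
    push Not at hcon
    have h1 := hw 0
    have h2 : (0:ℝ) ≤ ((Finset.univ.filter (fun i : Fin n => w i = 0)).card : ℝ) := by positivity
    nlinarith
  have hf : (0:ℝ) < n.factorial := by exact_mod_cast n.factorial_pos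
  rw [hpow, div_le_iff₀ hf, mul_comm]
  by_cases hn16 : 16 ≤ n
  · by_cases hc : ∃ t, n ≤ 2 * (univ.filter (fun i : Fin n => w i = t)).card
    · obtain ⟨t, ht⟩ := hc
      have hsum : (univ.filter (fun i : Fin n => w i = t)).card + (univ.filter (fun i : Fin n => w i ≠ t)).card = n := by
        rw [card_filter_add_card_filter_not]; simp
      have hsumr : ((univ.filter (fun i : Fin n => w i = t)).card : ℝ) + (univ.filter (fun i : Fin n => w i ≠ t)).card = n := by
        exact_mod_cast hsum
      have hke : ε * n ≤ (univ.filter (fun i : Fin n => w i ≠ t)).card := by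
        have := hw t
        linarith
      have hen : 0 < ε * n := by positivity
      have hk : 0 < (univ.filter (fun i : Fin n => w i ≠ t)).card := by
        exact_mod_cast hen.trans_le hke
      refine (caseI w v hv t x hn16 ht hk).trans ?_
      apply mul_le_mul_of_nonneg_left _ hf.le
      rw [← mul_assoc]
      apply div_le_div₀ (by norm_num) (by norm_num) (by positivity)
      gcongr
    · push Not at hc
      refine (caseII w v hv x hn16 hc).trans ?_
      apply mul_le_mul_of_nonneg_left _ hf.le
      apply div_le_div_of_nonneg_left (by norm_num) (by positivity)
      have : 0 < (n:ℝ) * √n := by positivity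
      nlinarith
  · have h1 : ((univ.filter (fun π : Equiv.Perm (Fin n) => ∑ i, w (π i) * v i = x)).card : ℝ) ≤ n.factorial := by
      have := card_le_univ (univ.filter (fun π : Equiv.Perm (Fin n) => ∑ i, w (π i) * v i = x))
      rw [Fintype.card_perm, Fintype.card_fin] at this
      exact_mod_cast this
    refine h1.trans (le_mul_of_one_le_right hf.le ?_)
    rw [one_le_div (by positivity)]
    have h16 : (n:ℝ) ≤ 16 := by exact_mod_cast (by omega : n ≤ 16)
    have hs4 : √(n:ℝ) ≤ 16 := Real.sqrt_le_iff.2 ⟨by norm_num, by linarith⟩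
    have : (n:ℝ) * √n ≤ 16 * 16 := by gcongr
    have h0 : 0 < (n:ℝ) * √n := by positivity
    nlinarith
end
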